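/- Let (u, B) be a weak solution of the ideal incompressible MHD equations on 𝕋³×(0,T) with both u and B weakly divergence-free, and suppose that for some exponents 0 < α₁ < α₂ < 1 one has u ∈ L²((0,T); B^{α₂}_{4,∞}(𝕋³)) and B ∈ L²((0,T); B^{−α₁}_{4,∞}(𝕋³)) (in addition to u, B ∈ L^∞((0,T); L²(𝕋³))). Then the magnetic helicity is conserved: ∫_{𝕋³} A·B (x,t₁) dx = ∫_{𝕋³} A·B (x,t₂) dx for almost every t₁, t₂ ∈ (0,T), where A = ∇×(−Δ)^{-1}B is the divergence-free magnetic vector potential. -/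

import Mathlib

open MeasureTheory Filter Topology Complex
open scoped ENNReal Real NNReal

noncomputable section

namespace PaperHelicity

/-! Spatial points: we model the torus `𝕋³` by ℤ³-periodic functions on
Euclidean space `ℝ³`, with the cube `[0,1)³` as fundamental domain. -/

abbrev Vec : Type := EuclideanSpace ℝ (Fin 3)

/-- The integer lattice `ℤ³`. -/
abbrev Lat : Type := Fin 3 → ℤ

/-- Embedding of the lattice into space. -/
def latv (n : Lat) : Vec := (WithLp.equiv 2 (Fin 3 → ℝ)).symm fun i => (n i : ℝ)

/-- A fundamental domain for the torus. -/
def cube : Set Vec := {x : Vec | ∀ i, 0 ≤ x i ∧ x i < 1}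

/-- The measure on the torus: Lebesgue measure restricted to the fundamental domain. -/
def μT : Measure Vec := volume.restrict cube

/-- Lebesgue measure on the time interval `(0,T)`. -/
def tIoo (T : ℝ) : Measure ℝ := volume.restrict (Set.Ioo 0 T)

/-- ℤ³-periodicity. -/
def Per {E : Type*} (f : Vec → E) : Prop := ∀ (x : Vec) (n : Lat), f (x + latv n) = f x

/-- The Fourier character `e^{2πi n·x}`. -/
def chr (n : Lat) (x : Vec) : ℂ :=
  Complex.exp (2 * Real.pi * Complex.I * (∑ i, (n i : ℂ) * (x i : ℂ)))

/-- Fourier coefficient on the torus. -/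
def fc (f : Vec → ℂ) (n : Lat) : ℂ := ∫ x in cube, f x * (starRingEnd ℂ) (chr n x)

/-- Euclidean norm of a lattice point. -/
def latNorm (n : Lat) : ℝ := Real.sqrt (∑ i, ((n i : ℝ)) ^ 2)

def latSq (n : Lat) : ℝ := ∑ i, ((n i : ℝ)) ^ 2

/-- Squared Sobolev `H^s` norm of a (periodic distribution given by its) Fourier
coefficient sequence. -/
def sobSqC (s : ℝ) (c : Lat → ℂ) : ℝ≥0∞ :=
  ∑' n : Lat, ENNReal.ofReal ((1 + latNorm n ^ 2) ^ s * ‖c n‖ ^ 2)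

def HsNormC (s : ℝ) (c : Lat → ℂ) : ℝ≥0∞ := sobSqC s c ^ (1/2 : ℝ)

def HsNorm (s : ℝ) (f : Vec → ℂ) : ℝ≥0∞ := HsNormC s (fc f)

/-- `H^s` norm of an `ℝ³`-valued field. -/
def HsNormV (s : ℝ) (u : Vec → Vec) : ℝ≥0∞ := ∑ j : Fin 3, HsNorm s fun x => (u x j : ℂ)

/-- The `j`-th dyadic shell in frequency space. -/
def shell (j : ℕ) : Set Lat := {n | (2:ℝ) ^ j ≤ latNorm n ∧ latNorm n < (2:ℝ) ^ (j + 1)}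

/-- Littlewood-Paley block of a coefficient sequence (a finite trigonometric sum). -/
def lpBlockC (j : ℕ) (c : Lat → ℂ) (x : Vec) : ℂ :=
  ∑' n : Lat, (shell j).indicator (fun m => c m * chr m x) n

/-- Low-frequency Littlewood-Paley block. -/
def lpLowC (c : Lat → ℂ) (x : Vec) : ℂ :=
  ∑' n : Lat, ({m : Lat | latNorm m < 1}).indicator (fun m => c m * chr m x) n

/-- Besov `B^s_{p,q}` norm of a coefficient sequence, via Littlewood-Paley decomposition. -/
def besovC (s : ℝ) (p q : ℝ≥0∞) (c : Lat → ℂ) : ℝ≥0∞ :=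
  eLpNorm (lpLowC c) p μT +
    if q = ∞ then ⨆ j : ℕ, ENNReal.ofReal ((2:ℝ) ^ (s * (j:ℝ))) * eLpNorm (lpBlockC j c) p μT
    else (∑' j : ℕ, (ENNReal.ofReal ((2:ℝ) ^ (s * (j:ℝ))) * eLpNorm (lpBlockC j c) p μT)
      ^ q.toReal) ^ (1 / q.toReal)

def besov (s : ℝ) (p q : ℝ≥0∞) (f : Vec → ℂ) : ℝ≥0∞ := besovC s p q (fc f)

def besovV (s : ℝ) (p q : ℝ≥0∞) (u : Vec → Vec) : ℝ≥0∞ :=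
  ∑ j : Fin 3, besov s p q fun x => (u x j : ℂ)

/-- Reconstruction of a function from its Fourier coefficients. -/
def recon (c : Lat → ℂ) (x : Vec) : ℂ := ∑' n : Lat, c n * chr n x

/-- The `L^r((0,T))` norm (in time) of a nonnegative quantity. -/
def timeNorm (r : ℝ≥0∞) (T : ℝ) (F : ℝ → ℝ≥0∞) : ℝ≥0∞ :=
  if r = ∞ then essSup F (tIoo T)
  else (∫⁻ t, F t ^ r.toReal ∂tIoo T) ^ (1 / r.toReal)

/-- Spatial partial derivative in the `i`-th coordinate direction. -/
def pd {E : Type*} [NormedAddCommGroup E] [NormedSpace ℝ E] (i : Fin 3) (g : Vec → E)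
    (x : Vec) : E :=
  fderiv ℝ g x (EuclideanSpace.single i (1:ℝ))

/-- Time derivative of a time-dependent field. -/
def tderiv {E : Type*} [NormedAddCommGroup E] [NormedSpace ℝ E] (f : ℝ → Vec → E)
    (t : ℝ) (x : Vec) : E :=
  deriv (fun s => f s x) t

/-- Laplacian. -/
def lap (g : Vec → ℝ) (x : Vec) : ℝ := ∑ i, pd i (fun y => pd i g y) x

/-- Test functions on `𝕋³ × (0,T)`: smooth, ℤ³-periodic in space, compactly supported
in time inside `(0,T)`. -/
structure TestFun (T : ℝ) (E : Type*) [NormedAddCommGroup E] [NormedSpace ℝ E] where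
  f : ℝ → Vec → E
  smooth : ContDiff ℝ (⊤ : ℕ∞) (Function.uncurry f)
  periodic : ∀ t, Per (f t)
  compactIn : ∃ a b : ℝ, 0 < a ∧ b < T ∧ ∀ t, t ∉ Set.Icc a b → f t = 0

/-- Purely spatial test functions on `𝕋³`. -/
structure SpTest (E : Type*) [NormedAddCommGroup E] [NormedSpace ℝ E] where
  f : Vec → E
  smooth : ContDiff ℝ (⊤ : ℕ∞) f
  periodic : Per f

/-- A divergence-free (vector-valued) test function. -/
def DivFreeT {T : ℝ} (ζ : TestFun T Vec) : Prop :=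
  ∀ t x, ∑ i, pd i (fun y => ζ.f t y i) x = 0

/-- A time-dependent field is weakly divergence free. -/
def WeakDivFree (T : ℝ) (u : ℝ → Vec → Vec) : Prop :=
  ∀ φ : TestFun T ℝ,
    (∫ t in Set.Ioo 0 T, ∫ x in cube, ∑ i, u t x i * pd i (φ.f t) x) = 0

def eulerIntegrand (u : ℝ → Vec → Vec) (ζ ζt : ℝ → Vec → Vec) (t : ℝ) : ℝ :=
  ∫ x in cube,
    ((∑ j, u t x j * ζt t x j) + ∑ i, ∑ j, u t x i * u t x j * pd i (fun y => ζ t y j) x)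

/-- `u` is a weak solution of the incompressible Euler equations (standard sense). -/
def EulerWeak (T : ℝ) (u : ℝ → Vec → Vec) : Prop :=
  ∀ ζ : TestFun T Vec, DivFreeT ζ →
    (∫ t in Set.Ioo 0 T, eulerIntegrand u ζ.f (tderiv ζ.f) t) = 0

/-- Fourier coefficients of the vorticity `ω = ∇ × u` (a distribution). -/
def curlC (u : Vec → Vec) (n : Lat) (j : Fin 3) : ℂ :=
  2 * Real.pi * Complex.I *
    ((n (j + 1) : ℂ) * fc (fun x => (u x (j + 2) : ℂ)) n -
     (n (j + 2) : ℂ) * fc (fun x => (u x (j + 1) : ℂ)) n)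

def ωC (u : Vec → Vec) (j : Fin 3) : Lat → ℂ := fun n => curlC u n j

def uC (u : Vec → Vec) (i : Fin 3) : Vec → ℂ := fun x => (u x i : ℂ)

/-- Duality pairing of a periodic distribution (given by its Fourier coefficients)
with a function. -/
def dpair (c : Lat → ℂ) (g : Vec → ℂ) : ℂ := ∑' n : Lat, c n * fc g (-n)

/-- The integrand (in time) of the weak vorticity formulation, with the nonlinearity
interpreted by duality/paraproducts: `⟨ω, ∂ₜψ⟩ + ⟨u⊗ω - ω⊗u, ∇ψ⟩`. -/
def vortIntegrand (u : Vec → Vec) (ψ ψt : Vec → Vec) : ℂ :=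
  (∑ j, dpair (ωC u j) fun x => (ψt x j : ℂ)) +
    ∑ i, ∑ j,
      (dpair (ωC u j) (fun x => ((u x i * pd i (fun y => ψ y j) x : ℝ) : ℂ)) -
       dpair (ωC u i) (fun x => ((u x j * pd i (fun y => ψ y j) x : ℝ) : ℂ)))

/-- The weak (paraproduct) formulation of the vorticity equation. -/
def VortWeak (T : ℝ) (u : ℝ → Vec → Vec) : Prop :=
  ∀ ψ : TestFun T Vec,
    (∫ t in Set.Ioo 0 T, vortIntegrand (u t) (ψ.f t) (tderiv ψ.f t)) = 0

/-- `(u, ω)` (with `ω = ∇ × u` determined by `u`) is a functional vorticity solution of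
the Euler equations. -/
def IsFVS (T : ℝ) (u : ℝ → Vec → Vec) : Prop :=
  Measurable (Function.uncurry u) ∧ (∀ t, Per (u t)) ∧
    (∃ ε > 0, timeNorm ∞ T (fun t => HsNormV (1/2 + ε) (u t)) < ∞) ∧
    WeakDivFree T u ∧ VortWeak T u

/-- A standard radial smooth compactly supported mollifier of total mass one. -/
structure Mollifier where
  φ : Vec → ℝ
  smooth : ContDiff ℝ (⊤ : ℕ∞) φ
  cpt : HasCompactSupport φ
  nonneg : ∀ x, 0 ≤ φ x
  radial : ∀ x y : Vec, ‖x‖ = ‖y‖ → φ x = φ y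
  mass : (∫ x : Vec, φ x) = 1

/-- The rescaled mollifier `φ_ε`. -/
def mscale (m : Mollifier) (ε : ℝ) (x : Vec) : ℝ := (ε ^ 3)⁻¹ * m.φ (ε⁻¹ • x)

/-- Increment `δu(ξ;x) = u(x+ξ) - u(x)`. -/
def du (u : Vec → Vec) (ξ x : Vec) : Vec := u (x + ξ) - u x

/-- The pairing `⟨δu (δω · δu), φ⟩` (`k`-th component), with `δω` interpreted by duality. -/
def defPair1 (u : Vec → Vec) (φ : Vec → ℝ) (ξ : Vec) (k : Fin 3) : ℂ :=
  ∑ j, dpair (ωC u j) fun x =>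
    ((du u (-ξ) x k * du u (-ξ) x j * φ (x - ξ) - du u ξ x k * du u ξ x j * φ x : ℝ) : ℂ)

/-- The pairing `⟨δω |δu|², φ⟩` (`k`-th component), with `δω` interpreted by duality. -/
def defPair2 (u : Vec → Vec) (φ : Vec → ℝ) (ξ : Vec) (k : Fin 3) : ℂ :=
  dpair (ωC u k) fun x =>
    (((∑ j, du u (-ξ) x j ^ 2) * φ (x - ξ) - (∑ j, du u ξ x j ^ 2) * φ x : ℝ) : ℂ)

/-- `⟨D_{1,ε}(u,ω), φ⟩ = ∫ ∇φ_ε(ξ) · ⟨δu (δω·δu), φ⟩ dξ`. -/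
def D1pair (m : Mollifier) (ε : ℝ) (u : Vec → Vec) (φ : Vec → ℝ) : ℂ :=
  ∫ ξ : Vec, ∑ k, ((pd k (mscale m ε) ξ : ℝ) : ℂ) * defPair1 u φ ξ k

/-- `⟨D_{2,ε}(u,ω), φ⟩ = ∫ ∇φ_ε(ξ) · ⟨δω |δu|², φ⟩ dξ`. -/
def D2pair (m : Mollifier) (ε : ℝ) (u : Vec → Vec) (φ : Vec → ℝ) : ℂ :=
  ∫ ξ : Vec, ∑ k, ((pd k (mscale m ε) ξ : ℝ) : ℂ) * defPair2 u φ ξ k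

/-- The local terms of the helicity balance, paired with a test function:
`-⟨2ωu, ∂ₜφ⟩ + ⟨2∇·(pω) + ∇·(2(u·ω)u - |u|²ω), φ⟩`. -/
def helLocal (u : Vec → Vec) (p : Vec → ℝ) (φt φ : Vec → ℝ) : ℂ :=
  -2 * (∑ j, dpair (ωC u j) fun x => ((u x j * φt x : ℝ) : ℂ))
    - 2 * (∑ j, dpair (ωC u j) fun x => ((p x * pd j φ x : ℝ) : ℂ))
    - 2 * (∑ i, ∑ j, dpair (ωC u i) fun x => ((u x i * u x j * pd j φ x : ℝ) : ℂ))
    + ∑ j, dpair (ωC u j) fun x => (((∑ i, u x i ^ 2) * pd j φ x : ℝ) : ℂ)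

/-- `p` is the pressure associated with `u`: `-Δp = (∇⊗∇):(u⊗u)`, `∫ p = 0` (in Fourier form). -/
def PressureOf (u : Vec → Vec) (p : Vec → ℝ) : Prop :=
  fc (fun x => (p x : ℂ)) 0 = 0 ∧
    ∀ n : Lat,
      ((4 * Real.pi ^ 2 * latSq n : ℝ) : ℂ) * fc (fun x => (p x : ℂ)) n =
        ∑ i, ∑ j, (2 * Real.pi * Complex.I * (n i : ℂ)) * (2 * Real.pi * Complex.I * (n j : ℂ)) *
          fc (fun x => ((u x i * u x j : ℝ) : ℂ)) n

/-- The helicity `⟨ω, u⟩` at a fixed time (an `H^{-1/2} × H^{1/2}` duality pairing). -/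
def hel (u : Vec → Vec) : ℂ := ∑ j, dpair (ωC u j) (uC u j)

end PaperHelicity

namespace PaperHelicity

/-! ### Mollification in Fourier form, explicit mollified defect terms -/

/-- The Fourier transform of the rescaled mollifier at the lattice frequency `n`. -/
def molHat (m : Mollifier) (ε : ℝ) (n : Lat) : ℂ :=
  ∫ ξ : Vec, (mscale m ε ξ : ℂ) * (starRingEnd ℂ) (chr n ξ)

/-- Mollified reconstruction of a periodic distribution: `(T * φ_ε)(x)`. -/
def reconMol (m : Mollifier) (ε : ℝ) (c : Lat → ℂ) (x : Vec) : ℂ :=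
  ∑' n : Lat, c n * molHat m ε n * chr n x

/-- Fourier coefficients of the (para)product of a distribution and a function. -/
def pprodC (c : Lat → ℂ) (g : Vec → ℂ) (n : Lat) : ℂ := ∑' k : Lat, c k * fc g (n - k)

/-- Mollification of a function: `(g * φ_ε)(x)`. -/
def conv (m : Mollifier) (ε : ℝ) (g : Vec → ℝ) (x : Vec) : ℝ :=
  ∫ y : Vec, mscale m ε y * g (x - y)

/-- `⟨D_{1,ε}(u,ω), φ⟩` where `D_{1,ε} = -∇·((ω·u)u)^ε + u·∇(ω·u)^ε + u·(∇·(u⊗ω)^ε)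
+ ω·(∇·(u⊗u)^ε) - u⊗ω:∇u^ε - u⊗u:∇ω^ε` (products interpreted as paraproducts). -/
def D1explicit (m : Mollifier) (ε : ℝ) (u : Vec → Vec) (φ : Vec → ℝ) : ℂ :=
  (∑ i, ∑ j, dpair (ωC u i) fun x => uC u i x * uC u j x * ((pd j (conv m ε φ) x : ℝ) : ℂ))
  + (∫ x in cube,
      (∑ i, uC u i x * pd i (reconMol m ε fun n => ∑ j, pprodC (ωC u j) (uC u j) n) x)
        * ((φ x : ℝ) : ℂ))
  + (∫ x in cube,
      (∑ i, ∑ j, uC u j x * pd i (reconMol m ε (pprodC (ωC u j) (uC u i))) x) * ((φ x : ℝ) : ℂ))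
  + (∑ j, dpair (ωC u j) fun x =>
      (∑ i, pd i (reconMol m ε (fc fun y => uC u i y * uC u j y)) x) * ((φ x : ℝ) : ℂ))
  - (∑ i, ∑ j, dpair (ωC u j) fun x =>
      uC u i x * pd i (reconMol m ε (fc (uC u j))) x * ((φ x : ℝ) : ℂ))
  - (∫ x in cube,
      (∑ i, ∑ j, uC u i x * uC u j x * pd i (reconMol m ε (ωC u j)) x) * ((φ x : ℝ) : ℂ))

/-- `⟨D_{2,ε}(u,ω), φ⟩` where `D_{2,ε} = -∇·(|u|²ω)^ε + ω·∇(|u|²)^ε + 2u·(∇·(ω⊗u)^ε)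
- 2ω⊗u:∇u^ε` (products interpreted as paraproducts). -/
def D2explicit (m : Mollifier) (ε : ℝ) (u : Vec → Vec) (φ : Vec → ℝ) : ℂ :=
  (∑ j, dpair (ωC u j) fun x =>
      (((∑ i, u x i ^ 2) : ℝ) : ℂ) * ((pd j (conv m ε φ) x : ℝ) : ℂ))
  + (∑ j, dpair (ωC u j) fun x =>
      pd j (reconMol m ε (fc fun y => (((∑ i, u y i ^ 2) : ℝ) : ℂ))) x * ((φ x : ℝ) : ℂ))
  + 2 * (∫ x in cube,
      (∑ i, ∑ j, uC u j x * pd i (reconMol m ε (pprodC (ωC u i) (uC u j))) x) * ((φ x : ℝ) : ℂ))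
  - 2 * (∑ i, ∑ j, dpair (ωC u i) fun x =>
      uC u j x * pd i (reconMol m ε (fc (uC u j))) x * ((φ x : ℝ) : ℂ))

/-! ### Navier-Stokes -/

/-- A strong solution of the incompressible Navier-Stokes equations with viscosity `ν`
on `[0,T]`. -/
def IsStrongNS (ν T : ℝ) (u : ℝ → Vec → Vec) : Prop :=
  (∀ t, Per (u t)) ∧ (∀ t ∈ Set.Icc 0 T, ContDiff ℝ (⊤ : ℕ∞) (u t)) ∧
    (∀ t ∈ Set.Icc 0 T, ∀ x : Vec, ∑ i, pd i (fun y => u t y i) x = 0) ∧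
    ∃ p : ℝ → Vec → ℝ, (∀ t, Per (p t)) ∧ (∀ t ∈ Set.Icc 0 T, ContDiff ℝ (⊤ : ℕ∞) (p t)) ∧
      ∀ t ∈ Set.Ioo 0 T, ∀ x : Vec, ∀ j,
        HasDerivAt (fun s => u s x j)
          (ν * (∑ i, pd i (fun y => pd i (fun z => u t z j) y) x)
            - (∑ i, u t x i * pd i (fun y => u t y j) x) - pd j (p t) x) t

/-- Convergence in `L³(𝕋³ × (0,T))`. -/
def L3conv (T : ℝ) (w : ℕ → ℝ → Vec → Vec) (v : ℝ → Vec → Vec) : Prop :=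
  Tendsto (fun k => ∫⁻ t, (∫⁻ x, (‖w k t x - v t x‖₊ : ℝ≥0∞) ^ (3:ℝ) ∂μT) ∂tIoo T)
    atTop (𝓝 0)

/-! ### Spherical averages (third-order structure functions) -/

def mkVec (a b c : ℝ) : Vec := (WithLp.equiv 2 (Fin 3 → ℝ)).symm ![a, b, c]

/-- Parametrization of the unit sphere `𝕊²`. -/
def sphMap (θ ϕ : ℝ) : Vec :=
  mkVec (Real.sin θ * Real.cos ϕ) (Real.sin θ * Real.sin ϕ) (Real.cos θ)

/-- The pairing `⟨(δu(ζ)·dir)(δω(ζ)·δu(ζ)), φ⟩`, with `δω` interpreted by duality. -/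
def spIncr1 (u : Vec → Vec) (φ : Vec → ℝ) (ζ dir : Vec) : ℂ :=
  ∑ j, dpair (ωC u j) fun x =>
    (((∑ k, du u ζ (x - ζ) k * dir k) * du u ζ (x - ζ) j * φ (x - ζ)
        - (∑ k, du u ζ x k * dir k) * du u ζ x j * φ x : ℝ) : ℂ)

/-- The pairing `⟨(δω(ζ)·dir)|δu(ζ)|², φ⟩`, with `δω` interpreted by duality. -/
def spIncr2 (u : Vec → Vec) (φ : Vec → ℝ) (ζ dir : Vec) : ℂ :=
  ∑ j, ((dir j : ℝ) : ℂ) * dpair (ωC u j) fun x =>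
    (((∑ k, du u ζ (x - ζ) k ^ 2) * φ (x - ζ) - (∑ k, du u ζ x k ^ 2) * φ x : ℝ) : ℂ)

/-- `⟨S₁(u,ω,r), φ⟩`: the spherical average of the first third-order structure function,
paired with a test function (surface measure on `𝕊²`, total mass `4π`). -/
def S1pair (u : Vec → Vec) (φ : Vec → ℝ) (r : ℝ) : ℂ :=
  ∫ θ in (0:ℝ)..Real.pi, ∫ ϕ in (0:ℝ)..(2 * Real.pi),
    ((Real.sin θ : ℝ) : ℂ) * spIncr1 u φ (r • sphMap θ ϕ) (sphMap θ ϕ)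

/-- `⟨S₂(u,ω,r), φ⟩`. -/
def S2pair (u : Vec → Vec) (φ : Vec → ℝ) (r : ℝ) : ℂ :=
  ∫ θ in (0:ℝ)..Real.pi, ∫ ϕ in (0:ℝ)..(2 * Real.pi),
    ((Real.sin θ : ℝ) : ℂ) * spIncr2 u φ (r • sphMap θ ϕ) (sphMap θ ϕ)

/-! ### MHD -/

def dotV (a b : Vec) : ℝ := ∑ j, a j * b j

/-- `(a ⊗ b) : ∇ψ` at the point `x`. -/
def advPair (a b : Vec → Vec) (ψ : Vec → Vec) (x : Vec) : ℝ :=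
  ∑ i, ∑ j, a x i * b x j * pd i (fun y => ψ y j) x

/-- Weak solution of the ideal MHD equations (with divergence-free magnetic field as
part of the definition). -/
def MHDWeakDF (T : ℝ) (u B : ℝ → Vec → Vec) : Prop :=
  (∀ ψ : TestFun T Vec, DivFreeT ψ →
    (∫ t in Set.Ioo 0 T, ∫ x in cube,
      (dotV (u t x) (tderiv ψ.f t x) + advPair (u t) (u t) (ψ.f t) x
        - advPair (B t) (B t) (ψ.f t) x)) = 0) ∧
  (∀ ψ : TestFun T Vec, DivFreeT ψ →
    (∫ t in Set.Ioo 0 T, ∫ x in cube,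
      (dotV (B t x) (tderiv ψ.f t x) + advPair (u t) (B t) (ψ.f t) x
        - advPair (B t) (u t) (ψ.f t) x)) = 0) ∧
  WeakDivFree T u ∧ WeakDivFree T B

/-- `dB` is the weak divergence of `B`. -/
def WeakDiv (T : ℝ) (B : ℝ → Vec → Vec) (dB : ℝ → Vec → ℝ) : Prop :=
  ∀ φ : TestFun T ℝ,
    (∫ t in Set.Ioo 0 T, ∫ x in cube,
      (dB t x * φ.f t x + ∑ j, B t x j * pd j (φ.f t) x)) = 0

/-- Weak solution of the ideal MHD equations in the generalized sense allowing
`∇·B ≠ 0` (Definition 8.1 of the paper). -/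
def IdealMHDWeak (T : ℝ) (u B : ℝ → Vec → Vec) (dB : ℝ → Vec → ℝ) : Prop :=
  Measurable (Function.uncurry u) ∧ Measurable (Function.uncurry B) ∧
  Measurable (Function.uncurry dB) ∧
  (∀ t, Per (u t)) ∧ (∀ t, Per (B t)) ∧ (∀ t, Per (dB t)) ∧
  timeNorm ∞ T (fun t => eLpNorm (u t) 2 μT) < ∞ ∧
  timeNorm ∞ T (fun t => eLpNorm (B t) 2 μT) < ∞ ∧
  timeNorm ∞ T (fun t => eLpNorm (dB t) 2 μT) < ∞ ∧
  WeakDiv T B dB ∧ WeakDivFree T u ∧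
  (∀ ψ : TestFun T Vec, DivFreeT ψ →
    (∫ t in Set.Ioo 0 T, ∫ x in cube,
      (dotV (u t x) (tderiv ψ.f t x) + advPair (u t) (u t) (ψ.f t) x
        - advPair (B t) (B t) (ψ.f t) x - dB t x * dotV (B t x) (ψ.f t x))) = 0) ∧
  (∀ ψ : TestFun T Vec, DivFreeT ψ →
    (∫ t in Set.Ioo 0 T, ∫ x in cube,
      (dotV (B t x) (tderiv ψ.f t x) + advPair (u t) (B t) (ψ.f t) x
        - advPair (B t) (u t) (ψ.f t) x - dB t x * dotV (u t x) (ψ.f t x))) = 0)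

/-- Leray-Hopf weak solution of the viscous and resistive MHD equations in the
generalized sense allowing `∇·B ≠ 0` (Definition 8.4 of the paper). The viscous
terms `-νᵢ ∇v : ∇ψ` are written in the equivalent form `νᵢ v · Δψ`. -/
def LerayHopfMHD (ν₁ ν₂ T : ℝ) (u₀ B₀ : Vec → Vec) (u B : ℝ → Vec → Vec)
    (dB : ℝ → Vec → ℝ) : Prop :=
  Measurable (Function.uncurry u) ∧ Measurable (Function.uncurry B) ∧
  Measurable (Function.uncurry dB) ∧
  (∀ t, Per (u t)) ∧ (∀ t, Per (B t)) ∧ (∀ t, Per (dB t)) ∧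
  timeNorm ∞ T (fun t => eLpNorm (u t) 2 μT) < ∞ ∧
  timeNorm ∞ T (fun t => eLpNorm (B t) 2 μT) < ∞ ∧
  timeNorm ∞ T (fun t => eLpNorm (dB t) 2 μT) < ∞ ∧
  timeNorm 2 T (fun t => HsNormV 1 (u t)) < ∞ ∧
  timeNorm 2 T (fun t => HsNormV 1 (B t)) < ∞ ∧
  timeNorm 2 T (fun t => HsNorm 1 fun x => (dB t x : ℂ)) < ∞ ∧
  WeakDiv T B dB ∧ WeakDivFree T u ∧
  (∀ ψ : TestFun T Vec, DivFreeT ψ →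
    (∫ t in Set.Ioo 0 T, ∫ x in cube,
      (dotV (u t x) (tderiv ψ.f t x) + ν₁ * (∑ j, u t x j * lap (fun y => ψ.f t y j) x)
        + advPair (u t) (u t) (ψ.f t) x - advPair (B t) (B t) (ψ.f t) x
        - dB t x * dotV (B t x) (ψ.f t x))) = 0) ∧
  (∀ ψ : TestFun T Vec, DivFreeT ψ →
    (∫ t in Set.Ioo 0 T, ∫ x in cube,
      (dotV (B t x) (tderiv ψ.f t x) + ν₂ * (∑ j, B t x j * lap (fun y => ψ.f t y j) x)
        + advPair (u t) (B t) (ψ.f t) x - advPair (B t) (u t) (ψ.f t) x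
        - dB t x * dotV (u t x) (ψ.f t x))) = 0) ∧
  Tendsto (fun t => eLpNorm (fun x => u t x - u₀ x) 2 μT) (𝓝[>] 0) (𝓝 0) ∧
  Tendsto (fun t => eLpNorm (fun x => B t x - B₀ x) 2 μT) (𝓝[>] 0) (𝓝 0)

/-! ### Magnetic helicity -/

/-- Fourier coefficients of the divergence-free vector potential `A = ∇×(-Δ)⁻¹B`,
computed from the Fourier coefficients of `B`. -/
def vecPotC (c : Fin 3 → Lat → ℂ) (n : Lat) (j : Fin 3) : ℂ :=
  if n = 0 then 0 else
    Complex.I * ((n (j + 1) : ℂ) * c (j + 2) n - (n (j + 2) : ℂ) * c (j + 1) n) /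
      (2 * Real.pi * (latSq n : ℂ))

def fcV (B : Vec → Vec) (j : Fin 3) : Lat → ℂ := fc fun x => (B x j : ℂ)

/-- The magnetic helicity `∫ A·B dx` of a square-integrable magnetic field,
in Parseval form. -/
def magHel (B : Vec → Vec) : ℂ :=
  ∑' n : Lat, ∑ j, vecPotC (fcV B) n j * (starRingEnd ℂ) (fcV B j n)

/-- The magnetic helicity `⟨B, A⟩` of a magnetic field given as a distribution via its
Fourier coefficients (duality pairing). -/
def magHelC (c : Fin 3 → Lat → ℂ) : ℂ :=
  ∑' n : Lat, ∑ j, c j n * vecPotC c (-n) j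

/-! ### Kinematic dynamo -/

/-- `k`-th component of the curl of a (test) vector field. -/
def curlF (ψ : Vec → Vec) (k : Fin 3) (x : Vec) : ℝ :=
  pd (k + 1) (fun y => ψ y (k + 2)) x - pd (k + 2) (fun y => ψ y (k + 1)) x

/-- Functional weak solution of the kinematic dynamo equation: the magnetic field is
given by its Fourier coefficients `c`, the velocity `u` is given, and
`∫⟨B,∂ₜψ⟩ - ∫⟨B×u, ∇×ψ⟩ = 0` with `B×u` interpreted as a paraproduct; moreover `B` is
weakly divergence-free. -/
def DynamoWeak (T : ℝ) (u : ℝ → Vec → Vec) (c : ℝ → Fin 3 → Lat → ℂ) : Prop :=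
  (∀ ψ : TestFun T Vec,
    (∫ t in Set.Ioo 0 T,
      ((∑ j, dpair (c t j) fun x => (tderiv ψ.f t x j : ℂ)) -
        ∑ j, dpair (c t j) fun x =>
          ((u t x (j + 1) * curlF (ψ.f t) (j + 2) x
            - u t x (j + 2) * curlF (ψ.f t) (j + 1) x : ℝ) : ℂ))) = 0) ∧
  (∀ φ : TestFun T ℝ,
    (∫ t in Set.Ioo 0 T, ∑ j, dpair (c t j) fun x => ((pd j (φ.f t) x : ℝ) : ℂ)) = 0)

end PaperHelicity

namespace PaperHelicity

/-! ### Characters -/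

lemma chr_eq_exp (n : Lat) (x : Vec) :
    chr n x = Complex.exp (((2 * Real.pi * ∑ i, (n i : ℝ) * x i : ℝ) : ℂ) * Complex.I) := by
  unfold chr
  congr 1
  push_cast
  ring

lemma norm_chr (n : Lat) (x : Vec) : ‖chr n x‖ = 1 := by
  rw [chr_eq_exp, Complex.norm_exp_ofReal_mul_I]

lemma chr_add_vec (n : Lat) (x y : Vec) : chr n (x + y) = chr n x * chr n y := by
  unfold chr
  rw [← Complex.exp_add]
  congr 1
  simp only [PiLp.add_apply, Complex.ofReal_add, mul_add, Finset.sum_add_distrib]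

lemma chr_add (n m : Lat) (x : Vec) : chr (n + m) x = chr n x * chr m x := by
  unfold chr
  rw [← Complex.exp_add]
  congr 1
  simp only [Pi.add_apply, Int.cast_add, add_mul, Finset.sum_add_distrib, mul_add]

lemma chr_neg (n : Lat) (x : Vec) : chr (-n) x = (starRingEnd ℂ) (chr n x) := by
  rw [chr_eq_exp, chr_eq_exp, ← Complex.exp_conj]
  congr 1
  rw [map_mul, Complex.conj_ofReal, Complex.conj_I]
  simp only [Pi.neg_apply, Int.cast_neg, neg_mul, Finset.sum_neg_distrib]
  push_cast
  ring

lemma chr_zero (x : Vec) : chr 0 x = 1 := by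
  simp [chr]

lemma continuous_chr (n : Lat) : Continuous (chr n) := by
  unfold chr
  fun_prop

lemma measurable_chr (n : Lat) : Measurable (chr n) := (continuous_chr n).measurable

lemma fc_eq (f : Vec → ℂ) (n : Lat) : fc f n = ∫ x, f x * chr (-n) x ∂μT := by
  unfold fc μT
  simp only [chr_neg]

section Torus

local instance : MeasureSpace UnitAddCircle := ⟨AddCircle.haarAddCircle⟩

local instance : Measure.IsAddHaarMeasure (volume : Measure UnitAddCircle) :=
  inferInstanceAs (Measure.IsAddHaarMeasure AddCircle.haarAddCircle)

local instance : IsProbabilityMeasure (volume : Measure UnitAddCircle) :=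
  inferInstanceAs (IsProbabilityMeasure AddCircle.haarAddCircle)

def toT (x : Vec) : UnitAddTorus (Fin 3) := fun i => ((x i : ℝ) : UnitAddCircle)

def secT (θ : UnitAddTorus (Fin 3)) : Vec :=
  WithLp.toLp 2 (fun i => ((AddCircle.equivIoc 1 (0:ℝ) (θ i)).1 : ℝ))

lemma toT_secT (θ : UnitAddTorus (Fin 3)) : toT (secT θ) = θ := by
  funext i
  exact (AddCircle.equivIoc 1 (0:ℝ)).symm_apply_apply (θ i)

lemma chr_eq_mF (n : Lat) (x : Vec) : chr n x = UnitAddTorus.mFourier n (toT x) := by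
  simp only [UnitAddTorus.mFourier, ContinuousMap.coe_mk, toT, fourier_coe_apply]
  rw [← Complex.exp_sum]
  unfold chr
  congr 1
  rw [Finset.mul_sum]
  refine Finset.sum_congr rfl fun i _ => ?_
  simp
  ring

lemma measurable_toT : Measurable toT := by
  refine measurable_pi_lambda _ fun i => ?_
  exact AddCircle.measurable_mk'.comp (by fun_prop)

def cubeP : Set (Fin 3 → ℝ) := {x | ∀ i, x i ∈ Set.Ioc (0:ℝ) (0 + 1)}

lemma μT_eq : μT = Measure.map (WithLp.toLp 2) (volume.restrict cubeP) := by
  have hmp := (PiLp.volume_preserving_toLp (Fin 3))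
  have h1 : (WithLp.toLp 2 : (Fin 3 → ℝ) → Vec) ⁻¹' cube =ᵐ[volume] cubeP := by
    have e1 : (WithLp.toLp 2 : (Fin 3 → ℝ) → Vec) ⁻¹' cube
        = Set.pi Set.univ (fun _ => Set.Ico (0:ℝ) 1) := by
      ext x; simp [cube, Set.mem_pi]
    have e2 : cubeP = Set.pi Set.univ (fun _ => Set.Ioc (0:ℝ) 1) := by
      ext x; simp [cubeP, Set.mem_pi]
    rw [e1, e2]
    exact Measure.pi_Ico_ae_eq_pi_Icc.trans Measure.pi_Ioc_ae_eq_pi_Icc.symm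
  rw [← Measure.restrict_congr_set h1]
  have hc : MeasurableSet cube := by
    have : cube = ⋂ i, {x : Vec | 0 ≤ x i ∧ x i < 1} := by ext; simp [cube]
    rw [this]
    refine MeasurableSet.iInter fun i => ?_
    have hm : Measurable (fun x : Vec => x i) := by fun_prop
    exact (measurableSet_le measurable_const hm).inter (measurableSet_lt hm measurable_const)
  exact ((hmp.restrict_preimage hc).map_eq).symm

lemma mp_secT : MeasurePreserving secT volume μT := by
  have h := UnitAddTorus.measurePreserving_equivPiIoc (d := Fin 3) (fun _ => (0:ℝ))
  have hm : MeasurableSet {x : Fin 3 → ℝ | ∀ i, x i ∈ Set.Ioc (0:ℝ) (0 + 1)} :=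
    MeasurableSet.univ_pi' (fun i => measurableSet_Ioc)
  have h2 : MeasurePreserving (Subtype.val :
      {x : Fin 3 → ℝ // ∀ i, x i ∈ Set.Ioc (0:ℝ) (0 + 1)} → (Fin 3 → ℝ))
      (Measure.comap Subtype.val volume) (volume.restrict cubeP) :=
    ⟨measurable_subtype_coe, map_comap_subtype_coe hm volume⟩
  have h3 : MeasurePreserving (WithLp.toLp 2 : (Fin 3 → ℝ) → Vec) (volume.restrict cubeP) μT :=
    ⟨by fun_prop, μT_eq.symm⟩
  exact h3.comp (h2.comp h)

lemma mp_toT : MeasurePreserving toT μT volume := by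
  refine ⟨measurable_toT, ?_⟩
  rw [← mp_secT.map_eq, Measure.map_map measurable_toT mp_secT.measurable]
  have : toT ∘ secT = id := funext toT_secT
  rw [this, Measure.map_id]

instance isProb_μT : IsProbabilityMeasure μT := by
  constructor
  have := mp_secT.measure_preimage (s := Set.univ) MeasurableSet.univ.nullMeasurableSet
  rw [← this]
  simp

lemma chr_secT (n : Lat) (θ : UnitAddTorus (Fin 3)) :
    chr n (secT θ) = UnitAddTorus.mFourier n θ := by rw [chr_eq_mF, toT_secT]

lemma integral_secT (f : Vec → ℂ) (hf : AEStronglyMeasurable f μT) :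
    ∫ x, f x ∂μT = ∫ θ, f (secT θ) := by
  conv_lhs => rw [← mp_secT.map_eq]
  rw [integral_map mp_secT.measurable.aemeasurable]
  rwa [mp_secT.map_eq]

lemma fc_secT (f : Vec → ℂ) (hf : AEStronglyMeasurable f μT) (n : Lat) :
    fc f n = UnitAddTorus.mFourierCoeff (fun θ => f (secT θ)) n := by
  rw [fc_eq, integral_secT (fun x => f x * chr (-n) x)
    (hf.mul (continuous_chr _).aestronglyMeasurable)]
  unfold UnitAddTorus.mFourierCoeff
  simp only [chr_secT, smul_eq_mul, mul_comm]

lemma parseval_conj (f g : Vec → ℂ) (hf : MemLp f 2 μT) (hg : MemLp g 2 μT) :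
    HasSum (fun n : Lat => (starRingEnd ℂ) (fc f n) * fc g n)
      (∫ x, (starRingEnd ℂ) (f x) * g x ∂μT) := by
  have hf' : MemLp (fun θ => f (secT θ)) 2 volume := hf.comp_measurePreserving mp_secT
  have hg' : MemLp (fun θ => g (secT θ)) 2 volume := hg.comp_measurePreserving mp_secT
  have h := UnitAddTorus.hasSum_prod_mFourierCoeff (hf'.toLp) (hg'.toLp)
  have e : ∀ (k : Vec → ℂ) (hk : AEStronglyMeasurable k μT)
      (hk' : MemLp (fun θ => k (secT θ)) 2 volume) (n : Lat),
      UnitAddTorus.mFourierCoeff (hk'.toLp) n = fc k n := by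
    intro k hk hk' n
    rw [fc_secT k hk]
    unfold UnitAddTorus.mFourierCoeff
    refine integral_congr_ae ?_
    filter_upwards [hk'.coeFn_toLp] with θ hθ
    rw [hθ]
  simp only [e f hf.1 hf', e g hg.1 hg'] at h
  convert h using 1
  rw [integral_secT (fun x => (starRingEnd ℂ) (f x) * g x) ((Complex.continuous_conj.comp_aestronglyMeasurable hf.1).mul hg.1)]
  refine integral_congr_ae ?_
  filter_upwards [hf'.coeFn_toLp, hg'.coeFn_toLp] with θ h1 h2
  rw [h1, h2]

lemma toT_add (x y : Vec) : toT (x + y) = toT x + toT y := rfl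

lemma eLpNorm_shift (p : ℝ≥0∞) (s : Finset Lat) (c : Lat → ℂ) (y : Vec) :
    eLpNorm (fun x => ∑ n ∈ s, c n * chr n (x + y)) p μT
      = eLpNorm (fun x => ∑ n ∈ s, c n * chr n x) p μT := by
  let G : UnitAddTorus (Fin 3) → ℂ := fun θ => ∑ n ∈ s, c n * UnitAddTorus.mFourier n θ
  have hG : Continuous G := by fun_prop
  have h1 : (fun x => ∑ n ∈ s, c n * chr n (x + y)) = (fun θ => G (θ + toT y)) ∘ toT := by
    funext x
    simp only [G, Function.comp, chr_eq_mF, toT_add]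
  have h2 : (fun x => ∑ n ∈ s, c n * chr n x) = G ∘ toT := by
    funext x
    simp only [G, Function.comp, chr_eq_mF]
  have hG' : Continuous (fun θ => G (θ + toT y)) := hG.comp (continuous_id.add continuous_const)
  rw [h1, h2, eLpNorm_comp_measurePreserving hG.aestronglyMeasurable mp_toT,
    eLpNorm_comp_measurePreserving hG'.aestronglyMeasurable mp_toT]
  have h3 : MeasurePreserving (fun θ : UnitAddTorus (Fin 3) => θ + toT y) volume volume :=
    measurePreserving_add_right volume (toT y)
  exact eLpNorm_comp_measurePreserving hG.aestronglyMeasurable h3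

lemma integral_chr (n : Lat) : ∫ x, chr n x ∂μT = if n = 0 then 1 else 0 := by
  rw [integral_secT _ (continuous_chr _).aestronglyMeasurable]
  simp only [chr_secT]
  have h := (orthonormal_iff_ite.mp (UnitAddTorus.orthonormal_mFourier (d := Fin 3))) 0 n
  simp only [ContinuousMap.inner_toLp, ← UnitAddTorus.mFourier_neg,
    ← UnitAddTorus.mFourier_add] at h
  simp only [neg_zero, add_zero] at h
  rw [h]
  simp [eq_comm]

end Torus


/-! ### A positive kernel (Fejér extremal kernel) -/

def ee (j : ℤ) (t : ℝ) : ℂ := Complex.exp (2 * Real.pi * Complex.I * ((j : ℂ) * (t : ℂ)))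

lemma ee_eq (j : ℤ) (t : ℝ) :
    ee j t = Complex.exp (((2 * Real.pi * j * t : ℝ) : ℂ) * Complex.I) := by
  unfold ee; congr 1; push_cast; ring

lemma ee_norm (j : ℤ) (t : ℝ) : ‖ee j t‖ = 1 := by
  rw [ee_eq, Complex.norm_exp_ofReal_mul_I]

lemma ee_re (j : ℤ) (t : ℝ) : (ee j t).re = Real.cos (2 * Real.pi * j * t) := by
  rw [ee_eq, Complex.exp_ofReal_mul_I_re]

lemma ee_add (j k : ℤ) (t : ℝ) : ee (j + k) t = ee j t * ee k t := by
  unfold ee; rw [← Complex.exp_add]; congr 1; push_cast; ring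

lemma ee_conj (j : ℤ) (t : ℝ) : (starRingEnd ℂ) (ee j t) = ee (-j) t := by
  rw [ee_eq, ee_eq, ← Complex.exp_conj, map_mul, Complex.conj_ofReal, Complex.conj_I]
  congr 1; push_cast; ring

lemma ee_cont (j : ℤ) : Continuous (ee j) := by unfold ee; fun_prop

lemma ee_int (j : ℤ) :
    ∫ t in Set.Ioc (-1/2 : ℝ) (1/2), ee j t = if j = 0 then 1 else 0 := by
  rw [← intervalIntegral.integral_of_le (by norm_num)]
  split_ifs with h
  · subst h
    simp [ee]; norm_num
  · have hc : (2 * Real.pi * Complex.I * (j : ℂ)) ≠ 0 := by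
      simp [Real.pi_ne_zero, h]
    have : ∀ t : ℝ, ee j t = Complex.exp ((2 * Real.pi * Complex.I * (j : ℂ)) * t) := by
      intro t; unfold ee; congr 1; ring
    simp only [this]
    rw [integral_exp_mul_complex hc]
    have e : Complex.exp ((2 * Real.pi * Complex.I * (j : ℂ)) * ((1/2 : ℝ) : ℂ))
        = Complex.exp ((2 * Real.pi * Complex.I * (j : ℂ)) * ((-1/2 : ℝ) : ℂ)) := by
      rw [Complex.exp_eq_exp_iff_exists_int]
      exact ⟨j, by push_cast; ring⟩
    rw [e, sub_self, zero_div]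

lemma one_sub_cos_ge (t : ℝ) (h : |t| ≤ 1/2) : 8 * t ^ 2 ≤ 1 - Real.cos (2 * Real.pi * t) := by
  have h1 : 1 - Real.cos (2 * Real.pi * t) = 2 * Real.sin (Real.pi * t) ^ 2 := by
    rw [Real.sin_sq, mul_assoc, Real.cos_two_mul]; ring
  have h2 : 2 / Real.pi * |Real.pi * t| ≤ |Real.sin (Real.pi * t)| := by
    apply Real.mul_abs_le_abs_sin
    rw [abs_mul, abs_of_pos Real.pi_pos]
    nlinarith [Real.pi_pos]
  have h3 : 2 / Real.pi * |Real.pi * t| = 2 * |t| := by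
    rw [abs_mul, abs_of_pos Real.pi_pos]; field_simp
  rw [h3] at h2
  have := pow_le_pow_left₀ (by positivity) h2 2
  rw [sq_abs, mul_pow, sq_abs] at this
  linarith

lemma one_sub_cos_le (x : ℝ) : 1 - Real.cos x ≤ x ^ 2 / 2 := by
  linarith [Real.one_sub_sq_div_two_le_cos (x := x)]

lemma kernel1 (R : ℕ) (hR : 2 ≤ R) : ∃ (m : ℤ → ℝ) (ν : Measure ℝ), IsProbabilityMeasure ν ∧
    (∀ n, ∫ t, ee n t ∂ν = (m n : ℂ)) ∧ (∀ n, (R : ℤ) ≤ |n| → m n = 0) ∧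
    (∀ n, m (-n) = m n) ∧ (∀ n, |m n| ≤ 1) ∧ (∀ n : ℤ, 1 - m n ≤ 20 * (n:ℝ) ^ 2 / (R:ℝ) ^ 2) ∧
    Integrable (fun t : ℝ => |t|) ν ∧ ∫ t, |t| ∂ν ≤ 1 / (R:ℝ) := by
  have hR0 : (0:ℝ) < R := by positivity
  have hRne : (R:ℝ) ≠ 0 := hR0.ne'
  set a : ℕ → ℝ := fun k => Real.sin (Real.pi * k / R) with ha
  set A : ℝ := ∑ k ∈ Finset.range R, a k ^ 2 with hA
  have hApos : 0 < A := by
    refine Finset.sum_pos' (fun i _ => sq_nonneg _) ⟨1, Finset.mem_range.2 (by omega), ?_⟩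
    have : 0 < a 1 := by
      simp only [ha, Nat.cast_one, mul_one]
      apply Real.sin_pos_of_pos_of_lt_pi (by positivity)
      rw [div_lt_iff₀ hR0]
      have : (2:ℝ) ≤ R := by exact_mod_cast hR
      nlinarith [Real.pi_pos]
    positivity
  set φ : ℝ → ℝ := fun t => ‖∑ k ∈ Finset.range R, (a k : ℂ) * ee k t‖ ^ 2 / A with hφ
  have hφc : Continuous φ := by
    have := fun k : ℕ => ee_cont k
    fun_prop
  have hφ0 : ∀ t, 0 ≤ φ t := fun t => by positivity
  set μ0 : Measure ℝ := volume.restrict (Set.Ioc (-1/2 : ℝ) (1/2)) with hμ0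
  set ν : Measure ℝ := μ0.withDensity (fun t => ENNReal.ofReal (φ t)) with hν
  have hintg : ∀ g : ℝ → ℂ, ∫ t, g t ∂ν = ∫ t, (φ t : ℂ) * g t ∂μ0 := by
    intro g
    rw [hν, integral_withDensity_eq_integral_toReal_smul (by fun_prop) (by simp)]
    refine integral_congr_ae (Filter.Eventually.of_forall fun t => ?_)
    simp [ENNReal.toReal_ofReal (hφ0 t)]
  set m : ℤ → ℝ := fun n => (∑ k ∈ Finset.range R, ∑ l ∈ Finset.range R,
    if (k:ℤ) - l + n = 0 then a k * a l else 0) / A with hm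
  have hφe : ∀ n t, (φ t : ℂ) * ee n t = ∑ k ∈ Finset.range R, ∑ l ∈ Finset.range R,
      ((a k * a l / A : ℝ) : ℂ) * ee ((k:ℤ) - l + n) t := by
    intro n t
    have : (φ t : ℂ) = (∑ k ∈ Finset.range R, (a k : ℂ) * ee k t) *
        (starRingEnd ℂ) (∑ k ∈ Finset.range R, (a k : ℂ) * ee k t) / A := by
      rw [Complex.mul_conj, Complex.normSq_eq_norm_sq, hφ]; push_cast; rfl
    rw [this, map_sum, Finset.sum_mul_sum, Finset.sum_div, Finset.sum_mul]
    refine Finset.sum_congr rfl fun k _ => ?_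
    rw [Finset.sum_div, Finset.sum_mul]
    refine Finset.sum_congr rfl fun l _ => ?_
    rw [map_mul, Complex.conj_ofReal, ee_conj, ee_add, sub_eq_add_neg, ee_add]
    push_cast; ring
  have hcoef : ∀ n, ∫ t, ee n t ∂ν = (m n : ℂ) := by
    intro n
    rw [hintg]
    simp only [hφe]
    have hii : ∀ j : ℤ, ∀ c : ℂ, Integrable (fun t => c * ee j t) μ0 := by
      intro j c
      refine Integrable.const_mul ?_ c
      exact (ee_cont j).integrableOn_Ioc
    rw [integral_finsetSum _ (fun k _ => integrable_finsetSum _ fun l _ => hii _ _)]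
    simp only [hm]
    push_cast
    rw [Finset.sum_div]
    refine Finset.sum_congr rfl fun k _ => ?_
    rw [integral_finsetSum _ (fun l _ => hii _ _), Finset.sum_div]
    refine Finset.sum_congr rfl fun l _ => ?_
    rw [integral_const_mul, hμ0, ee_int]
    split_ifs <;> simp
  have hm0 : m 0 = 1 := by
    simp only [hm]
    rw [div_eq_one_iff_eq hApos.ne', hA]
    refine Finset.sum_congr rfl fun k hk => ?_
    rw [Finset.sum_eq_single k]
    · simp [sq]
    · intro l _ hl
      rw [if_neg (by omega)]
    · intro h; exact absurd hk h
  have hprob : IsProbabilityMeasure ν := by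
    have hφi : Integrable φ μ0 := hφc.integrableOn_Ioc
    have h1 : ∫ t, φ t ∂μ0 = 1 := by
      have := hcoef 0
      rw [hintg, hm0] at this
      simp only [ee, Int.cast_zero, zero_mul, mul_zero, Complex.exp_zero, mul_one] at this
      rw [integral_complex_ofReal] at this
      exact_mod_cast this
    constructor
    rw [hν, withDensity_apply _ MeasurableSet.univ, Measure.restrict_univ,
      ← ofReal_integral_eq_lintegral_ofReal hφi (Filter.Eventually.of_forall hφ0), h1]
    simp
  have hae : ∀ᵐ t ∂ν, |t| ≤ 1/2 := by
    refine (withDensity_absolutelyContinuous μ0 _) ?_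
    rw [hμ0]
    filter_upwards [ae_restrict_mem measurableSet_Ioc] with t ht
    rw [abs_le]; constructor <;> linarith [ht.1, ht.2]
  have hmre : ∀ n : ℤ, m n = ∫ t, Real.cos (2 * Real.pi * n * t) ∂ν := by
    intro n
    have h := congrArg Complex.re (hcoef n)
    have hi : Integrable (ee n) ν := by
      refine Integrable.of_bound (ee_cont n).aestronglyMeasurable 1 ?_
      exact Filter.Eventually.of_forall fun t => (ee_norm n t).le
    rw [Complex.ofReal_re] at h
    rw [← h]
    have := integral_re hi
    simp only [RCLike.re_to_complex] at this
    rw [← this]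
    simp only [ee_re]
  have hcosi : ∀ n : ℤ, Integrable (fun t => Real.cos (2 * Real.pi * n * t)) ν := by
    intro n
    refine Integrable.of_bound (by fun_prop) 1 ?_
    exact Filter.Eventually.of_forall fun t => by
      rw [Real.norm_eq_abs]; exact Real.abs_cos_le_one _
  have hsqi : Integrable (fun t : ℝ => t ^ 2) ν := by
    refine Integrable.of_bound (by fun_prop) 1 ?_
    filter_upwards [hae] with t ht
    rw [norm_pow, Real.norm_eq_abs]
    nlinarith [abs_nonneg t]
  have habsi : Integrable (fun t : ℝ => |t|) ν := by
    refine Integrable.of_bound (by fun_prop) 1 ?_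
    filter_upwards [hae] with t ht
    rw [Real.norm_eq_abs, abs_abs]
    linarith
  have hsub : ∀ n : ℤ, 1 - m n = ∫ t, (1 - Real.cos (2 * Real.pi * n * t)) ∂ν := by
    intro n
    rw [integral_sub (integrable_const _) (hcosi n), ← hmre]
    simp
  have hm1 : m 1 = Real.cos (Real.pi / R) := by
    have e1 : ∀ k : ℕ, (∑ l ∈ Finset.range R, if (k:ℤ) - l + 1 = 0 then a k * a l else 0)
        = a k * a (k + 1) - (if k + 1 < R then 0 else a k * a (k+1)) := by
      intro k
      by_cases h : k + 1 < R
      · rw [if_pos h, sub_zero, Finset.sum_eq_single (k+1)]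
        · rw [if_pos (by push_cast; ring)]
        · intro l _ hl
          rw [if_neg (by omega)]
        · intro h'; exact absurd (Finset.mem_range.2 h) h'
      · rw [if_neg h, sub_self]
        refine Finset.sum_eq_zero fun l hl => ?_
        have := Finset.mem_range.1 hl
        rw [if_neg (by omega)]
    have haR : a R = 0 := by
      simp only [ha]; rw [mul_div_assoc, div_self hRne, mul_one, Real.sin_pi]
    have ha0 : a 0 = 0 := by simp [ha]
    have e2 : (∑ k ∈ Finset.range R, ∑ l ∈ Finset.range R,
        if (k:ℤ) - l + 1 = 0 then a k * a l else 0) = ∑ k ∈ Finset.range R, a k * a (k+1) := by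
      refine Finset.sum_congr rfl fun k hk => ?_
      rw [e1]
      split_ifs with h
      · simp
      · have : k + 1 = R := by have := Finset.mem_range.1 hk; omega
        rw [this, haR]; simp
    have e3 : ∀ k : ℕ, a k + a (k + 2) = 2 * Real.cos (Real.pi / R) * a (k + 1) := by
      intro k
      simp only [ha]
      have x1 : Real.pi * (k:ℝ) / R = Real.pi * ((k+1 : ℕ):ℝ) / R - Real.pi / R := by
        push_cast; field_simp; ring
      have x2 : Real.pi * ((k+2:ℕ):ℝ) / R = Real.pi * ((k+1 : ℕ):ℝ) / R + Real.pi / R := by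
        push_cast; field_simp; ring
      rw [x1, x2, Real.sin_sub, Real.sin_add]; ring
    -- telescoping identity by induction
    have e4 : ∀ N : ℕ, 2 * (∑ k ∈ Finset.range N, a k * a (k+1)) + a N * a (N+1)
        = 2 * Real.cos (Real.pi / R) * (∑ k ∈ Finset.range (N+1), a k ^ 2) := by
      intro N
      induction N with
      | zero => simp [ha0]
      | succ N ih =>
        rw [Finset.sum_range_succ, Finset.sum_range_succ _ (N+1), mul_add, mul_add, ← ih]
        linear_combination a (N+1) * e3 N
    have e5 := e4 R
    rw [Finset.sum_range_succ _ R, haR] at e5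
    simp only [hm]
    rw [e2, div_eq_iff hApos.ne', hA]
    linarith
  have hsq : ∫ t, t ^ 2 ∂ν ≤ 1 / (R:ℝ) ^ 2 := by
    have h1 : 8 * ∫ t, t ^ 2 ∂ν ≤ 1 - m 1 := by
      rw [hsub, ← integral_const_mul]
      refine integral_mono_ae (hsqi.const_mul 8) ((integrable_const _).sub (hcosi 1)) ?_
      filter_upwards [hae] with t ht
      simpa using one_sub_cos_ge t ht
    have h2 : 1 - m 1 ≤ (Real.pi / R) ^ 2 / 2 := by
      rw [hm1]; exact one_sub_cos_le _
    have h3 : (Real.pi / R) ^ 2 / 2 ≤ 8 * (1 / (R:ℝ)^2) := by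
      rw [div_pow, div_div, ← mul_div_assoc, div_le_div_iff₀ (by positivity) (by positivity)]
      have : Real.pi ^ 2 ≤ 16 := by nlinarith [Real.pi_pos, Real.pi_le_four]
      nlinarith [sq_nonneg (R:ℝ)]
    linarith
  refine ⟨m, ν, hprob, hcoef, ?_, ?_, ?_, ?_, habsi, ?_⟩
  · intro n hn
    simp only [hm]
    rw [div_eq_zero_iff]; left
    refine Finset.sum_eq_zero fun k hk => Finset.sum_eq_zero fun l hl => ?_
    have := Finset.mem_range.1 hk
    have := Finset.mem_range.1 hl
    rw [if_neg]
    intro h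
    have : n = (l:ℤ) - k := by omega
    rw [this, le_abs] at hn
    omega
  · intro n
    rw [hmre, hmre]
    congr 1; funext t
    rw [← Real.cos_neg]; congr 1; push_cast; ring
  · intro n
    have h := norm_integral_le_of_norm_le_const (μ := ν) (f := ee n) (C := 1)
      (Filter.Eventually.of_forall fun t => (ee_norm n t).le)
    rw [hcoef, Complex.norm_real, Real.norm_eq_abs] at h
    simpa using h
  · intro n
    rw [hsub]
    have h1 : ∫ t, (1 - Real.cos (2 * Real.pi * n * t)) ∂ν
        ≤ ∫ t, (2 * Real.pi * n) ^ 2 / 2 * t ^ 2 ∂ν := by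
      refine integral_mono ((integrable_const _).sub (hcosi n)) (hsqi.const_mul _) fun t => ?_
      refine (one_sub_cos_le _).trans (le_of_eq ?_)
      ring
    rw [integral_const_mul] at h1
    refine h1.trans ?_
    have h2 : (2 * Real.pi * n) ^ 2 / 2 * ∫ t, t ^ 2 ∂ν ≤ (2 * Real.pi * n) ^ 2 / 2 * (1 / (R:ℝ)^2) :=
      mul_le_mul_of_nonneg_left hsq (by positivity)
    refine h2.trans ?_
    rw [mul_one_div]
    gcongr
    have : Real.pi ^ 2 ≤ 10 := by nlinarith [Real.pi_pos, Real.pi_lt_d2]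
    nlinarith [sq_nonneg (n:ℝ)]
  · have h1 : ∫ t, |t| ∂ν ≤ ∫ t, ((R:ℝ) / 2 * t ^ 2 + 1 / (2 * R)) ∂ν := by
      refine integral_mono habsi ((hsqi.const_mul _).add (integrable_const _)) fun t => ?_
      have : (R:ℝ) / 2 * t ^ 2 + 1 / (2 * R) - |t| = (R * |t| - 1) ^ 2 / (2 * R) := by
        rw [← sq_abs t]; field_simp; ring
      have h2 : 0 ≤ (R * |t| - 1) ^ 2 / (2 * R) := by positivity
      simp only
      linarith
    rw [integral_add (hsqi.const_mul _) (integrable_const _), integral_const_mul] at h1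
    simp only [integral_const, probReal_univ, one_smul] at h1
    have h2 : (R:ℝ) / 2 * ∫ t, t ^ 2 ∂ν ≤ (R:ℝ) / 2 * (1 / (R:ℝ)^2) :=
      mul_le_mul_of_nonneg_left hsq (by positivity)
    have h3 : (R:ℝ) / 2 * (1 / (R:ℝ)^2) + 1 / (2 * R) = 1 / R := by field_simp; norm_num
    linarith


/-! ### Group C : trigonometric polynomials in L⁴ and Bernstein -/

lemma memLp_chr (n : Lat) (p : ℝ≥0∞) : MemLp (chr n) p μT :=
  MemLp.of_bound (continuous_chr n).aestronglyMeasurable 1 (ae_of_all _ fun x => (norm_chr n x).le)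

instance fact4 : Fact (1 ≤ (4:ℝ≥0∞)) := ⟨by norm_num⟩

/-- character as element of L⁴ -/
def EE (n : Lat) : Lp ℂ 4 μT := (memLp_chr n 4).toLp

/-- L⁴ norm of the trigonometric polynomial with coefficients c on s -/
def tp (s : Finset Lat) (c : Lat → ℂ) : Lp ℂ 4 μT := ∑ n ∈ s, c n • EE n

lemma memLp_trig (s : Finset Lat) (c : Lat → ℂ) (p : ℝ≥0∞) :
    MemLp (fun x => ∑ n ∈ s, c n * chr n x) p μT :=
  memLp_finsetSum _ fun n _ => (memLp_chr n p).const_mul (c n)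

lemma tp_eq (s : Finset Lat) (c : Lat → ℂ) : tp s c = (memLp_trig s c 4).toLp := by
  unfold tp
  induction s using Finset.induction_on with
  | empty =>
    simp only [Finset.sum_empty]
    symm
    exact MemLp.toLp_zero _
  | insert a s ha ih =>
    rw [Finset.sum_insert ha, ih]
    unfold EE
    rw [← MemLp.toLp_const_smul, ← MemLp.toLp_add]
    congr 1
    ext x
    simp [Finset.sum_insert ha]

lemma norm_tp (s : Finset Lat) (c : Lat → ℂ) :
    ‖tp s c‖ = (eLpNorm (fun x => ∑ n ∈ s, c n * chr n x) 4 μT).toReal := by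
  rw [tp_eq, Lp.norm_toLp]

lemma norm_tp_shift (s : Finset Lat) (c : Lat → ℂ) (y : Vec) :
    ‖tp s (fun n => c n * chr n y)‖ = ‖tp s c‖ := by
  rw [norm_tp, norm_tp, ← eLpNorm_shift 4 s c y]
  congr 3
  ext x
  refine Finset.sum_congr rfl fun n _ => ?_
  rw [chr_add_vec]; ring

lemma tp_add (s : Finset Lat) (c d : Lat → ℂ) : tp s (fun n => c n + d n) = tp s c + tp s d := by
  simp [tp, add_smul, Finset.sum_add_distrib]

lemma tp_sub (s : Finset Lat) (c d : Lat → ℂ) : tp s (fun n => c n - d n) = tp s c - tp s d := by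
  simp [tp, sub_smul, Finset.sum_sub_distrib]

lemma tp_smul (s : Finset Lat) (a : ℂ) (c : Lat → ℂ) :
    tp s (fun n => a * c n) = a • tp s c := by
  simp [tp, mul_smul, Finset.smul_sum]

lemma tp_congr {s : Finset Lat} {c d : Lat → ℂ} (h : ∀ n ∈ s, c n = d n) : tp s c = tp s d :=
  Finset.sum_congr rfl fun n hn => by rw [h n hn]

def sgl (i : Fin 3) (t : ℝ) : Vec := EuclideanSpace.single i t

lemma chr_sgl (n : Lat) (i : Fin 3) (t : ℝ) : chr n (sgl i t) = ee (n i) t := by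
  unfold chr ee sgl
  congr 1
  congr 1
  rw [Finset.sum_eq_single i]
  · simp
  · intro b _ hb; simp [hb]
  · simp

lemma cos_mult (s : Finset Lat) (c : Lat → ℂ) (i : Fin 3) (θ r : ℝ) :
    ‖tp s (fun n => ((Real.cos (θ + 2 * Real.pi * (n i) * r) : ℝ) : ℂ) * c n)‖ ≤ ‖tp s c‖ := by
  have h : ∀ n : Lat, ((Real.cos (θ + 2 * Real.pi * (n i) * r) : ℝ) : ℂ) * c n =
      (Complex.exp (θ * I) / 2) * (c n * chr n (sgl i r)) +
      (Complex.exp (-θ * I) / 2) * (c n * chr n (sgl i (-r))) := by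
    intro n
    rw [chr_sgl, chr_sgl, Complex.ofReal_cos, Complex.cos, ee, ee]
    have e1 : Complex.exp (((θ + 2 * Real.pi * (n i) * r : ℝ) : ℂ) * I) =
      Complex.exp (θ * I) * Complex.exp (2 * Real.pi * I * ((n i : ℂ) * (r:ℂ))) := by
      rw [← Complex.exp_add]; congr 1; push_cast; ring
    have e2 : Complex.exp (-((θ + 2 * Real.pi * (n i) * r : ℝ) : ℂ) * I) =
      Complex.exp (-θ * I) * Complex.exp (2 * Real.pi * I * ((n i : ℂ) * ((-r : ℝ):ℂ))) := by
      rw [← Complex.exp_add]; congr 1; push_cast; ring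
    rw [e1, e2]; ring
  simp only [h]
  rw [tp_add, tp_smul, tp_smul]
  refine (norm_add_le _ _).trans ?_
  rw [norm_smul, norm_smul, norm_tp_shift, norm_tp_shift]
  have a1 : ‖Complex.exp (θ * I) / 2‖ = 1/2 := by
    rw [norm_div, Complex.norm_exp_ofReal_mul_I]; simp
  have a2 : ‖Complex.exp (-θ * I) / 2‖ = 1/2 := by
    rw [norm_div, ← Complex.ofReal_neg, Complex.norm_exp_ofReal_mul_I]; simp
  rw [a1, a2]; linarith

lemma bern2 (x : ℝ) : (Polynomial.map (algebraMap ℚ ℝ) (Polynomial.bernoulli 2)).eval x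
    = x ^ 2 - x + 1/6 := by
  have : bernoulli 2 = 1/6 := by rw [bernoulli_eq_bernoulli'_of_ne_one (by norm_num), bernoulli'_two]
  simp [Polynomial.bernoulli, Finset.sum_range_succ, this, bernoulli_one, Polynomial.eval_monomial]
  ring

lemma tri_wave (x : ℝ) (h0 : 0 ≤ x) (h1 : x ≤ 1/2) :
    HasSum (fun k : ℕ => 1 / (k:ℝ) ^ 2 * (Real.cos (2 * Real.pi * k * (x + 1/2))
      - Real.cos (2 * Real.pi * k * x))) (Real.pi ^ 2 * (x - 1/4)) := by
  have a := hasSum_one_div_nat_pow_mul_cos (k := 1) (by norm_num) (x := x + 1/2)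
    ⟨by linarith, by linarith⟩
  have b := hasSum_one_div_nat_pow_mul_cos (k := 1) (by norm_num) (x := x)
    ⟨by linarith, by linarith⟩
  have := a.sub b
  simp only [mul_one, bern2] at this
  have e1 : (fun k : ℕ => 1 / (k:ℝ) ^ 2 * (Real.cos (2 * Real.pi * k * (x + 1/2))
      - Real.cos (2 * Real.pi * k * x))) = fun b : ℕ => 1 / (b:ℝ) ^ 2 *
        Real.cos (2 * Real.pi * b * (x + 1 / 2)) - 1 / (b:ℝ) ^ 2 * Real.cos (2 * Real.pi * b * x) := by
    ext k; rw [mul_sub]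
  rw [e1]
  have e2 : Real.pi ^ 2 * (x - 1/4) = (-1) ^ (1 + 1) * (2 * Real.pi) ^ 2 / 2 / ((Nat.factorial 2 : ℕ) : ℝ)
      * ((x + 1 / 2) ^ 2 - (x + 1 / 2) + 1 / 6) -
      (-1) ^ (1 + 1) * (2 * Real.pi) ^ 2 / 2 / ((Nat.factorial 2 : ℕ) : ℝ) * (x ^ 2 - x + 1 / 6) := by
    rw [Nat.factorial_two]
    push_cast
    ring
  rw [e2]
  exact this

/-- Bernstein inequality in one direction -/
lemma bernstein (s : Finset Lat) (c : Lat → ℂ) (i : Fin 3) (M : ℝ) (hM : 0 < M)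
    (hs : ∀ n ∈ s, |((n i : ℤ) : ℝ)| ≤ M) :
    ‖tp s (fun n => (n i : ℂ) * c n)‖ ≤ 2 * M * ‖tp s c‖ := by
  set g : ℕ → Lat → ℝ := fun k n => 1 / (k:ℝ) ^ 2 *
    (Real.cos (2 * Real.pi * k * ((1/4 + n i / (4 * M)) + 1/2))
      - Real.cos (2 * Real.pi * k * (1/4 + n i / (4 * M)))) with hg
  have hsum : ∀ n ∈ s, HasSum (fun k => g k n) (Real.pi ^ 2 * ((1/4 + n i / (4 * M)) - 1/4)) := by
    intro n hn
    have h := abs_le.1 (hs n hn)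
    have e : (n i : ℝ) / (4 * M) ≤ 1/4 := by rw [div_le_iff₀ (by positivity)]; linarith
    have e' : -(1/4) ≤ (n i : ℝ) / (4 * M) := by rw [le_div_iff₀ (by positivity)]; linarith
    exact tri_wave _ (by linarith) (by linarith)
  have ht : Tendsto (fun S : Finset ℕ => tp s (fun n => ((∑ k ∈ S, g k n : ℝ) : ℂ) * c n)) atTop
      (𝓝 (tp s (fun n => ((Real.pi ^ 2 * ((1/4 + n i / (4 * M)) - 1/4) : ℝ) : ℂ) * c n))) := by
    unfold tp
    refine tendsto_finsetSum _ fun n hn => ?_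
    refine Tendsto.smul_const ?_ _
    refine Tendsto.mul_const _ ?_
    exact (Complex.continuous_ofReal.tendsto _).comp (hsum n hn)
  have hb : ∀ S : Finset ℕ, ‖tp s (fun n => ((∑ k ∈ S, g k n : ℝ) : ℂ) * c n)‖ ≤
      (Real.pi ^ 2 / 3) * ‖tp s c‖ := by
    intro S
    have e1 : tp s (fun n => ((∑ k ∈ S, g k n : ℝ) : ℂ) * c n) =
        ∑ k ∈ S, tp s (fun n => (g k n : ℂ) * c n) := by
      unfold tp
      rw [Finset.sum_comm]
      refine Finset.sum_congr rfl fun n _ => ?_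
      push_cast
      rw [Finset.sum_mul, Finset.sum_smul]
    have e2 : ∀ k, ‖tp s (fun n => (g k n : ℂ) * c n)‖ ≤ (1 / (k:ℝ)^2) * (2 * ‖tp s c‖) := by
      intro k
      have : (fun n : Lat => (g k n : ℂ) * c n) = fun n => (((1 / (k:ℝ)^2 : ℝ)) : ℂ) *
        (((Real.cos ((2 * Real.pi * k * (3/4)) + 2 * Real.pi * (n i) * (k / (4 * M))) : ℝ) : ℂ) * c n
        - ((Real.cos ((2 * Real.pi * k * (1/4)) + 2 * Real.pi * (n i) * (k / (4 * M))) : ℝ) : ℂ) * c n)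
          := by
        ext n
        have a1 : 2 * Real.pi * k * ((1/4 + n i / (4 * M)) + 1/2) =
          (2 * Real.pi * k * (3/4)) + 2 * Real.pi * (n i) * (k / (4 * M)) := by ring
        have a2 : 2 * Real.pi * k * (1/4 + n i / (4 * M)) =
          (2 * Real.pi * k * (1/4)) + 2 * Real.pi * (n i) * (k / (4 * M)) := by ring
        simp only [hg, a1, a2]
        push_cast; ring
      rw [this, tp_smul, norm_smul, Complex.norm_real, Real.norm_of_nonneg (by positivity)]
      refine mul_le_mul_of_nonneg_left ?_ (by positivity)
      rw [tp_sub]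
      refine (norm_sub_le _ _).trans ?_
      linarith [cos_mult s c i (2 * Real.pi * k * (3/4)) (k / (4 * M)),
        cos_mult s c i (2 * Real.pi * k * (1/4)) (k / (4 * M))]
    rw [e1]
    refine (norm_sum_le _ _).trans ((Finset.sum_le_sum fun k _ => e2 k).trans ?_)
    rw [← Finset.sum_mul]
    have := sum_le_hasSum S (fun k _ => by positivity) hasSum_zeta_two
    nlinarith [norm_nonneg (tp s c)]
  have hlim := le_of_tendsto ht.norm (Eventually.of_forall hb)
  have e3 : tp s (fun n => (n i : ℂ) * c n) = ((4 * M / Real.pi ^ 2 : ℝ) : ℂ) •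
      tp s (fun n => ((Real.pi ^ 2 * ((1/4 + n i / (4 * M)) - 1/4) : ℝ) : ℂ) * c n) := by
    rw [← tp_smul]
    refine tp_congr fun n _ => ?_
    rw [← mul_assoc, ← Complex.ofReal_mul]
    have : 4 * M / Real.pi ^ 2 * (Real.pi ^ 2 * ((1/4 + n i / (4 * M)) - 1/4)) = (n i : ℝ) := by
      have := Real.pi_pos
      field_simp; ring
    rw [this]; simp
  rw [e3, norm_smul, Complex.norm_real, Real.norm_of_nonneg (by positivity)]
  refine (mul_le_mul_of_nonneg_left hlim (by positivity)).trans ?_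
  have hp := Real.pi_pos
  have : 4 * M / Real.pi ^ 2 * (Real.pi ^ 2 / 3 * ‖tp s c‖) = 4 / 3 * (M * ‖tp s c‖) := by
    field_simp
  rw [this]
  nlinarith [mul_nonneg hM.le (norm_nonneg (tp s c))]

lemma hasDerivAt_ee (j : ℤ) (t : ℝ) :
    HasDerivAt (ee j) (2 * Real.pi * I * (j : ℂ) * ee j t) t := by
  have h1 : HasDerivAt (fun t : ℝ => 2 * Real.pi * I * ((j : ℂ) * (t : ℂ)))
      (2 * Real.pi * I * (j : ℂ)) t := by
    have := ((hasDerivAt_id t).ofReal_comp.const_mul (2 * Real.pi * I * (j : ℂ)))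
    simpa [mul_assoc] using this
  have := h1.cexp
  unfold ee
  convert this using 1
  ring

lemma shift_one (s : Finset Lat) (c : Lat → ℂ) (i : Fin 3) (M : ℝ) (hM : 0 < M)
    (hs : ∀ n ∈ s, |((n i : ℤ) : ℝ)| ≤ M) (t : ℝ) :
    ‖tp s (fun n => c n * chr n (sgl i t)) - tp s c‖ ≤ 16 * M * |t| * ‖tp s c‖ := by
  have hd : ∀ r ∈ (Set.univ : Set ℝ), HasDerivWithinAt (fun r => tp s (fun n => c n * chr n (sgl i r)))
      (tp s (fun n => (2 * Real.pi * I) * ((n i : ℂ) * (c n * chr n (sgl i r))))) Set.univ r := by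
    intro r _
    refine HasDerivAt.hasDerivWithinAt ?_
    unfold tp
    refine HasDerivAt.fun_sum fun n _ => ?_
    simp only [chr_sgl]
    refine HasDerivAt.smul_const ?_ _
    convert (hasDerivAt_ee (n i) r).const_mul (c n) using 1
    ring
  have := Convex.norm_image_sub_le_of_norm_hasDerivWithin_le (C := 16 * M * ‖tp s c‖) hd ?_ convex_univ
    (Set.mem_univ 0) (Set.mem_univ t)
  · have e0 : tp s (fun n => c n * chr n (sgl i 0)) = tp s c := by
      refine tp_congr fun n _ => ?_
      rw [chr_sgl]; simp [ee]
    rw [e0, sub_zero, Real.norm_eq_abs] at this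
    linarith
  · intro r _
    rw [tp_smul, norm_smul]
    have h1 := bernstein s (fun n => c n * chr n (sgl i r)) i M hM hs
    rw [norm_tp_shift] at h1
    have h2 : ‖(2 * Real.pi * I : ℂ)‖ = 2 * Real.pi := by
      simp [abs_of_pos Real.pi_pos]
    rw [h2]
    have := Real.pi_le_four
    have := Real.pi_pos
    have h3 : 0 ≤ M * ‖tp s c‖ := by positivity
    calc _ ≤ 2 * Real.pi * (2 * M * ‖tp s c‖) := by gcongr
      _ = 4 * Real.pi * (M * ‖tp s c‖) := by ring
      _ ≤ 4 * 4 * (M * ‖tp s c‖) := by gcongr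
      _ = _ := by ring

lemma shift_add (s : Finset Lat) (c : Lat → ℂ) (a b : Vec) :
    ‖tp s (fun n => c n * chr n (a + b)) - tp s c‖ ≤
      ‖tp s (fun n => c n * chr n a) - tp s c‖ + ‖tp s (fun n => c n * chr n b) - tp s c‖ := by
  have e : tp s (fun n => c n * chr n (a + b)) - tp s c =
    (tp s (fun n => c n * chr n a) - tp s c) +
     tp s (fun n => (c n * chr n b - c n) * chr n a) := by
    have : (fun n => (c n * chr n b - c n) * chr n a) =
      fun n => c n * chr n (a+b) - c n * chr n a := by
      ext n; rw [chr_add_vec]; ring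
    rw [this, tp_sub]; abel
  rw [e]
  refine (norm_add_le _ _).trans ?_
  rw [norm_tp_shift, tp_sub]

lemma vec_sgl (y : Vec) : y = sgl 0 (y 0) + (sgl 1 (y 1) + sgl 2 (y 2)) := by
  ext i
  fin_cases i <;> simp [sgl]

lemma shift_all (s : Finset Lat) (c : Lat → ℂ) (M : ℝ) (hM : 0 < M)
    (hs : ∀ n ∈ s, ∀ i, |((n i : ℤ) : ℝ)| ≤ M) (y : Vec) :
    ‖tp s (fun n => c n * chr n y) - tp s c‖ ≤
      16 * M * (|y 0| + |y 1| + |y 2|) * ‖tp s c‖ := by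
  have e := vec_sgl y
  conv_lhs => rw [e]
  refine (shift_add _ _ _ _).trans ?_
  have := shift_add s c (sgl 1 (y 1)) (sgl 2 (y 2))
  have h0 := shift_one s c 0 M hM (fun n hn => hs n hn 0) (y 0)
  have h1 := shift_one s c 1 M hM (fun n hn => hs n hn 1) (y 1)
  have h2 := shift_one s c 2 M hM (fun n hn => hs n hn 2) (y 2)
  linarith

lemma shift_triv (s : Finset Lat) (c : Lat → ℂ) (y : Vec) :
    ‖tp s (fun n => c n * chr n y) - tp s c‖ ≤ 2 * ‖tp s c‖ := by
  refine (norm_sub_le _ _).trans ?_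
  rw [norm_tp_shift]; linarith



/-! ### Group D1 : three dimensional kernel -/

lemma chr_prod (n : Lat) (y : Fin 3 → ℝ) :
    chr n (WithLp.toLp 2 y) = ∏ i, ee (n i) (y i) := by
  unfold chr ee
  rw [← Complex.exp_sum, Finset.mul_sum]

lemma kernel3 (R : ℕ) (hR : 2 ≤ R) : ∃ (m : Lat → ℝ) (P : Measure Vec),
    IsProbabilityMeasure P ∧ (∀ n, ∫ y, chr n y ∂P = (m n : ℂ)) ∧
    (∀ n : Lat, (∃ i, (R:ℤ) ≤ |n i|) → m n = 0) ∧ (∀ n, m (-n) = m n) ∧ (∀ n, |m n| ≤ 1) ∧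
    (∀ n : Lat, |1 - m n| ≤ 20 * latSq n / (R:ℝ)^2) ∧
    ∀ i : Fin 3, Integrable (fun y : Vec => |y i|) P ∧ ∫ y : Vec, |y i| ∂P ≤ 1 / (R:ℝ) := by
  obtain ⟨m, ν, hν, hm, h0, hev, h1, hd, hintg, hle⟩ := kernel1 R hR
  have hmeas : Measurable (WithLp.toLp 2 : (Fin 3 → ℝ) → Vec) := by
    exact (PiLp.continuous_toLp 2 _).measurable
  refine ⟨fun n => ∏ i, m (n i), Measure.map (WithLp.toLp 2) (Measure.pi fun _ : Fin 3 => ν),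
    Measure.isProbabilityMeasure_map hmeas.aemeasurable, ?_, ?_, ?_, ?_, ?_, ?_⟩
  · intro n
    rw [integral_map hmeas.aemeasurable (continuous_chr n).aestronglyMeasurable]
    simp only [chr_prod]
    rw [integral_fintype_prod_eq_prod (𝕜 := ℂ) (fun i => ee (n i))]
    push_cast
    exact Finset.prod_congr rfl fun i _ => hm (n i)
  · rintro n ⟨i, hi⟩
    exact Finset.prod_eq_zero (Finset.mem_univ i) (h0 _ hi)
  · intro n
    exact Finset.prod_congr rfl fun i _ => by simpa using hev (n i)
  · intro n
    rw [Finset.abs_prod]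
    exact Finset.prod_le_one (fun i _ => abs_nonneg _) fun i _ => h1 _
  · intro n
    simp only [Fin.prod_univ_three, latSq, Fin.sum_univ_three]
    have a := hd (n 0); have b := hd (n 1); have c := hd (n 2)
    have ha := abs_le.1 (h1 (n 0)); have hb := abs_le.1 (h1 (n 1)); have hc := abs_le.1 (h1 (n 2))
    have e : 1 - m (n 0) * m (n 1) * m (n 2) = (1 - m (n 0)) + m (n 0) * (1 - m (n 1)) +
      m (n 0) * m (n 1) * (1 - m (n 2)) := by ring
    rw [e]
    have t1 : |m (n 0) * (1 - m (n 1))| ≤ 1 - m (n 1) := by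
      rw [abs_mul, abs_of_nonneg (a := 1 - m (n 1)) (by linarith)]
      exact mul_le_of_le_one_left (by linarith) (h1 _)
    have t2 : |m (n 0) * m (n 1) * (1 - m (n 2))| ≤ 1 - m (n 2) := by
      rw [abs_mul, abs_of_nonneg (a := 1 - m (n 2)) (by linarith), abs_mul]
      exact mul_le_of_le_one_left (by linarith) (mul_le_one₀ (h1 _) (abs_nonneg _) (h1 _))
    have t0 : |1 - m (n 0)| = 1 - m (n 0) := abs_of_nonneg (by linarith)
    refine (abs_add_three _ _ _).trans ?_
    have : 20 * ((n 0 : ℝ)^2 + (n 1 : ℝ)^2 + (n 2 : ℝ)^2) / (R:ℝ)^2 =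
      20 * (n 0 : ℝ)^2 / (R:ℝ)^2 + 20 * (n 1 : ℝ)^2 / (R:ℝ)^2 + 20 * (n 2 : ℝ)^2 / (R:ℝ)^2 := by ring
    rw [this]
    linarith
  · intro i
    have mp := measurePreserving_eval (fun _ : Fin 3 => ν) i
    have hc : Continuous (fun y : Vec => |y i|) := by fun_prop
    constructor
    · rw [integrable_map_measure hc.aestronglyMeasurable hmeas.aemeasurable]
      exact (mp.integrable_comp (continuous_abs.aestronglyMeasurable)).2 hintg
    · rw [integral_map hmeas.aemeasurable hc.aestronglyMeasurable]
      have : ∫ y : Fin 3 → ℝ, |y i| ∂(Measure.pi fun _ : Fin 3 => ν) = ∫ t, |t| ∂ν := by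
        have := integral_map (μ := Measure.pi fun _ : Fin 3 => ν) mp.measurable.aemeasurable
          (f := fun t : ℝ => |t|) (continuous_abs.aestronglyMeasurable)
        rw [mp.map_eq] at this
        exact this.symm
      exact this.trans_le hle


/-! ### Group D2 : finite flux estimate -/

structure Ker (R : ℕ) where
  m : Lat → ℝ
  P : Measure Vec
  prob : IsProbabilityMeasure P
  hm : ∀ n, ∫ y, chr n y ∂P = (m n : ℂ)
  hz : ∀ n : Lat, (∃ i, (R:ℤ) ≤ |n i|) → m n = 0
  even : ∀ n, m (-n) = m n
  le1 : ∀ n, |m n| ≤ 1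
  near : ∀ n : Lat, |1 - m n| ≤ 20 * latSq n / (R:ℝ)^2
  int1 : ∀ i : Fin 3, Integrable (fun y : Vec => |y i|) P
  mom : ∀ i : Fin 3, ∫ y : Vec, |y i| ∂P ≤ 1 / (R:ℝ)

lemma exists_ker (R : ℕ) (hR : 2 ≤ R) : Nonempty (Ker R) := by
  obtain ⟨m, P, h1, h2, h3, h4, h5, h6, h7⟩ := kernel3 R hR
  exact ⟨⟨m, P, h1, h2, h3, h4, h5, h6, fun i => (h7 i).1, fun i => (h7 i).2⟩⟩

lemma mulLp (p q r : ℝ≥0∞) [hpqr : ENNReal.HolderTriple p q r] (F H : Vec → ℂ)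
    (hF : AEStronglyMeasurable F μT) (hH : AEStronglyMeasurable H μT) :
    eLpNorm (fun x => F x * H x) r μT ≤ eLpNorm F p μT * eLpNorm H q μT := by
  have := eLpNorm_smul_le_mul_eLpNorm (p := p) (q := q) (r := r) hH hF
  exact this

lemma holder3 (F H g : Vec → ℂ) (hF : MemLp F 4 μT) (hH : MemLp H 4 μT) (hg : MemLp g 2 μT) :
    ‖∫ x, F x * H x * g x ∂μT‖ ≤
      (eLpNorm F 4 μT).toReal * (eLpNorm H 4 μT).toReal * (eLpNorm g 2 μT).toReal := by
  have i1 : ENNReal.HolderTriple 4 4 2 := ⟨by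
    rw [← two_mul, show (4:ℝ≥0∞) = 2 * 2 by norm_num, ENNReal.mul_inv (by simp) (by simp), ← mul_assoc,
      ENNReal.mul_inv_cancel (by simp) (by simp), one_mul]⟩
  have i2 : ENNReal.HolderTriple 2 2 1 := inferInstance
  have e1 : eLpNorm (fun x => F x * H x) 2 μT ≤ eLpNorm F 4 μT * eLpNorm H 4 μT :=
    mulLp 4 4 2 F H hF.1 hH.1
  have e2 : eLpNorm (fun x => F x * H x * g x) 1 μT ≤
      eLpNorm (fun x => F x * H x) 2 μT * eLpNorm g 2 μT :=
    mulLp 2 2 1 (fun x => F x * H x) g (hF.1.mul hH.1) hg.1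
  have e3 : ‖∫ x, F x * H x * g x ∂μT‖ₑ ≤ eLpNorm F 4 μT * eLpNorm H 4 μT * eLpNorm g 2 μT := by
    refine (enorm_integral_le_lintegral_enorm _).trans ?_
    rw [← eLpNorm_one_eq_lintegral_enorm]
    exact e2.trans (by gcongr)
  have hfin : eLpNorm F 4 μT * eLpNorm H 4 μT * eLpNorm g 2 μT ≠ ∞ :=
    ENNReal.mul_ne_top (ENNReal.mul_ne_top hF.2.ne hH.2.ne) hg.2.ne
  have := ENNReal.toReal_mono hfin e3
  simpa [ENNReal.toReal_mul] using this

lemma trilin_bound (s b : Finset Lat) (c d : Lat → ℂ) (g : Vec → ℂ) (hg : MemLp g 2 μT) :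
    ‖∑ k ∈ s, ∑ l ∈ b, c k * d l * fc g (-(k + l))‖ ≤
      ‖tp s c‖ * ‖tp b d‖ * (eLpNorm g 2 μT).toReal := by
  have h := holder3 _ _ g (memLp_trig s c 4) (memLp_trig b d 4) hg
  rw [← norm_tp, ← norm_tp] at h
  convert h using 2
  have e : ∀ x, (∑ n ∈ s, c n * chr n x) * (∑ n ∈ b, d n * chr n x) * g x =
      ∑ k ∈ s, ∑ l ∈ b, c k * d l * (g x * chr (-(-(k + l))) x) := by
    intro x
    rw [Finset.sum_mul_sum, Finset.sum_mul]
    refine Finset.sum_congr rfl fun k _ => ?_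
    rw [Finset.sum_mul]
    refine Finset.sum_congr rfl fun l _ => ?_
    rw [neg_neg, chr_add]; ring
  have gi : ∀ n, Integrable (fun x => g x * chr n x) μT := fun n => by
    have := (hg.integrable (by norm_num)).mul_bdd (c := 1) (continuous_chr n).aestronglyMeasurable
      (ae_of_all _ fun x => (norm_chr n x).le)
    exact this
  simp only [e]
  rw [integral_finsetSum _ fun k _ => integrable_finsetSum _ fun l _ => (gi _).const_mul _]
  refine Finset.sum_congr rfl fun k _ => ?_
  rw [integral_finsetSum _ fun l _ => (gi _).const_mul _]
  refine Finset.sum_congr rfl fun l _ => ?_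
  rw [integral_const_mul, fc_eq]

lemma chr_int {R : ℕ} (K : Ker R) (n : Lat) : Integrable (chr n) K.P := by
  have := K.prob
  exact Integrable.of_bound (continuous_chr n).aestronglyMeasurable 1
    (ae_of_all _ fun x => (norm_chr n x).le)

lemma continuous_tp (s : Finset Lat) (c : Lat → ℂ) :
    Continuous fun y => tp s (fun n => c n * chr n y) := by
  unfold tp
  have := continuous_chr
  fun_prop

lemma mult_contr {R : ℕ} (K : Ker R) (s : Finset Lat) (c : Lat → ℂ) :
    ‖tp s (fun n => (K.m n : ℂ) * c n)‖ ≤ ‖tp s c‖ := by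
  have := K.prob
  have e : tp s (fun n => (K.m n : ℂ) * c n) = ∫ y, tp s (fun n => c n * chr n y) ∂K.P := by
    unfold tp
    rw [integral_finsetSum _ fun n _ => ((chr_int K n).const_mul _).smul_const _]
    refine Finset.sum_congr rfl fun n _ => ?_
    rw [integral_smul_const, integral_const_mul, K.hm, mul_comm]
  rw [e]
  have := norm_integral_le_of_norm_le_const (μ := K.P) (C := ‖tp s c‖)
    (f := fun y => tp s (fun n => c n * chr n y)) (ae_of_all _ fun y => (norm_tp_shift s c y).le)
  simpa using this

lemma avg_shift {R : ℕ} (hR : 0 < R) (K : Ker R) (s : Finset Lat) (c : Lat → ℂ) (M : ℝ) (hM : 0 < M)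
    (hs : ∀ n ∈ s, ∀ i, |((n i : ℤ) : ℝ)| ≤ M) (θ : ℝ) (h0 : 0 < θ) (h1 : θ < 1) :
    ∫ y, ‖tp s (fun n => c n * chr n y) - tp s c‖ ∂K.P ≤ 48 * (M / R) ^ θ * ‖tp s c‖ := by
  have := K.prob
  have hR' : (0:ℝ) < R := by exact_mod_cast hR
  have ci : Integrable (fun y => ‖tp s (fun n => c n * chr n y) - tp s c‖) K.P :=
    Integrable.of_bound (((continuous_tp s c).sub continuous_const).norm.aestronglyMeasurable)
      (2 * ‖tp s c‖) (ae_of_all _ fun y => by simpa using shift_triv s c y)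
  have b1 : ∫ y, ‖tp s (fun n => c n * chr n y) - tp s c‖ ∂K.P ≤ 2 * ‖tp s c‖ := by
    have := integral_mono ci (integrable_const (2 * ‖tp s c‖)) (fun y => shift_triv s c y)
    simpa using this
  have b2 : ∫ y, ‖tp s (fun n => c n * chr n y) - tp s c‖ ∂K.P ≤ 48 * (M / R) * ‖tp s c‖ := by
    have i3 : Integrable (fun y : Vec => |y 0| + |y 1| + |y 2|) K.P :=
      ((K.int1 0).add (K.int1 1)).add (K.int1 2)
    have := integral_mono ci ((i3.const_mul (16 * M)).mul_const ‖tp s c‖)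
      (fun y => shift_all s c M hM hs y)
    refine this.trans ?_
    have i4 : Integrable (fun y : Vec => |y 0| + |y 1|) K.P := (K.int1 0).add (K.int1 1)
    rw [integral_mul_const, integral_const_mul, integral_add i4 (K.int1 2),
      integral_add (K.int1 0) (K.int1 1)]
    refine mul_le_mul_of_nonneg_right ?_ (norm_nonneg _)
    calc _ ≤ 16 * M * (1 / R + 1 / R + 1 / R) := by
          have := K.mom 0; have := K.mom 1; have := K.mom 2
          gcongr
      _ = _ := by ring
  have hx : 0 < M / R := by positivity
  rcases le_total (M / R) 1 with h | h
  · refine b2.trans ?_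
    gcongr
    calc M / R = (M / R) ^ (1:ℝ) := by rw [Real.rpow_one]
      _ ≤ _ := Real.rpow_le_rpow_of_exponent_ge hx h h1.le
  · refine b1.trans ?_
    gcongr
    have := Real.one_le_rpow h h0.le
    linarith

/-- the flux estimate for trigonometric polynomials -/
lemma flux_fin {R : ℕ} (hR : 0 < R) (K : Ker R) (s b : Finset Lat) (c d : Lat → ℂ)
    (g : Vec → ℂ) (hg : MemLp g 2 μT) (M : ℝ) (hM : 0 < M)
    (hs : ∀ n ∈ s, ∀ i, |((n i : ℤ) : ℝ)| ≤ M) (θ : ℝ) (h0 : 0 < θ) (h1 : θ < 1) :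
    ‖∑ k ∈ s, ∑ l ∈ b, c k * d l * ((K.m l * K.m l - K.m l * K.m (k + l) : ℝ) : ℂ) * fc g (-(k + l))‖
      ≤ 48 * (M / R) ^ θ * ‖tp s c‖ * ‖tp b d‖ * (eLpNorm g 2 μT).toReal := by
  have := K.prob
  set φ : Vec → ℂ := fun y => ∑ k ∈ s, ∑ l ∈ b, (c k - c k * chr k y) *
    (((K.m l : ℂ) * d l) * chr l y) * fc g (-(k + l)) with hφ
  have e : ∑ k ∈ s, ∑ l ∈ b, c k * d l * ((K.m l * K.m l - K.m l * K.m (k + l) : ℝ) : ℂ) *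
      fc g (-(k + l)) = ∫ y, φ y ∂K.P := by
    have e1 : φ = fun y => ∑ k ∈ s, ∑ l ∈ b, (c k * d l * (K.m l : ℂ) * fc g (-(k + l))) *
        (chr l y - chr (k + l) y) := by
      ext y
      simp only [hφ]
      refine Finset.sum_congr rfl fun k _ => Finset.sum_congr rfl fun l _ => ?_
      rw [chr_add]; ring
    have ii : ∀ k l, Integrable (fun y => (c k * d l * (K.m l : ℂ) * fc g (-(k + l))) *
        (chr l y - chr (k + l) y)) K.P := fun k l =>
      ((chr_int K l).sub (chr_int K (k + l))).const_mul _
    rw [e1, integral_finsetSum _ fun k _ => integrable_finsetSum _ fun l _ => ii k l]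
    refine Finset.sum_congr rfl fun k _ => ?_
    rw [integral_finsetSum _ fun l _ => ii k l]
    refine Finset.sum_congr rfl fun l _ => ?_
    rw [integral_const_mul, integral_sub (chr_int K l) (chr_int K (k + l)), K.hm, K.hm]
    push_cast; ring
  have hb : ∀ y, ‖φ y‖ ≤ ‖tp s (fun n => c n * chr n y) - tp s c‖ *
      (‖tp b d‖ * (eLpNorm g 2 μT).toReal) := by
    intro y
    refine (trilin_bound s b _ _ g hg).trans ?_
    rw [norm_tp_shift, tp_sub, norm_sub_rev, mul_assoc]
    gcongr
    exact mult_contr K b d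
  have ci : Integrable (fun y => ‖tp s (fun n => c n * chr n y) - tp s c‖) K.P :=
    Integrable.of_bound (((continuous_tp s c).sub continuous_const).norm.aestronglyMeasurable)
      (2 * ‖tp s c‖) (ae_of_all _ fun y => by simpa using shift_triv s c y)
  rw [e]
  refine (norm_integral_le_of_norm_le (ci.mul_const _) (ae_of_all _ hb)).trans ?_
  rw [integral_mul_const]
  have := avg_shift hR K s c M hM hs θ h0 h1
  calc _ ≤ (48 * (M / R) ^ θ * ‖tp s c‖) * (‖tp b d‖ * (eLpNorm g 2 μT).toReal) := by gcongr
    _ = _ := by ring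


/-! ### Group D3 : dyadic balls and Besov norms -/

lemma abs_le_latNorm (n : Lat) (i : Fin 3) : |(n i : ℝ)| ≤ latNorm n := by
  unfold latNorm
  refine Real.abs_le_sqrt ?_
  exact Finset.single_le_sum (f := fun i => (n i : ℝ)^2) (fun i _ => sq_nonneg _) (Finset.mem_univ i)

lemma latNorm_nonneg (n : Lat) : 0 ≤ latNorm n := Real.sqrt_nonneg _

lemma ball_finite (r : ℝ) : {n : Lat | latNorm n < r}.Finite := by
  refine Set.Finite.subset (Fintype.piFinset fun _ : Fin 3 => Finset.Icc (-⌈r⌉) ⌈r⌉).finite_toSet ?_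
  intro n hn
  simp only [Finset.mem_coe, Fintype.mem_piFinset, Finset.mem_Icc]
  intro i
  have h1 := (abs_le_latNorm n i).trans (le_of_lt hn)
  have h2 := abs_le.1 (h1.trans (Int.le_ceil r))
  exact ⟨by exact_mod_cast h2.1, by exact_mod_cast h2.2⟩

def ballF (K : ℕ) : Finset Lat := (ball_finite ((2:ℝ)^K)).toFinset

lemma mem_ballF (K : ℕ) (n : Lat) : n ∈ ballF K ↔ latNorm n < (2:ℝ)^K := by simp [ballF]

lemma ballF_mono (K : ℕ) : ballF K ⊆ ballF (K + 1) := by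
  intro n hn
  rw [mem_ballF] at *
  refine hn.trans ?_
  rw [pow_succ]; linarith [pow_pos (two_pos (α := ℝ)) K]

open Classical in
def shellF (j : ℕ) : Finset Lat := ballF (j + 1) \ ballF j

lemma mem_shellF (j : ℕ) (n : Lat) : n ∈ shellF j ↔ n ∈ shell j := by
  simp [shellF, mem_ballF, shell, and_comm]

lemma sum_ballF_succ {M : Type*} [AddCommMonoid M] (K : ℕ) (f : Lat → M) :
    ∑ n ∈ ballF (K + 1), f n = ∑ n ∈ ballF K, f n + ∑ n ∈ shellF K, f n := by
  classical
  unfold shellF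
  rw [← Finset.sum_sdiff (ballF_mono K), add_comm]

lemma ballF_zero : ballF 0 = {0} := by
  ext n
  rw [mem_ballF, Finset.mem_singleton]
  constructor
  · intro h
    ext i
    have h1 := (abs_le_latNorm n i).trans_lt h
    rw [pow_zero] at h1
    have : |n i| < 1 := by exact_mod_cast h1
    simpa using Int.abs_lt_one_iff.1 this
  · rintro rfl
    simp [latNorm]

lemma ballF_tendsto : Tendsto ballF atTop atTop := by
  refine tendsto_atTop_finset_of_monotone (monotone_nat_of_le_succ ballF_mono) ?_
  intro n
  obtain ⟨K, hK⟩ := pow_unbounded_of_one_lt (latNorm n) (one_lt_two (α := ℝ))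
  exact ⟨K, (mem_ballF K n).2 hK⟩

lemma latNorm_neg (n : Lat) : latNorm (-n) = latNorm n := by simp [latNorm]

lemma neg_mem_ballF (K : ℕ) (n : Lat) : -n ∈ ballF K ↔ n ∈ ballF K := by
  rw [mem_ballF, mem_ballF, latNorm_neg]

lemma lpBlock_eq (j : ℕ) (c : Lat → ℂ) :
    lpBlockC j c = fun x => ∑ n ∈ shellF j, c n * chr n x := by
  ext x
  unfold lpBlockC
  rw [tsum_eq_sum (s := shellF j)]
  · refine Finset.sum_congr rfl fun n hn => ?_
    rw [Set.indicator_of_mem ((mem_shellF j n).1 hn)]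
  · intro n hn
    rw [Set.indicator_of_notMem (fun h => hn ((mem_shellF j n).2 h))]

lemma lpLow_eq (c : Lat → ℂ) : lpLowC c = fun x => ∑ n ∈ ballF 0, c n * chr n x := by
  ext x
  unfold lpLowC
  rw [tsum_eq_sum (s := ballF 0)]
  · refine Finset.sum_congr rfl fun n hn => ?_
    rw [Set.indicator_of_mem]
    simpa [mem_ballF] using hn
  · intro n hn
    rw [Set.indicator_of_notMem]
    simpa [mem_ballF] using hn

lemma besov_low (s : ℝ) (c : Lat → ℂ) (h : besovC s 4 ∞ c ≠ ∞) :
    ‖tp (ballF 0) c‖ ≤ (besovC s 4 ∞ c).toReal := by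
  rw [norm_tp, ← lpLow_eq]
  exact ENNReal.toReal_mono h le_self_add

lemma besov_block (s : ℝ) (c : Lat → ℂ) (h : besovC s 4 ∞ c ≠ ∞) (j : ℕ) :
    ‖tp (shellF j) c‖ ≤ (2:ℝ) ^ (-(s * j)) * (besovC s 4 ∞ c).toReal := by
  rw [norm_tp, ← lpBlock_eq]
  have h1 : ENNReal.ofReal ((2:ℝ) ^ (s * (j:ℝ))) * eLpNorm (lpBlockC j c) 4 μT ≤ besovC s 4 ∞ c := by
    unfold besovC
    rw [if_pos rfl]
    exact (le_iSup (fun j : ℕ => ENNReal.ofReal ((2:ℝ) ^ (s * (j:ℝ))) * eLpNorm (lpBlockC j c) 4 μT)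
      j).trans le_add_self
  have h2 := ENNReal.toReal_mono h h1
  have hp : (0:ℝ) < (2:ℝ) ^ (s * (j:ℝ)) := by positivity
  rw [ENNReal.toReal_mul, ENNReal.toReal_ofReal hp.le] at h2
  rw [Real.rpow_neg (by norm_num), inv_mul_eq_div, le_div_iff₀ hp]
  linarith

lemma ball_bound (a : ℝ) (ha : 0 < a) (c : Lat → ℂ) (h : besovC (-a) 4 ∞ c ≠ ∞) (J : ℕ) :
    ‖tp (ballF (J + 1)) c‖ ≤ (J + 2) * (2:ℝ) ^ (a * J) * (besovC (-a) 4 ∞ c).toReal := by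
  set X := (besovC (-a) 4 ∞ c).toReal with hX
  have hX0 : 0 ≤ X := ENNReal.toReal_nonneg
  have key : ∀ K ≤ J + 1, ‖tp (ballF K) c‖ ≤ (K + 1) * (2:ℝ) ^ (a * J) * X := by
    intro K
    induction K with
    | zero =>
      intro _
      refine (besov_low _ c h).trans ?_
      have : (1:ℝ) ≤ (2:ℝ) ^ (a * J) := Real.one_le_rpow (by norm_num) (by positivity)
      rw [← hX]
      push_cast
      nlinarith
    | succ K ih =>
      intro hK
      have e : tp (ballF (K + 1)) c = tp (ballF K) c + tp (shellF K) c := sum_ballF_succ K _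
      rw [e]
      refine (norm_add_le _ _).trans ?_
      have h1 := ih (by omega)
      have h2 := besov_block _ c h K
      have h3 : (2:ℝ) ^ (-(-a * K)) ≤ (2:ℝ) ^ (a * J) := by
        refine Real.rpow_le_rpow_of_exponent_le (by norm_num) ?_
        have : (K:ℝ) ≤ J := by exact_mod_cast (by omega : K ≤ J)
        nlinarith
      have h4 := h2.trans (mul_le_mul_of_nonneg_right h3 hX0)
      push_cast
      linarith
  have := key (J + 1) le_rfl
  push_cast at this
  convert this using 3
  ring

/-- flux restricted to frequencies of f in the ball of radius 2^K -/
def fluxK {R : ℕ} (Kr : Ker R) (b : Finset Lat) (c d : Lat → ℂ) (g : Vec → ℂ) (s : Finset Lat) : ℂ :=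
  ∑ k ∈ s, ∑ l ∈ b, c k * d l * ((Kr.m l * Kr.m l - Kr.m l * Kr.m (k + l) : ℝ) : ℂ) * fc g (-(k + l))

lemma fluxK_bound (J : ℕ) (Kr : Ker (2 ^ J)) (c d : Lat → ℂ) (g : Vec → ℂ)
    (hg : MemLp g 2 μT) (a₁ a₂ θ : ℝ) (h1 : 0 < a₁) (h1θ : a₁ < θ) (hθ2 : θ < a₂) (h2 : a₂ < 1)
    (hc : besovC a₂ 4 ∞ c ≠ ∞) (hd : besovC (-a₁) 4 ∞ d ≠ ∞) (K : ℕ) :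
    ‖fluxK Kr (ballF (J + 1)) c d g (ballF K)‖ ≤
      (96 / (1 - (2:ℝ) ^ (-(a₂ - θ))) * ((J + 2) * (2:ℝ) ^ (-((θ - a₁) * J)))) *
        (besovC a₂ 4 ∞ c).toReal * (besovC (-a₁) 4 ∞ d).toReal * (eLpNorm g 2 μT).toReal := by
  set X := (besovC a₂ 4 ∞ c).toReal with hX
  set Y := (besovC (-a₁) 4 ∞ d).toReal with hY
  set G := (eLpNorm g 2 μT).toReal with hG
  have hX0 : 0 ≤ X := ENNReal.toReal_nonneg
  have hY0 : 0 ≤ Y := ENNReal.toReal_nonneg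
  have hG0 : 0 ≤ G := ENNReal.toReal_nonneg
  set q : ℝ := (2:ℝ) ^ (-(a₂ - θ)) with hq
  have hq0 : 0 < q := by positivity
  have hq1 : q < 1 := Real.rpow_lt_one_of_one_lt_of_neg (by norm_num) (by linarith)
  set Z := (J + 2) * (2:ℝ) ^ (-((θ - a₁) * J)) with hZ
  have hZ0 : 0 ≤ Z := by positivity
  have key : ∀ K : ℕ, ‖fluxK Kr (ballF (J + 1)) c d g (ballF K)‖ ≤
      (∑ j ∈ Finset.range K, q ^ j) * (96 * Z * X * Y * G) := by
    intro K
    induction K with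
    | zero =>
      rw [ballF_zero]
      simp [fluxK]
    | succ K ih =>
      have e : fluxK Kr (ballF (J + 1)) c d g (ballF (K + 1)) =
        fluxK Kr (ballF (J + 1)) c d g (ballF K) + fluxK Kr (ballF (J + 1)) c d g (shellF K) :=
        sum_ballF_succ K _
      rw [e, Finset.sum_range_succ, add_mul]
      refine (norm_add_le _ _).trans (add_le_add ih ?_)
      have hs : ∀ n ∈ shellF K, ∀ i, |((n i : ℤ) : ℝ)| ≤ (2:ℝ) ^ (K + 1) := by
        intro n hn i
        exact (abs_le_latNorm n i).trans ((mem_shellF K n).1 hn).2.le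
      have hh := flux_fin (R := 2 ^ J) (by positivity) Kr (shellF K) (ballF (J + 1)) c d g hg
        ((2:ℝ) ^ (K + 1)) (by positivity) hs θ (by linarith) (by linarith)
      have b1 := besov_block a₂ c hc K
      have b2 := ball_bound a₁ h1 d hd J
      rw [← hX] at b1
      rw [← hY] at b2
      rw [← hG] at hh
      have hp : ((2:ℝ) ^ (K + 1) / ((2 ^ J : ℕ) : ℝ)) ^ θ ≤ 2 * ((2:ℝ) ^ (θ * K) * (2:ℝ) ^ (-(θ * J))) := by
        have e2 : (2:ℝ) ^ (K + 1) / ((2 ^ J : ℕ) : ℝ) = (2:ℝ) ^ ((K:ℝ) + 1 - J) := by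
          rw [Real.rpow_sub (by norm_num), Real.rpow_natCast]
          rw [show ((K:ℝ) + 1) = ((K + 1 : ℕ) : ℝ) by push_cast; ring, Real.rpow_natCast]
          push_cast; rfl
        rw [e2, ← Real.rpow_mul (by norm_num), ← Real.rpow_add (by norm_num)]
        have : (2:ℝ) * (2:ℝ) ^ (θ * K + -(θ * J)) = (2:ℝ) ^ (1 + (θ * K + -(θ * J))) := by
          rw [Real.rpow_add (by norm_num) 1, Real.rpow_one]
        rw [this]
        refine Real.rpow_le_rpow_of_exponent_le (by norm_num) ?_
        nlinarith
      refine (show ‖fluxK Kr (ballF (J + 1)) c d g (shellF K)‖ ≤ _ from hh).trans ?_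
      calc 48 * ((2:ℝ) ^ (K + 1) / ((2 ^ J : ℕ) : ℝ)) ^ θ * ‖tp (shellF K) c‖ * ‖tp (ballF (J + 1)) d‖ * G
          ≤ 48 * (2 * ((2:ℝ) ^ (θ * K) * (2:ℝ) ^ (-(θ * J)))) * ((2:ℝ) ^ (-(a₂ * K)) * X) *
            ((J + 2) * (2:ℝ) ^ (a₁ * J) * Y) * G := by gcongr
        _ = ((2:ℝ) ^ (θ * K) * (2:ℝ) ^ (-(a₂ * K))) * (96 * ((J + 2) *
            ((2:ℝ) ^ (-(θ * J)) * (2:ℝ) ^ (a₁ * J))) * X * Y * G) := by ring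
        _ = q ^ K * (96 * Z * X * Y * G) := by
          rw [hZ, hq, ← Real.rpow_natCast, ← Real.rpow_mul (by norm_num), ← Real.rpow_add (by norm_num),
            ← Real.rpow_add (by norm_num)]
          congr 3
          · ring
          · congr 3; ring_nf
  refine (key K).trans ?_
  have hgeom : ∑ j ∈ Finset.range K, q ^ j ≤ 1 / (1 - q) := by
    have := (summable_geometric_of_lt_one hq0.le hq1).sum_le_tsum (Finset.range K)
      (fun i _ => by positivity)
    rwa [tsum_geometric_of_lt_one hq0.le hq1, ← one_div] at this
  calc _ ≤ (1 / (1 - q)) * (96 * Z * X * Y * G) := by gcongr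
    _ = _ := by ring


/-! ### Group D4 : passing to the limit; the cyclic cancellation -/

lemma fc_conj (f : Vec → ℂ) (n : Lat) :
    fc (fun x => (starRingEnd ℂ) (f x)) n = (starRingEnd ℂ) (fc f (-n)) := by
  rw [fc_eq, fc_eq, ← integral_conj]
  simp only [map_mul, chr_neg, neg_neg]

lemma fc_mul_chr (g : Vec → ℂ) (l n : Lat) : fc (fun x => g x * chr l x) n = fc g (n - l) := by
  rw [fc_eq, fc_eq]
  congr 1; ext x
  rw [mul_assoc, ← chr_add]; congr 2; abel

lemma memLp_mul_chr (g : Vec → ℂ) (hg : MemLp g 2 μT) (l : Lat) :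
    MemLp (fun x => g x * chr l x) 2 μT := by
  refine hg.of_le (hg.1.mul (continuous_chr l).aestronglyMeasurable) (ae_of_all _ fun x => ?_)
  rw [norm_mul, norm_chr, mul_one]

lemma memLp_conj (f : Vec → ℂ) (hf : MemLp f 2 μT) :
    MemLp (fun x => (starRingEnd ℂ) (f x)) 2 μT := by
  refine hf.of_le (Complex.continuous_conj.comp_aestronglyMeasurable hf.1) (ae_of_all _ fun x => ?_)
  simp

lemma hasSum_prod (f g : Vec → ℂ) (hf : MemLp f 2 μT) (hg : MemLp g 2 μT) (l : Lat) :
    HasSum (fun k => fc f k * fc g (-(k + l))) (fc (fun x => f x * g x) (-l)) := by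
  have h := parseval_conj _ _ (memLp_conj f hf) (memLp_mul_chr g hg l)
  simp only [fc_conj, fc_mul_chr, Complex.conj_conj] at h
  have h2 := (Equiv.neg Lat).hasSum_iff.2 h
  convert h2 using 1
  · ext k
    simp only [Function.comp, Equiv.neg_apply, neg_neg]
    congr 2; abel
  · rw [fc_eq]
    congr 1; ext x
    rw [neg_neg]; ring

def Wt {R : ℕ} (Kr : Ker R) (b : Finset Lat) (f g h : Vec → ℂ) : ℂ :=
  ∑ l ∈ b, (Kr.m l : ℂ) * (Kr.m l : ℂ) * fc h l * fc (fun x => f x * g x) (-l)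

def Vt {R : ℕ} (Kr : Ker R) (b : Finset Lat) (f g h : Vec → ℂ) : ℂ :=
  ∑ l ∈ b, ∑ p ∈ b, (Kr.m l : ℂ) * (Kr.m p : ℂ) * fc h l * fc g p * fc f (-(p + l))

lemma Vt_symm {R : ℕ} (Kr : Ker R) (b : Finset Lat) (f g h : Vec → ℂ) :
    Vt Kr b f g h = Vt Kr b f h g := by
  unfold Vt
  rw [Finset.sum_comm]
  refine Finset.sum_congr rfl fun l _ => Finset.sum_congr rfl fun p _ => ?_
  rw [add_comm l p]; ring

lemma ker_supp (J : ℕ) (Kr : Ker (2 ^ J)) (n : Lat) (hn : n ∉ ballF (J + 1)) : Kr.m n = 0 := by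
  apply Kr.hz
  by_contra! hcon
  apply hn
  rw [mem_ballF, latNorm, Real.sqrt_lt' (by positivity)]
  have h : ∀ i, ((n i : ℤ) : ℝ) ^ 2 ≤ (2:ℝ) ^ J * (2:ℝ) ^ J := by
    intro i
    have h1 : |((n i : ℤ) : ℝ)| ≤ (2:ℝ) ^ J := by
      have := (hcon i).le
      exact_mod_cast this
    rw [← sq_abs, sq]
    gcongr
  rw [Fin.sum_univ_three, pow_succ (2:ℝ) J]
  have := h 0; have := h 1; have := h 2
  have : (0:ℝ) < (2:ℝ) ^ J * (2:ℝ) ^ J := by positivity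
  nlinarith

lemma flux_tendsto (J : ℕ) (Kr : Ker (2 ^ J)) (f g h : Vec → ℂ) (hf : MemLp f 2 μT)
    (hg : MemLp g 2 μT) :
    Tendsto (fun K => fluxK Kr (ballF (J + 1)) (fc f) (fc h) g (ballF K)) atTop
      (𝓝 (Wt Kr (ballF (J + 1)) f g h - Vt Kr (ballF (J + 1)) f g h)) := by
  set b := ballF (J + 1) with hb
  have hl : ∀ l, HasSum (fun k => fc f k * fc h l * ((Kr.m l * Kr.m l - Kr.m l * Kr.m (k + l) : ℝ) : ℂ) *
      fc g (-(k + l))) ((Kr.m l : ℂ) * (Kr.m l : ℂ) * fc h l * fc (fun x => f x * g x) (-l) -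
        ∑ p ∈ b, (Kr.m l : ℂ) * (Kr.m p : ℂ) * fc h l * fc g p * fc f (-(p + l))) := by
    intro l
    have a1 := (hasSum_prod f g hf hg l).mul_left ((Kr.m l : ℂ) * (Kr.m l : ℂ) * fc h l)
    have a2 : HasSum (fun k => (Kr.m l : ℂ) * (Kr.m (k + l) : ℂ) * fc h l * fc g (-(k + l)) * fc f k)
        (∑ p ∈ b, (Kr.m l : ℂ) * (Kr.m p : ℂ) * fc h l * fc g p * fc f (-(p + l))) := by
      have a3 : HasSum (fun p => (Kr.m l : ℂ) * (Kr.m p : ℂ) * fc h l * fc g p * fc f (-(p + l)))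
          (∑ p ∈ b, (Kr.m l : ℂ) * (Kr.m p : ℂ) * fc h l * fc g p * fc f (-(p + l))) := by
        refine hasSum_sum_of_ne_finset_zero fun p hp => ?_
        rw [ker_supp J Kr p hp]; simp
      have a4 := ((Equiv.addRight l).trans (Equiv.neg Lat)).hasSum_iff.2 a3
      convert a4 using 1
      ext k
      simp only [Function.comp, Equiv.trans_apply, Equiv.coe_addRight, Equiv.neg_apply, Kr.even]
      congr 2; abel
    have a5 := a1.sub a2
    refine Eq.mp ?_ a5
    congr 1
    ext k
    push_cast; ring
  have e : ∀ s, fluxK Kr b (fc f) (fc h) g s = ∑ l ∈ b, ∑ k ∈ s, fc f k * fc h l *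
    ((Kr.m l * Kr.m l - Kr.m l * Kr.m (k + l) : ℝ) : ℂ) * fc g (-(k + l)) := fun s => Finset.sum_comm
  have e2 : Wt Kr b f g h - Vt Kr b f g h = ∑ l ∈ b, ((Kr.m l : ℂ) * (Kr.m l : ℂ) * fc h l *
      fc (fun x => f x * g x) (-l) -
        ∑ p ∈ b, (Kr.m l : ℂ) * (Kr.m p : ℂ) * fc h l * fc g p * fc f (-(p + l))) := by
    rw [Finset.sum_sub_distrib]; rfl
  simp only [e]
  rw [e2]
  refine tendsto_finsetSum _ fun l _ => ?_
  exact (hl l).comp ballF_tendsto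

def epsJ (a₁ a₂ θ : ℝ) (J : ℕ) : ℝ :=
  96 / (1 - (2:ℝ) ^ (-(a₂ - θ))) * ((J + 2) * (2:ℝ) ^ (-((θ - a₁) * J)))

lemma epsJ_nonneg (a₁ a₂ θ : ℝ) (hθ2 : θ < a₂) (J : ℕ) : 0 ≤ epsJ a₁ a₂ θ J := by
  have hq1 : (2:ℝ) ^ (-(a₂ - θ)) < 1 := Real.rpow_lt_one_of_one_lt_of_neg (by norm_num) (by linarith)
  have : 0 < 1 - (2:ℝ) ^ (-(a₂ - θ)) := by linarith
  unfold epsJ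
  positivity

lemma epsJ_tendsto (a₁ a₂ θ : ℝ) (h1θ : a₁ < θ) : Tendsto (epsJ a₁ a₂ θ) atTop (𝓝 0) := by
  unfold epsJ
  set r : ℝ := (2:ℝ) ^ (-(θ - a₁)) with hr
  have hr0 : 0 < r := by positivity
  have hr1 : r < 1 := Real.rpow_lt_one_of_one_lt_of_neg (by norm_num) (by linarith)
  have e : ∀ J : ℕ, ((J:ℝ) + 2) * (2:ℝ) ^ (-((θ - a₁) * J)) = J * r ^ J + 2 * r ^ J := by
    intro J
    rw [hr, ← Real.rpow_natCast, ← Real.rpow_mul (by norm_num)]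
    ring_nf
  simp only [e]
  have t1 := tendsto_self_mul_const_pow_of_lt_one hr0.le hr1
  have t2 := tendsto_pow_atTop_nhds_zero_of_lt_one hr0.le hr1
  have := (t1.add (t2.const_mul 2)).const_mul (96 / (1 - (2:ℝ) ^ (-(a₂ - θ))))
  simpa using this

lemma flux_est (J : ℕ) (Kr : Ker (2 ^ J)) (f g h : Vec → ℂ) (hf : MemLp f 2 μT)
    (hg : MemLp g 2 μT) (a₁ a₂ θ : ℝ) (h1 : 0 < a₁) (h1θ : a₁ < θ) (hθ2 : θ < a₂) (h2 : a₂ < 1)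
    (hc : besov a₂ 4 ∞ f ≠ ∞) (hd : besov (-a₁) 4 ∞ h ≠ ∞) :
    ‖Wt Kr (ballF (J + 1)) f g h - Vt Kr (ballF (J + 1)) f g h‖ ≤
      epsJ a₁ a₂ θ J * (besov a₂ 4 ∞ f).toReal * (besov (-a₁) 4 ∞ h).toReal *
        (eLpNorm g 2 μT).toReal :=
  le_of_tendsto (flux_tendsto J Kr f g h hf hg).norm (Eventually.of_forall fun K =>
    fluxK_bound J Kr (fc f) (fc h) g hg a₁ a₂ θ h1 h1θ hθ2 h2 hc hd K)

/-- Fourier coefficients of u × B -/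
def fcE (u B : Vec → Vec) (j : Fin 3) (n : Lat) : ℂ :=
  fc (fun x => uC u (j + 1) x * uC B (j + 2) x) n - fc (fun x => uC u (j + 2) x * uC B (j + 1) x) n

def SN {R : ℕ} (Kr : Ker R) (b : Finset Lat) (u B : Vec → Vec) : ℂ :=
  ∑ n ∈ b, ((Kr.m n * Kr.m n : ℝ) : ℂ) * ∑ j, fcE u B j n * (starRingEnd ℂ) (fcV B j n)

lemma fcV_conj (B : Vec → Vec) (j : Fin 3) (n : Lat) :
    (starRingEnd ℂ) (fcV B j n) = fcV B j (-n) := by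
  unfold fcV
  have := fc_conj (fun x => (B x j : ℂ)) (-n)
  rw [neg_neg] at this
  rw [← this]
  simp only [Complex.conj_ofReal]

lemma memLp_comp (B : Vec → Vec) (hB : MemLp B 2 μT) (j : Fin 3) : MemLp (uC B j) 2 μT := by
  refine hB.of_le ?_ (ae_of_all _ fun x => ?_)
  · unfold uC
    have : Continuous fun v : Vec => ((v j : ℝ) : ℂ) := by fun_prop
    exact this.comp_aestronglyMeasurable hB.1
  · simp only [uC, Complex.norm_real]
    exact PiLp.norm_apply_le _ _

lemma eLpNorm_comp_le (B : Vec → Vec) (j : Fin 3) :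
    eLpNorm (uC B j) 2 μT ≤ eLpNorm B 2 μT := by
  refine eLpNorm_mono fun x => ?_
  simp only [uC, Complex.norm_real]
  exact PiLp.norm_apply_le _ _

lemma SN_eq (J : ℕ) (Kr : Ker (2 ^ J)) (u B : Vec → Vec) :
    SN Kr (ballF (J + 1)) u B =
      ∑ j, (Wt Kr (ballF (J + 1)) (uC u (j + 1)) (uC B (j + 2)) (uC B j) -
        Wt Kr (ballF (J + 1)) (uC u (j + 2)) (uC B (j + 1)) (uC B j)) := by
  unfold SN Wt
  set b := ballF (J + 1) with hb
  have e : ∑ n ∈ b, ((Kr.m n * Kr.m n : ℝ) : ℂ) * ∑ j, fcE u B j n * (starRingEnd ℂ) (fcV B j n) =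
    ∑ n ∈ b, ((Kr.m n * Kr.m n : ℝ) : ℂ) * ∑ j, fcE u B j (-n) * fcV B j n := by
    refine Finset.sum_nbij' (fun n => -n) (fun n => -n) ?_ ?_ ?_ ?_ ?_
    · intro n hn; exact (neg_mem_ballF _ _).2 hn
    · intro n hn; exact (neg_mem_ballF _ _).2 hn
    · intro n _; simp
    · intro n _; simp
    · intro n _
      simp only [Kr.even, neg_neg, fcV_conj]
  rw [e]
  simp only [← Finset.sum_sub_distrib]
  rw [Finset.sum_comm]
  refine Finset.sum_congr rfl fun n _ => ?_
  rw [Finset.mul_sum]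
  refine Finset.sum_congr rfl fun j _ => ?_
  have : fcV B j n = fc (uC B j) n := rfl
  rw [this, fcE]
  push_cast; ring

lemma SN_bound (J : ℕ) (Kr : Ker (2 ^ J)) (u B : Vec → Vec) (hu : MemLp u 2 μT)
    (hB : MemLp B 2 μT) (a₁ a₂ θ : ℝ) (h1 : 0 < a₁) (h1θ : a₁ < θ) (hθ2 : θ < a₂) (h2 : a₂ < 1)
    (hc : besovV a₂ 4 ∞ u ≠ ∞) (hd : besovV (-a₁) 4 ∞ B ≠ ∞) :
    ‖SN Kr (ballF (J + 1)) u B‖ ≤ 6 * (epsJ a₁ a₂ θ J * (besovV a₂ 4 ∞ u).toReal *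
      (besovV (-a₁) 4 ∞ B).toReal * (eLpNorm B 2 μT).toReal) := by
  set b := ballF (J + 1) with hb
  have e : SN Kr b u B = ∑ j : Fin 3, ((Wt Kr b (uC u (j + 1)) (uC B (j + 2)) (uC B j) -
        Vt Kr b (uC u (j + 1)) (uC B (j + 2)) (uC B j)) -
      (Wt Kr b (uC u (j + 2)) (uC B (j + 1)) (uC B j) -
        Vt Kr b (uC u (j + 2)) (uC B (j + 1)) (uC B j))) := by
    rw [hb, SN_eq, ← hb]
    have c0 := Vt_symm Kr b (uC u 0) (uC B 1) (uC B 2)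
    have c1 := Vt_symm Kr b (uC u 1) (uC B 2) (uC B 0)
    have c2 := Vt_symm Kr b (uC u 2) (uC B 0) (uC B 1)
    have x1 : (1 + 1 : Fin 3) = 2 := rfl
    have x2 : (1 + 2 : Fin 3) = 0 := rfl
    have x3 : (2 + 1 : Fin 3) = 0 := rfl
    have x4 : (2 + 2 : Fin 3) = 1 := rfl
    simp only [Fin.sum_univ_three, zero_add, x1, x2, x3, x4]
    rw [c0, c1, c2]
    ring
  have lu : ∀ i, besov a₂ 4 ∞ (uC u i) ≤ besovV a₂ 4 ∞ u := fun i =>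
    Finset.single_le_sum (f := fun j => besov a₂ 4 ∞ (uC u j)) (fun _ _ => zero_le) (Finset.mem_univ i)
  have lB : ∀ i, besov (-a₁) 4 ∞ (uC B i) ≤ besovV (-a₁) 4 ∞ B := fun i =>
    Finset.single_le_sum (f := fun j => besov (-a₁) 4 ∞ (uC B j)) (fun _ _ => zero_le)
      (Finset.mem_univ i)
  have he := epsJ_nonneg a₁ a₂ θ hθ2 J
  have hone : ∀ i k l : Fin 3, ‖Wt Kr b (uC u i) (uC B k) (uC B l) -
      Vt Kr b (uC u i) (uC B k) (uC B l)‖ ≤ epsJ a₁ a₂ θ J * (besovV a₂ 4 ∞ u).toReal *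
      (besovV (-a₁) 4 ∞ B).toReal * (eLpNorm B 2 μT).toReal := by
    intro i k l
    have q1 := ENNReal.toReal_mono hc (lu i)
    have q2 := ENNReal.toReal_mono hd (lB l)
    have q3 := ENNReal.toReal_mono hB.2.ne (eLpNorm_comp_le B k)
    refine (flux_est J Kr _ _ _ (memLp_comp u hu i) (memLp_comp B hB k) a₁ a₂ θ h1 h1θ hθ2 h2
      (ne_top_of_le_ne_top hc (lu i)) (ne_top_of_le_ne_top hd (lB l))).trans ?_
    gcongr
  rw [e]
  refine (norm_sum_le _ _).trans ?_
  refine (Finset.sum_le_sum fun j _ => (norm_sub_le _ _).trans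
    (add_le_add (hone _ _ _) (hone _ _ _))).trans ?_
  simp only [Finset.sum_const, Finset.card_univ, Fintype.card_fin, nsmul_eq_mul]
  push_cast; linarith


/-! ### Time lemmas -/

instance isFin_tIoo (T : ℝ) : IsFiniteMeasure (tIoo T) := by
  unfold tIoo; infer_instance

/-- `f` agrees a.e. with an absolutely continuous function with derivative `g`. -/
def WD (T : ℝ) (f g : ℝ → ℝ) : Prop :=
  ∃ F : ℝ → ℝ, AbsolutelyContinuousOnInterval F 0 T ∧ (∀ᵐ t ∂tIoo T, f t = F t) ∧
    (∀ᵐ t ∂tIoo T, g t = deriv F t)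

lemma AC_ae_diff {T : ℝ} (hT : 0 < T) {F : ℝ → ℝ} (hF : AbsolutelyContinuousOnInterval F 0 T) :
    ∀ᵐ t ∂tIoo T, DifferentiableAt ℝ F t := by
  unfold tIoo
  rw [ae_restrict_iff' measurableSet_Ioo]
  filter_upwards [hF.ae_differentiableAt] with t ht h
  apply ht
  rw [Set.uIcc_of_le hT.le]
  exact Set.Ioo_subset_Icc_self h

lemma WD.add {T : ℝ} (hT : 0 < T) {f g f' g' : ℝ → ℝ} (h : WD T f g) (h' : WD T f' g') :
    WD T (fun t => f t + f' t) (fun t => g t + g' t) := by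
  obtain ⟨F, hF, h1, h2⟩ := h
  obtain ⟨F', hF', h1', h2'⟩ := h'
  refine ⟨fun t => F t + F' t, hF.add hF', ?_, ?_⟩
  · filter_upwards [h1, h1'] with t a b
    rw [a, b]
  · filter_upwards [h2, h2', AC_ae_diff hT hF, AC_ae_diff hT hF'] with t a b c d
    rw [a, b, deriv_fun_add c d]

lemma WD.mul {T : ℝ} (hT : 0 < T) {f g f' g' : ℝ → ℝ} (h : WD T f g) (h' : WD T f' g') :
    WD T (fun t => f t * f' t) (fun t => g t * f' t + f t * g' t) := by
  obtain ⟨F, hF, h1, h2⟩ := h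
  obtain ⟨F', hF', h1', h2'⟩ := h'
  refine ⟨fun t => F t * F' t, hF.fun_mul hF', ?_, ?_⟩
  · filter_upwards [h1, h1'] with t a b
    rw [a, b]
  · filter_upwards [h1, h1', h2, h2', AC_ae_diff hT hF, AC_ae_diff hT hF'] with t a' b' a b c d
    rw [a, b, a', b', deriv_fun_mul c d]

lemma WD.const (T : ℝ) (c : ℝ) : WD T (fun _ => c) (fun _ => 0) :=
  ⟨fun _ => c, (contDiff_const.contDiffOn).absolutelyContinuousOnInterval, by simp, by simp⟩

lemma WD.congr {T : ℝ} {f g f' g' : ℝ → ℝ} (h : WD T f g) (hf : ∀ᵐ t ∂tIoo T, f' t = f t)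
    (hg : ∀ᵐ t ∂tIoo T, g' t = g t) : WD T f' g' := by
  obtain ⟨F, hF, h1, h2⟩ := h
  refine ⟨F, hF, ?_, ?_⟩
  · filter_upwards [h1, hf] with t a b
    rw [b, a]
  · filter_upwards [h2, hg] with t a b
    rw [b, a]

lemma WD.bound {T : ℝ} (hT : 0 < T) {f g : ℝ → ℝ} (h : WD T f g) :
    ∀ᵐ t₁ ∂tIoo T, ∀ᵐ t₂ ∂tIoo T, |f t₂ - f t₁| ≤ ∫ t, |g t| ∂tIoo T := by
  obtain ⟨F, hF, h1, h2⟩ := h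
  have hm : ∀ᵐ t ∂tIoo T, t ∈ Set.Ioo 0 T := ae_restrict_mem measurableSet_Ioo
  have hintg : IntegrableOn (deriv F) (Set.Ioc 0 T) := by
    have := hF.intervalIntegrable_deriv
    rwa [intervalIntegrable_iff_integrableOn_Ioc_of_le hT.le] at this
  have e : ∫ t, |g t| ∂tIoo T = ∫ t in Set.Ioc 0 T, |deriv F t| := by
    rw [integral_Ioc_eq_integral_Ioo]
    refine integral_congr_ae ?_
    filter_upwards [h2] with t a
    rw [a]
  filter_upwards [h1, hm] with t₁ a₁ m₁
  filter_upwards [h1, hm] with t₂ a₂ m₂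
  rw [a₁, a₂, e]
  have hsub : Set.uIcc t₁ t₂ ⊆ Set.uIcc 0 T := by
    rw [Set.uIcc_of_le hT.le]
    exact Set.uIcc_subset_Icc (Set.Ioo_subset_Icc_self m₁) (Set.Ioo_subset_Icc_self m₂)
  have h3 : AbsolutelyContinuousOnInterval F t₁ t₂ := hF.mono hsub
  rw [← h3.integral_deriv_eq_sub, ← Real.norm_eq_abs]
  refine intervalIntegral.norm_integral_le_integral_norm_uIoc.trans ?_
  refine setIntegral_mono_set hintg.norm ?_ ?_
  · exact Eventually.of_forall fun t => norm_nonneg _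
  · refine LE.le.eventuallyLE ?_
    intro t ht
    rw [Set.mem_uIoc] at ht
    rcases ht with ht | ht
    · exact ⟨m₁.1.trans ht.1, ht.2.trans m₂.2.le⟩
    · exact ⟨m₂.1.trans ht.1, ht.2.trans m₁.2.le⟩

lemma compact_in_Ioo {T : ℝ} (hT : 0 < T) {K : Set ℝ} (hK : IsCompact K) (hs : K ⊆ Set.Ioo 0 T) :
    ∃ a b : ℝ, 0 < a ∧ b < T ∧ K ⊆ Set.Icc a b := by
  rcases K.eq_empty_or_nonempty with h | h
  · exact ⟨T, 0, hT, hT, by simp [h]⟩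
  obtain ⟨a, ha⟩ := hK.exists_isLeast h
  obtain ⟨b, hb⟩ := hK.exists_isGreatest h
  exact ⟨a, b, (hs ha.1).1, (hs hb.1).2, fun x hx => ⟨ha.2 hx, hb.2 hx⟩⟩

/-- scalar time test functions -/
def TT (T : ℝ) (χ : ℝ → ℝ) : Prop :=
  ContDiff ℝ (⊤ : ℕ∞) χ ∧ ∃ a b : ℝ, 0 < a ∧ b < T ∧ ∀ t, t ∉ Set.Icc a b → χ t = 0

lemma TT.bdd {T : ℝ} {χ : ℝ → ℝ} (h : TT T χ) : ∃ C, ∀ t, |χ t| ≤ C := by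
  obtain ⟨hs, a, b, ha, hb, h0⟩ := h
  obtain ⟨C, hC⟩ := (isCompact_Icc (a := a) (b := b)).exists_bound_of_continuousOn hs.continuous.continuousOn
  refine ⟨max C 0, fun t => ?_⟩
  by_cases ht : t ∈ Set.Icc a b
  · exact (hC t ht).trans (le_max_left _ _)
  · simp [h0 t ht]

lemma TT.deriv {T : ℝ} {χ : ℝ → ℝ} (h : TT T χ) : TT T (deriv χ) := by
  obtain ⟨hs, a, b, ha, hb, h0⟩ := h
  refine ⟨(contDiff_infty_iff_deriv.1 hs).2, a, b, ha, hb, fun t ht => ?_⟩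
  have : χ =ᶠ[𝓝 t] fun _ => 0 := by
    filter_upwards [isClosed_Icc.isOpen_compl.mem_nhds ht] with s hs using h0 s hs
  rw [this.deriv_eq]; simp

lemma prim_AC {T : ℝ} (hT : 0 < T) {g : ℝ → ℝ} (hg : Integrable g (tIoo T)) (c : ℝ) :
    AbsolutelyContinuousOnInterval (fun t => c + ∫ s in (0:ℝ)..t, g s) 0 T ∧
    ∀ᵐ t ∂tIoo T, g t = _root_.deriv (fun t => c + ∫ s in (0:ℝ)..t, g s) t := by
  have hi : IntervalIntegrable g volume 0 T := by
    rw [intervalIntegrable_iff_integrableOn_Ioo_of_le hT.le]; exact hg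
  constructor
  · have h1 := hi.absolutelyContinuousOnInterval_intervalIntegral (c := 0) (by simp)
    exact (contDiff_const.contDiffOn.absolutelyContinuousOnInterval).add h1
  · unfold tIoo
    rw [ae_restrict_iff' measurableSet_Ioo]
    filter_upwards [hi.ae_hasDerivAt_integral] with t ht hm
    have hm' : t ∈ Set.uIcc 0 T := by
      rw [Set.uIcc_of_le hT.le]; exact Set.Ioo_subset_Icc_self hm
    have := ht hm' 0 (by simp)
    rw [(this.const_add c).deriv]

lemma dBR {T : ℝ} (hT : 0 < T) {f g : ℝ → ℝ} (hf : Integrable f (tIoo T)) (hg : Integrable g (tIoo T))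
    (h : ∀ χ : ℝ → ℝ, TT T χ → ∫ t, (_root_.deriv χ t * f t + χ t * g t) ∂tIoo T = 0) :
    WD T f g := by
  have hbm : ∀ (χ : ℝ → ℝ) (k : ℝ → ℝ), TT T χ → Integrable k (tIoo T) →
      Integrable (fun t => χ t * k t) (tIoo T) := by
    intro χ k hχ hk
    obtain ⟨C, hC⟩ := hχ.bdd
    exact hk.bdd_mul hχ.1.continuous.aestronglyMeasurable (Eventually.of_forall hC)
  obtain ⟨hGac, hGd⟩ := prim_AC hT hg 0
  set G : ℝ → ℝ := fun t => 0 + ∫ s in (0:ℝ)..t, g s with hG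
  have hGi : Integrable G (tIoo T) := by
    have : IntegrableOn G (Set.Icc 0 T) := by
      refine ContinuousOn.integrableOn_Icc ?_
      have := hGac.continuousOn
      rwa [Set.uIcc_of_le hT.le] at this
    exact this.mono_set Set.Ioo_subset_Icc_self
  -- step 1
  have s1 : ∀ χ : ℝ → ℝ, TT T χ → ∫ t, _root_.deriv χ t * (f t - G t) ∂tIoo T = 0 := by
    intro χ hχ
    have hχac : AbsolutelyContinuousOnInterval χ 0 T :=
      ((hχ.1.of_le (by norm_cast)).contDiffOn).absolutelyContinuousOnInterval
    have ibp := hχac.integral_deriv_mul_eq_sub hGac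
    obtain ⟨-, a, b, ha, hb, h0⟩ := id hχ
    have e0 : χ 0 = 0 := h0 0 (fun hh => absurd hh.1 (not_le.2 ha))
    have eT : χ T = 0 := h0 T (fun hh => absurd hh.2 (not_le.2 hb))
    rw [e0, eT, zero_mul, zero_mul, sub_zero, intervalIntegral.integral_of_le hT.le,
      integral_Ioc_eq_integral_Ioo] at ibp
    have ibp2 : ∫ t, (_root_.deriv χ t * G t + χ t * g t) ∂tIoo T = 0 := by
      rw [← ibp]
      refine integral_congr_ae ?_
      filter_upwards [hGd] with t ht
      rw [ht]
    have := h χ hχ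
    have e : (fun t => _root_.deriv χ t * (f t - G t)) = fun t =>
      (_root_.deriv χ t * f t + χ t * g t) - (_root_.deriv χ t * G t + χ t * g t) := by
      ext t; ring
    have i1 : Integrable (fun t => _root_.deriv χ t * f t + χ t * g t) (tIoo T) :=
      (hbm _ _ hχ.deriv hf).add (hbm _ _ hχ hg)
    have i2 : Integrable (fun t => _root_.deriv χ t * G t + χ t * g t) (tIoo T) :=
      (hbm _ _ hχ.deriv hGi).add (hbm _ _ hχ hg)
    rw [e, integral_sub i1 i2, this, ibp2, sub_zero]
  -- step 2
  let bp : ContDiffBump (T / 2) := ⟨T / 8, T / 4, by positivity, by linarith⟩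
  set χ0 : ℝ → ℝ := bp.normed volume with hχ0
  have hχs_base : ContDiff ℝ (⊤ : ℕ∞) χ0 := bp.contDiff_normed
  have hχi_base : ∫ t, χ0 t = 1 := bp.integral_normed
  have hχt_base : tsupport χ0 ⊆ Set.Icc (T / 4) (3 * T / 4) := by
    rw [hχ0, bp.tsupport_normed_eq, Real.closedBall_eq_Icc]
    refine Set.Icc_subset_Icc ?_ ?_ <;> simp only [bp] <;> linarith
  have hTT0 : TT T χ0 := ⟨hχs_base, T / 4, 3 * T / 4, by positivity, by linarith, fun t ht =>
    image_eq_zero_of_notMem_tsupport fun hh => ht (hχt_base hh)⟩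
  set c := ∫ t, χ0 t * (f t - G t) ∂tIoo T with hc
  have hfG : Integrable (fun t => f t - G t) (tIoo T) := hf.sub hGi
  have key : ∀ᵐ t, t ∈ Set.Ioo 0 T → f t - G t - c = 0 := by
    refine isOpen_Ioo.ae_eq_zero_of_integral_contDiff_smul_eq_zero ?_ ?_
    · refine IntegrableOn.locallyIntegrableOn ?_
      exact hfG.sub (integrable_const c)
    intro φ hφ hφc hφs
    obtain ⟨a, b, ha, hb, hab⟩ := compact_in_Ioo hT hφc hφs
    have hφ0 : ∀ t, t ∉ Set.Icc a b → φ t = 0 := fun t ht =>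
      image_eq_zero_of_notMem_tsupport fun hh => ht (hab hh)
    have hTφ : TT T φ := ⟨hφ, a, b, ha, hb, hφ0⟩
    set m := ∫ t, φ t with hm
    set q : ℝ → ℝ := fun t => φ t - m * χ0 t with hq
    have hqs : ContDiff ℝ (⊤ : ℕ∞) q := hφ.sub (contDiff_const.mul hχs_base)
    have hqi : ∫ t, q t = 0 := by
      rw [hq, integral_sub (hφ.continuous.integrable_of_hasCompactSupport hφc)
        (bp.integrable_normed.const_mul m), integral_const_mul, hχi_base, ← hm]
      ring
    set a' := min a (T / 4)
    set b' := max b (3 * T / 4)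
    have ha' : 0 < a' := lt_min ha (by positivity)
    have hb' : b' < T := max_lt hb (by linarith)
    have hq0 : ∀ t, t ∉ Set.Icc a' b' → q t = 0 := by
      intro t ht
      have h1 : t ∉ Set.Icc a b := fun hh => ht ⟨(min_le_left _ _).trans hh.1, hh.2.trans (le_max_left _ _)⟩
      have h2 : t ∉ Set.Icc (T / 4) (3 * T / 4) := fun hh =>
        ht ⟨(min_le_right _ _).trans hh.1, hh.2.trans (le_max_right _ _)⟩
      have h3 : χ0 t = 0 := image_eq_zero_of_notMem_tsupport fun hh => h2 (hχt_base hh)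
      simp only [hq, hφ0 t h1, h3]; ring
    set χ : ℝ → ℝ := fun t => ∫ s in (0:ℝ)..t, q s with hχ
    have hd : ∀ t, HasDerivAt χ (q t) t := fun t =>
      intervalIntegral.integral_hasDerivAt_right (hqs.continuous.intervalIntegrable _ _)
        hqs.continuous.aestronglyMeasurable.stronglyMeasurableAtFilter hqs.continuous.continuousAt
    have hdq : _root_.deriv χ = q := funext fun t => (hd t).deriv
    have hTχ : TT T χ := by
      refine ⟨contDiff_infty_iff_deriv.2 ⟨fun t => (hd t).differentiableAt, by rw [hdq]; exact hqs⟩,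
        a', b', ha', hb', ?_⟩
      intro t ht
      rcases lt_or_ge t a' with h1 | h1
      · simp only [hχ]
        rw [intervalIntegral.integral_congr (g := fun _ => 0)]
        · simp
        · intro s hs
          refine hq0 s fun hh => ?_
          have h2 : s ≤ max 0 t := hs.2
          have : max 0 t < a' := max_lt ha' h1
          linarith [hh.1]
      · have h2 : b' < t := by
          by_contra h2
          exact ht ⟨h1, not_lt.1 h2⟩
        simp only [hχ]
        rw [intervalIntegral.integral_eq_integral_of_support_subset, hqi]
        intro s hs
        by_contra hh
        refine hs (hq0 s fun hhh => hh ⟨ha'.trans_le hhh.1, hhh.2.trans h2.le⟩)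
    have h3 := s1 χ hTχ
    rw [hdq] at h3
    have e1 : ∫ t, φ t • (f t - G t - c) = ∫ t, φ t * (f t - G t - c) ∂tIoo T := by
      unfold tIoo
      rw [setIntegral_eq_integral_of_forall_compl_eq_zero]
      · rfl
      · intro t ht
        rw [hφ0 t fun hh => ht ⟨ha.trans_le hh.1, hh.2.trans_lt hb⟩, zero_mul]
    have e2 : ∫ t, φ t ∂tIoo T = m := by
      unfold tIoo
      rw [setIntegral_eq_integral_of_forall_compl_eq_zero]
      intro t ht
      rw [hφ0 t fun hh => ht ⟨ha.trans_le hh.1, hh.2.trans_lt hb⟩]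
    have e3 : ∫ t, q t * (f t - G t) ∂tIoo T =
        ∫ t, φ t * (f t - G t) ∂tIoo T - m * c := by
      rw [hc, ← integral_const_mul, ← integral_sub (hbm _ _ hTφ hfG) ((hbm _ _ hTT0 hfG).const_mul m)]
      refine integral_congr_ae (Eventually.of_forall fun t => ?_)
      simp only [hq]; ring
    have e4 : ∫ t, φ t * (f t - G t - c) ∂tIoo T =
        ∫ t, φ t * (f t - G t) ∂tIoo T - m * c := by
      rw [← e2, ← integral_mul_const, ← integral_sub (hbm _ _ hTφ hfG)]
      · refine integral_congr_ae (Eventually.of_forall fun t => ?_)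
        simp only; ring
      · have : Integrable (fun _ : ℝ => c) (tIoo T) := integrable_const c
        exact hbm _ _ hTφ this
    rw [e1, e4, ← e3, h3]
  obtain ⟨h1, h2⟩ := prim_AC hT hg c
  refine ⟨_, h1, ?_, h2⟩
  unfold tIoo
  rw [ae_restrict_iff' measurableSet_Ioo]
  filter_upwards [key] with t ht hm
  have := ht hm
  simp only [hG] at this
  linarith

/-- complex version -/
def CWD (T : ℝ) (f g : ℝ → ℂ) : Prop :=
  WD T (fun t => (f t).re) (fun t => (g t).re) ∧ WD T (fun t => (f t).im) (fun t => (g t).im)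

lemma CWD.congr {T : ℝ} {f g f' g' : ℝ → ℂ} (h : CWD T f g) (hf : ∀ᵐ t ∂tIoo T, f' t = f t)
    (hg : ∀ᵐ t ∂tIoo T, g' t = g t) : CWD T f' g' :=
  ⟨h.1.congr (by filter_upwards [hf] with t a using by rw [a])
    (by filter_upwards [hg] with t a using by rw [a]),
   h.2.congr (by filter_upwards [hf] with t a using by rw [a])
    (by filter_upwards [hg] with t a using by rw [a])⟩

lemma CWD.add {T : ℝ} (hT : 0 < T) {f g f' g' : ℝ → ℂ} (h : CWD T f g) (h' : CWD T f' g') :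
    CWD T (fun t => f t + f' t) (fun t => g t + g' t) := by
  simpa [CWD] using ⟨h.1.add hT h'.1, h.2.add hT h'.2⟩

lemma CWD.const (T : ℝ) (c : ℂ) : CWD T (fun _ => c) (fun _ => 0) :=
  ⟨WD.const T c.re, WD.const T c.im⟩

lemma CWD.mul {T : ℝ} (hT : 0 < T) {f g f' g' : ℝ → ℂ} (h : CWD T f g) (h' : CWD T f' g') :
    CWD T (fun t => f t * f' t) (fun t => g t * f' t + f t * g' t) := by
  have hm1 := WD.const T (-1)
  constructor
  · refine ((h.1.mul hT h'.1).add hT (hm1.mul hT (h.2.mul hT h'.2))).congr ?_ ?_ <;>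
    · refine Eventually.of_forall fun t => ?_
      simp; try ring
  · refine ((h.1.mul hT h'.2).add hT (h.2.mul hT h'.1)).congr ?_ ?_ <;>
    · refine Eventually.of_forall fun t => ?_
      simp; try ring

lemma CWD.conj {T : ℝ} (hT : 0 < T) {f g : ℝ → ℂ} (h : CWD T f g) :
    CWD T (fun t => (starRingEnd ℂ) (f t)) (fun t => (starRingEnd ℂ) (g t)) := by
  have hm1 := WD.const T (-1)
  constructor
  · simpa using h.1
  · refine (hm1.mul hT h.2).congr ?_ ?_ <;>
    · refine Eventually.of_forall fun t => ?_
      simp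

lemma CWD.sum {T : ℝ} (hT : 0 < T) {ι : Type*} (s : Finset ι) {f g : ι → ℝ → ℂ}
    (h : ∀ i ∈ s, CWD T (f i) (g i)) :
    CWD T (fun t => ∑ i ∈ s, f i t) (fun t => ∑ i ∈ s, g i t) := by
  classical
  induction s using Finset.induction_on with
  | empty => simpa using CWD.const T 0
  | insert i s hi ih =>
    have h1 := (h i (Finset.mem_insert_self _ _)).add hT
      (ih fun j hj => h j (Finset.mem_insert_of_mem hj))
    refine h1.congr ?_ ?_ <;>
    · refine Eventually.of_forall fun t => ?_
      rw [Finset.sum_insert hi]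

lemma CWD.bound {T : ℝ} (hT : 0 < T) {f g : ℝ → ℂ} (h : CWD T f g) (k : ℝ → ℝ)
    (hk : Integrable k (tIoo T)) (hgk : ∀ᵐ t ∂tIoo T, ‖g t‖ ≤ k t) :
    ∀ᵐ t₁ ∂tIoo T, ∀ᵐ t₂ ∂tIoo T, ‖f t₂ - f t₁‖ ≤ 2 * ∫ t, k t ∂tIoo T := by
  have aux : ∀ p : ℂ → ℝ, (∀ z, |p z| ≤ ‖z‖) → ∫ t, |p (g t)| ∂tIoo T ≤ ∫ t, k t ∂tIoo T := by
    intro p hp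
    refine integral_mono_of_nonneg (Eventually.of_forall fun t => abs_nonneg _) hk ?_
    filter_upwards [hgk] with t ht using (hp _).trans ht
  filter_upwards [h.1.bound hT, h.2.bound hT] with t₁ a₁ b₁
  filter_upwards [a₁, b₁] with t₂ a₂ b₂
  refine (Complex.norm_le_abs_re_add_abs_im _).trans ?_
  have h1 := a₂.trans (aux re abs_re_le_norm)
  have h2 := b₂.trans (aux im abs_im_le_norm)
  rw [Complex.sub_re, Complex.sub_im]
  linarith


/-! ### From the weak formulation to Fourier ODEs -/

def tau (n : Lat) (z : ℂ) (x : Vec) : ℝ := (z * chr n x).re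

lemma tau_smooth (n : Lat) (z : ℂ) : ContDiff ℝ (⊤ : ℕ∞) (tau n z) := by
  unfold tau
  have h : ContDiff ℝ (⊤ : ℕ∞) (chr n) := by
    unfold chr
    refine ContDiff.cexp ?_
    refine ContDiff.mul contDiff_const ?_
    refine ContDiff.sum fun i _ => ?_
    refine ContDiff.mul contDiff_const ?_
    have h2 : ContDiff ℝ (⊤ : ℕ∞) fun x : Vec => x i := by fun_prop
    exact Complex.ofRealCLM.contDiff.comp h2
  exact Complex.reCLM.contDiff.comp (contDiff_const.mul h)

lemma chr_latv (n m : Lat) : chr n (latv m) = 1 := by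
  unfold chr latv
  rw [Complex.exp_eq_one_iff]
  refine ⟨∑ i, n i * m i, ?_⟩
  simp only [WithLp.equiv_symm_apply]
  push_cast
  ring

lemma tau_per (n : Lat) (z : ℂ) : Per (tau n z) := by
  intro x m
  unfold tau
  rw [chr_add_vec, chr_latv, mul_one]

lemma hasFDerivAt_chr (n : Lat) (x : Vec) : HasFDerivAt (𝕜 := ℝ) (chr n)
    (chr n x • ((2 * Real.pi * Complex.I) • ∑ i, (n i : ℂ) •
      (Complex.ofRealCLM ∘L (EuclideanSpace.proj i : Vec →L[ℝ] ℝ)))) x := by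
  unfold chr
  refine HasFDerivAt.cexp ?_
  refine HasFDerivAt.const_mul ?_ _
  refine HasFDerivAt.fun_sum fun i _ => ?_
  refine HasFDerivAt.const_mul ?_ _
  exact (Complex.ofRealCLM ∘L (EuclideanSpace.proj i : Vec →L[ℝ] ℝ)).hasFDerivAt

lemma pd_tau (n : Lat) (z : ℂ) (c : ℝ) (i : Fin 3) (x : Vec) :
    pd i (fun y => c * tau n z y) x = c * tau n (z * (2 * Real.pi * Complex.I * (n i : ℂ))) x := by
  unfold pd
  have h1 : HasFDerivAt (fun y => c * tau n z y) _ x :=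
    ((Complex.reCLM.hasFDerivAt).comp x ((hasFDerivAt_chr n x).const_mul z)).const_mul c
  rw [h1.fderiv]
  have : ∀ k : Fin 3, (EuclideanSpace.single i (1:ℝ) : Vec) k = if k = i then 1 else 0 := by
    intro k; simp
  simp only [_root_.smul_apply, ContinuousLinearMap.comp_apply, Complex.reCLM_apply,
    _root_.sum_apply, PiLp.proj_apply, Complex.ofRealCLM_apply, this, tau,
    smul_eq_mul]
  congr 2
  simp only [apply_ite, Complex.ofReal_one, Complex.ofReal_zero, mul_ite, mul_one, mul_zero,
    Finset.sum_ite_eq', Finset.mem_univ, if_true, Finset.sum_ite_eq]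
  ring

lemma int_tau (f : Vec → ℝ) (hf : Integrable f μT) (z : ℂ) (n : Lat) :
    ∫ x, f x * tau n z x ∂μT = (z * (starRingEnd ℂ) (fc (fun x => (f x : ℂ)) n)).re := by
  rw [fc_eq, ← integral_conj, ← integral_const_mul]
  have hi : Integrable (fun x => z * (starRingEnd ℂ) ((f x : ℂ) * chr (-n) x)) μT := by
    refine Integrable.const_mul ?_ z
    refine Integrable.mono hf.norm ?_ (Eventually.of_forall fun x => ?_)
    · refine Complex.continuous_conj.comp_aestronglyMeasurable ?_
      exact (Complex.continuous_ofReal.comp_aestronglyMeasurable hf.1).mul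
        (measurable_chr _).aestronglyMeasurable
    · simp [norm_chr]
  have := integral_re hi
  simp only [RCLike.re_eq_complex_re] at this
  rw [← this]
  refine integral_congr_ae (Eventually.of_forall fun x => ?_)
  simp only [tau, map_mul, Complex.conj_ofReal, chr_neg, Complex.conj_conj]
  rw [mul_left_comm, Complex.re_ofReal_mul]

lemma integrable_tau (f : Vec → ℝ) (hf : Integrable f μT) (z : ℂ) (n : Lat) :
    Integrable (fun x => f x * tau n z x) μT := by
  refine Integrable.mul_bdd (c := ‖z‖) hf (tau_smooth n z).continuous.aestronglyMeasurable
    (Eventually.of_forall fun x => ?_)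
  unfold tau
  refine (Complex.abs_re_le_norm _).trans ?_
  rw [norm_mul, norm_chr, mul_one]

def fcP (u B : Vec → Vec) (i j : Fin 3) (n : Lat) : ℂ := fc (fun x => uC u i x * uC B j x) n

lemma fcP_symm (u B : Vec → Vec) (i j : Fin 3) (n : Lat) : fcP B u i j n = fcP u B j i n := by
  unfold fcP
  simp only [mul_comm]

lemma fcP_eq (u B : Vec → Vec) (i j : Fin 3) (n : Lat) :
    fcP u B i j n = fc (fun x => ((u x i * B x j : ℝ) : ℂ)) n := by
  unfold fcP uC
  push_cast
  rfl

lemma integrable_comp (B : Vec → Vec) (hB : MemLp B 2 μT) (j : Fin 3) :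
    Integrable (fun x => B x j) μT := by
  have := ((memLp_comp B hB j).integrable (by norm_num)).re
  exact this

lemma integrable_prod' (u B : Vec → Vec) (hu : MemLp u 2 μT) (hB : MemLp B 2 μT) (i j : Fin 3) :
    Integrable (fun x => u x i * B x j) μT := by
  have h1 : MemLp (fun x => u x i) 2 μT := by
    have := (memLp_comp u hu i).re
    exact this
  have h2 : MemLp (fun x => B x j) 2 μT := by
    have := (memLp_comp B hB j).re
    exact this
  exact h1.integrable_mul h2

lemma norm_fc_le (f : Vec → ℂ) (n : Lat) (hf : MemLp f 1 μT) : ‖fc f n‖ ≤ (eLpNorm f 1 μT).toReal := by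
  rw [fc_eq]
  refine (norm_integral_le_integral_norm _).trans ?_
  simp only [norm_mul, norm_chr, mul_one]
  rw [eLpNorm_one_eq_lintegral_enorm, integral_norm_eq_lintegral_enorm hf.1]

lemma norm_fcP_le (u B : Vec → Vec) (hu : MemLp u 2 μT) (hB : MemLp B 2 μT) (i j : Fin 3) (n : Lat) :
    ‖fcP u B i j n‖ ≤ (eLpNorm u 2 μT).toReal * (eLpNorm B 2 μT).toReal := by
  have h1 := memLp_comp u hu i
  have h2 := memLp_comp B hB j
  have hm : eLpNorm (fun x => uC u i x * uC B j x) 1 μT ≤ eLpNorm u 2 μT * eLpNorm B 2 μT :=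
    (mulLp 2 2 1 _ _ h1.1 h2.1).trans (mul_le_mul' (eLpNorm_comp_le u i) (eLpNorm_comp_le B j))
  have hfin : eLpNorm u 2 μT * eLpNorm B 2 μT ≠ ∞ := ENNReal.mul_ne_top hu.2.ne hB.2.ne
  rw [← ENNReal.toReal_mul]
  refine (norm_fc_le _ _ ⟨h1.1.mul h2.1, hm.trans_lt hfin.lt_top⟩).trans ?_
  exact ENNReal.toReal_mono hfin hm

lemma norm_fcV_le (B : Vec → Vec) (hB : MemLp B 2 μT) (j : Fin 3) (n : Lat) :
    ‖fcV B j n‖ ≤ (eLpNorm B 2 μT).toReal := by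
  have h2 := memLp_comp B hB j
  have hm : eLpNorm (uC B j) 1 μT ≤ eLpNorm B 2 μT :=
    (eLpNorm_le_eLpNorm_of_exponent_le (by norm_num) h2.1).trans (eLpNorm_comp_le B j)
  refine (norm_fc_le _ _ (h2.mono_exponent (by norm_num))).trans ?_
  exact ENNReal.toReal_mono hB.2.ne hm

lemma measurable_fc (F : ℝ → Vec → ℂ) (hF : Measurable (Function.uncurry F)) (n : Lat) :
    Measurable fun t => fc (F t) n := by
  simp only [fc_eq]
  have : StronglyMeasurable (Function.uncurry fun t x => F t x * chr (-n) x) :=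
    (hF.mul ((measurable_chr (-n)).comp measurable_snd)).stronglyMeasurable
  exact this.integral_prod_right.measurable

lemma measurable_uC (u : ℝ → Vec → Vec) (hu : Measurable (Function.uncurry u)) (i : Fin 3) :
    Measurable (Function.uncurry fun t => uC (u t) i) := by
  have : Continuous fun v : Vec => ((v i : ℝ) : ℂ) := by fun_prop
  exact this.measurable.comp hu

lemma measurable_fcV (B : ℝ → Vec → Vec) (hB : Measurable (Function.uncurry B)) (j : Fin 3) (n : Lat) :
    Measurable fun t => fcV (B t) j n :=
  measurable_fc (fun t => uC (B t) j) (measurable_uC B hB j) n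

lemma measurable_fcP (u B : ℝ → Vec → Vec) (hu : Measurable (Function.uncurry u))
    (hB : Measurable (Function.uncurry B)) (i j : Fin 3) (n : Lat) :
    Measurable fun t => fcP (u t) (B t) i j n :=
  measurable_fc (fun t x => uC (u t) i x * uC (B t) j x)
    ((measurable_uC u hu i).mul (measurable_uC B hB j)) n

lemma ae_memLp (T : ℝ) (B : ℝ → Vec → Vec) (hB : Measurable (Function.uncurry B))
    (hB2 : timeNorm ∞ T (fun t => eLpNorm (B t) 2 μT) < ∞) :
    ∃ M : ℝ, 0 ≤ M ∧ ∀ᵐ t ∂tIoo T, MemLp (B t) 2 μT ∧ (eLpNorm (B t) 2 μT).toReal ≤ M := by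
  unfold timeNorm at hB2
  rw [if_pos rfl] at hB2
  refine ⟨(essSup (fun t => eLpNorm (B t) 2 μT) (tIoo T)).toReal, ENNReal.toReal_nonneg, ?_⟩
  filter_upwards [ENNReal.ae_le_essSup (μ := tIoo T) (fun t => eLpNorm (B t) 2 μT)] with t ht
  refine ⟨⟨(hB.comp (measurable_prodMk_left (x := t))).aestronglyMeasurable, ht.trans_lt hB2⟩,
    ENNReal.toReal_mono hB2.ne ht⟩


def tfR {T : ℝ} {χ : ℝ → ℝ} (hχ : TT T χ) (n : Lat) (z : ℂ) : TestFun T ℝ where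
  f := fun t x => χ t * tau n z x
  smooth := by
    have h1 : ContDiff ℝ (⊤ : ℕ∞) fun p : ℝ × Vec => χ p.1 := hχ.1.comp contDiff_fst
    have h2 : ContDiff ℝ (⊤ : ℕ∞) fun p : ℝ × Vec => tau n z p.2 := (tau_smooth n z).comp contDiff_snd
    exact h1.mul h2
  periodic := by
    intro t x m
    simp only [tau_per n z x m]
  compactIn := by
    obtain ⟨a, b, ha, hb, h⟩ := hχ.2
    refine ⟨a, b, ha, hb, fun t ht => ?_⟩
    ext x
    simp [h t ht]

def tfV {T : ℝ} {χ : ℝ → ℝ} (hχ : TT T χ) (n : Lat) (z : ℂ) (w : Vec) : TestFun T Vec where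
  f := fun t x => χ t • (tau n z x • w)
  smooth := by
    have h1 : ContDiff ℝ (⊤ : ℕ∞) fun p : ℝ × Vec => χ p.1 := hχ.1.comp contDiff_fst
    have h2 : ContDiff ℝ (⊤ : ℕ∞) fun p : ℝ × Vec => tau n z p.2 := (tau_smooth n z).comp contDiff_snd
    exact h1.smul (h2.smul contDiff_const)
  periodic := by
    intro t x m
    simp only [tau_per n z x m]
  compactIn := by
    obtain ⟨a, b, ha, hb, h⟩ := hχ.2
    refine ⟨a, b, ha, hb, fun t ht => ?_⟩
    ext x
    simp [h t ht]

lemma ae_zero_of_TT {T : ℝ} (k : ℝ → ℝ) (hT : 0 < T) (hk : Integrable k (tIoo T))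
    (h : ∀ χ : ℝ → ℝ, TT T χ → ∫ t, χ t * k t ∂tIoo T = 0) : ∀ᵐ t ∂tIoo T, k t = 0 := by
  unfold tIoo
  rw [ae_restrict_iff' measurableSet_Ioo]
  refine isOpen_Ioo.ae_eq_zero_of_integral_contDiff_smul_eq_zero ?_ ?_
  · exact IntegrableOn.locallyIntegrableOn hk
  intro φ hφ hφc hφs
  obtain ⟨a, b, ha, hb, hab⟩ := compact_in_Ioo hT hφc hφs
  have hφ0 : ∀ t, t ∉ Set.Icc a b → φ t = 0 := fun t ht =>
    image_eq_zero_of_notMem_tsupport fun hh => ht (hab hh)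
  have := h φ ⟨hφ, a, b, ha, hb, hφ0⟩
  rw [← this]
  unfold tIoo
  rw [setIntegral_eq_integral_of_forall_compl_eq_zero]
  · rfl
  · intro t ht
    rw [hφ0 t fun hh => ht ⟨ha.trans_le hh.1, hh.2.trans_lt hb⟩, zero_mul]

lemma divfree_fourier (T : ℝ) (hT : 0 < T) (B : ℝ → Vec → Vec) (hmB : Measurable (Function.uncurry B))
    (hB2 : timeNorm ∞ T (fun t => eLpNorm (B t) 2 μT) < ∞) (hdiv : WeakDivFree T B) :
    ∀ᵐ t ∂tIoo T, ∀ n : Lat, ∑ j, (n j : ℂ) * fcV (B t) j n = 0 := by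
  obtain ⟨M, hM, hae⟩ := ae_memLp T B hmB hB2
  rw [ae_all_iff]
  intro n
  have key : ∀ z : ℂ, ∀ᵐ t ∂tIoo T,
      ∑ i, (z * (2 * Real.pi * Complex.I * (n i : ℂ)) * (starRingEnd ℂ) (fcV (B t) i n)).re = 0 := by
    intro z
    refine ae_zero_of_TT _ hT ?_ ?_
    · refine integrable_finsetSum _ fun i _ => ?_
      refine Integrable.of_bound (C := ‖z * (2 * Real.pi * Complex.I * (n i : ℂ))‖ * M) ?_ ?_
      · refine Measurable.aestronglyMeasurable ?_
        exact Complex.measurable_re.comp (measurable_const.mul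
          (Complex.continuous_conj.measurable.comp (measurable_fcV B hmB i n)))
      · filter_upwards [hae] with t ht
        refine (Complex.abs_re_le_norm _).trans ?_
        rw [norm_mul _ ((starRingEnd ℂ) _), RCLike.norm_conj]
        exact mul_le_mul_of_nonneg_left ((norm_fcV_le _ ht.1 i n).trans ht.2) (norm_nonneg _)
    · intro χ hχ
      rw [← hdiv (tfR hχ n z)]
      refine integral_congr_ae ?_
      filter_upwards [hae] with t ht
      have e : (fun x => ∑ i, B t x i * pd i ((tfR hχ n z).f t) x) = fun x =>
          ∑ i, χ t * (B t x i * tau n (z * (2 * Real.pi * Complex.I * (n i : ℂ))) x) := by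
        ext x
        refine Finset.sum_congr rfl fun i _ => ?_
        have := pd_tau n z (χ t) i x
        change B t x i * pd i (fun y => χ t * tau n z y) x = _
        rw [this]; ring
      change _ = ∫ x, ∑ i, B t x i * pd i ((tfR hχ n z).f t) x ∂μT
      rw [e, integral_finsetSum _ fun i _ =>
        (integrable_tau _ (integrable_comp (B t) ht.1 i) _ n).const_mul (χ t), Finset.mul_sum]
      refine Finset.sum_congr rfl fun i _ => ?_
      rw [integral_const_mul, int_tau _ (integrable_comp (B t) ht.1 i)]
      rfl
  filter_upwards [key 1, key Complex.I] with t h1 h2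
  have e : ∀ z : ℂ, ∑ i, (z * (2 * Real.pi * Complex.I * (n i : ℂ)) * (starRingEnd ℂ) (fcV (B t) i n)).re =
      2 * Real.pi * (z * Complex.I * (starRingEnd ℂ) (∑ j, (n j : ℂ) * fcV (B t) j n)).re := by
    intro z
    rw [← Complex.re_sum, ← Complex.re_ofReal_mul]
    congr 1
    rw [map_sum, Finset.mul_sum, Finset.mul_sum]
    refine Finset.sum_congr rfl fun i _ => ?_
    simp only [map_mul, map_intCast]
    push_cast
    ring
  rw [e] at h1 h2
  have hp : (2 * Real.pi : ℝ) ≠ 0 := by positivity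
  have h1' := (mul_eq_zero.1 h1).resolve_left hp
  have h2' := (mul_eq_zero.1 h2).resolve_left hp
  set S := ∑ j, (n j : ℂ) * fcV (B t) j n
  apply Complex.ext
  · simpa using h2'
  · simpa using h1'

lemma induction_fourier (T : ℝ) (hT : 0 < T) (u B : ℝ → Vec → Vec)
    (hmu : Measurable (Function.uncurry u)) (hmB : Measurable (Function.uncurry B))
    (hu2 : timeNorm ∞ T (fun t => eLpNorm (u t) 2 μT) < ∞)
    (hB2 : timeNorm ∞ T (fun t => eLpNorm (B t) 2 μT) < ∞) (hsol : MHDWeakDF T u B)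
    (n : Lat) (w : Vec) (hw : ∑ i, w i * (n i : ℝ) = 0) :
    CWD T (fun t => ∑ j, (w j : ℂ) * fcV (B t) j n)
      (fun t => ∑ i, ∑ j, (w j : ℂ) * (-(2 * Real.pi * Complex.I * (n i : ℂ))) *
        (fcP (u t) (B t) i j n - fcP (u t) (B t) j i n)) := by
  obtain ⟨M, hM, hae⟩ := ae_memLp T B hmB hB2
  obtain ⟨M', hM', hae'⟩ := ae_memLp T u hmu hu2
  have key : ∀ z : ℂ, WD T (fun t => ∑ j, w j * (z * (starRingEnd ℂ) (fcV (B t) j n)).re)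
      (fun t => ∑ i, ∑ j, w j * (z * (2 * Real.pi * Complex.I * (n i : ℂ)) *
        (starRingEnd ℂ) (fcP (u t) (B t) i j n - fcP (u t) (B t) j i n)).re) := by
    intro z
    refine dBR hT ?_ ?_ ?_
    · refine integrable_finsetSum _ fun j _ => Integrable.const_mul ?_ _
      refine Integrable.of_bound (C := ‖z‖ * M) ?_ ?_
      · refine Measurable.aestronglyMeasurable ?_
        exact Complex.measurable_re.comp (measurable_const.mul
          (Complex.continuous_conj.measurable.comp (measurable_fcV B hmB j n)))
      · filter_upwards [hae] with t ht
        refine (Complex.abs_re_le_norm _).trans ?_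
        rw [norm_mul _ ((starRingEnd ℂ) _), RCLike.norm_conj]
        exact mul_le_mul_of_nonneg_left ((norm_fcV_le _ ht.1 j n).trans ht.2) (norm_nonneg _)
    · refine integrable_finsetSum _ fun i _ => integrable_finsetSum _ fun j _ => Integrable.const_mul ?_ _
      refine Integrable.of_bound (C := ‖z * (2 * Real.pi * Complex.I * (n i : ℂ))‖ * (M' * M + M' * M)) ?_ ?_
      · refine Measurable.aestronglyMeasurable ?_
        exact Complex.measurable_re.comp (measurable_const.mul
          (Complex.continuous_conj.measurable.comp
            ((measurable_fcP u B hmu hmB i j n).sub (measurable_fcP u B hmu hmB j i n))))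
      · filter_upwards [hae, hae'] with t ht ht'
        refine (Complex.abs_re_le_norm _).trans ?_
        rw [norm_mul _ ((starRingEnd ℂ) _), RCLike.norm_conj]
        refine mul_le_mul_of_nonneg_left ((norm_sub_le _ _).trans ?_) (norm_nonneg _)
        have hh : (eLpNorm (u t) 2 μT).toReal * (eLpNorm (B t) 2 μT).toReal ≤ M' * M :=
          mul_le_mul ht'.2 ht.2 ENNReal.toReal_nonneg hM'
        exact add_le_add ((norm_fcP_le _ _ ht'.1 ht.1 i j n).trans hh)
          ((norm_fcP_le _ _ ht'.1 ht.1 j i n).trans hh)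
    · intro χ hχ
      have hdf : DivFreeT (tfV hχ n z w) := by
        intro t x
        have e : ∀ i, pd i (fun y => (tfV hχ n z w).f t y i) x =
            χ t * (w i * tau n (z * (2 * Real.pi * Complex.I * (n i : ℂ))) x) := by
          intro i
          have := pd_tau n z (χ t * w i) i x
          rw [mul_assoc] at this
          rw [← this]
          congr 1
          ext y
          simp only [tfV, PiLp.smul_apply, smul_eq_mul]; ring
        simp only [e, ← Finset.mul_sum]
        have : ∑ i, w i * tau n (z * (2 * Real.pi * Complex.I * (n i : ℂ))) x =
            ((∑ i, w i * (n i : ℝ) : ℝ) * (z * (2 * Real.pi * Complex.I) * chr n x)).re := by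
          unfold tau
          push_cast
          rw [Finset.sum_mul, Complex.re_sum]
          refine Finset.sum_congr rfl fun i _ => ?_
          rw [← Complex.re_ofReal_mul]
          congr 1; ring
        rw [this, hw]; simp
      rw [← hsol.2.1 (tfV hχ n z w) hdf]
      refine integral_congr_ae ?_
      filter_upwards [hae, hae'] with t ht ht'
      have e : (fun x => dotV (B t x) (tderiv (tfV hχ n z w).f t x) + advPair (u t) (B t) ((tfV hχ n z w).f t) x
          - advPair (B t) (u t) ((tfV hχ n z w).f t) x) = fun x =>
          (∑ j, (deriv χ t * w j) * (B t x j * tau n z x)) +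
            ∑ i, ∑ j, (χ t * w j) * ((u t x i * B t x j - u t x j * B t x i) *
              tau n (z * (2 * Real.pi * Complex.I * (n i : ℂ))) x) := by
        ext x
        have e1 : tderiv (tfV hχ n z w).f t x = deriv χ t • (tau n z x • w) := by
          unfold tderiv tfV
          have hd : HasDerivAt χ (deriv χ t) t :=
            ((hχ.1.differentiable (by norm_num)) t).hasDerivAt
          exact (hd.smul_const (tau n z x • w)).deriv
        have e2 : ∀ i j, pd i (fun y => (tfV hχ n z w).f t y j) x =
            χ t * w j * tau n (z * (2 * Real.pi * Complex.I * (n i : ℂ))) x := by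
          intro i j
          rw [← pd_tau n z (χ t * w j) i x]
          congr 1
          ext y
          simp only [tfV, PiLp.smul_apply, smul_eq_mul]; ring
        unfold dotV advPair
        simp only [e1, e2, PiLp.smul_apply, smul_eq_mul]
        rw [add_sub_assoc, ← Finset.sum_sub_distrib]
        congr 1
        · refine Finset.sum_congr rfl fun j _ => ?_
          ring
        · refine Finset.sum_congr rfl fun i _ => ?_
          rw [← Finset.sum_sub_distrib]
          refine Finset.sum_congr rfl fun j _ => ?_
          ring
      have i1 : ∀ j, Integrable (fun x => (deriv χ t * w j) * (B t x j * tau n z x)) μT := fun j =>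
        (integrable_tau _ (integrable_comp (B t) ht.1 j) _ n).const_mul _
      have hij : ∀ i j, Integrable (fun x => u t x i * B t x j - u t x j * B t x i) μT := fun i j =>
        (integrable_prod' (u t) (B t) ht'.1 ht.1 i j).sub (integrable_prod' (u t) (B t) ht'.1 ht.1 j i)
      have i2 : ∀ i j, Integrable (fun x => (χ t * w j) * ((u t x i * B t x j - u t x j * B t x i) *
              tau n (z * (2 * Real.pi * Complex.I * (n i : ℂ))) x)) μT := fun i j =>
        (integrable_tau _ (hij i j) _ n).const_mul _
      change _ = ∫ x, (dotV (B t x) (tderiv (tfV hχ n z w).f t x) + advPair (u t) (B t) ((tfV hχ n z w).f t) x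
          - advPair (B t) (u t) ((tfV hχ n z w).f t) x) ∂μT
      rw [e, integral_add (integrable_finsetSum _ fun j _ => i1 j)
        (integrable_finsetSum _ fun i _ => integrable_finsetSum _ fun j _ => i2 i j),
        integral_finsetSum _ fun j _ => i1 j,
        integral_finsetSum _ fun i _ => integrable_finsetSum _ fun j _ => i2 i j,
        Finset.mul_sum, Finset.mul_sum]
      congr 1
      · refine Finset.sum_congr rfl fun j _ => ?_
        rw [integral_const_mul, int_tau _ (integrable_comp (B t) ht.1 j), mul_assoc]
        rfl
      · refine Finset.sum_congr rfl fun i _ => ?_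
        rw [integral_finsetSum _ fun j _ => i2 i j, Finset.mul_sum]
        refine Finset.sum_congr rfl fun j _ => ?_
        rw [integral_const_mul, int_tau _ (hij i j), mul_assoc (χ t)]
        congr 5
        rw [fcP_eq, fcP_eq, fc_eq, fc_eq, fc_eq, ← integral_sub]
        · refine integral_congr_ae (Eventually.of_forall fun x => ?_)
          push_cast; ring
        · refine Integrable.mul_bdd (c := 1) (integrable_prod' (u t) (B t) ht'.1 ht.1 i j).ofReal
            (measurable_chr _).aestronglyMeasurable (Eventually.of_forall fun x => (norm_chr _ _).le)
        · refine Integrable.mul_bdd (c := 1) (integrable_prod' (u t) (B t) ht'.1 ht.1 j i).ofReal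
            (measurable_chr _).aestronglyMeasurable (Eventually.of_forall fun x => (norm_chr _ _).le)
  constructor
  · refine (key 1).congr (Eventually.of_forall fun t => ?_) (Eventually.of_forall fun t => ?_)
    · simp
    · rw [Complex.re_sum]
      refine Finset.sum_congr rfl fun i _ => ?_
      rw [Complex.re_sum]
      refine Finset.sum_congr rfl fun j _ => ?_
      rw [mul_assoc, Complex.re_ofReal_mul]
      simp; try ring
  · refine (key Complex.I).congr (Eventually.of_forall fun t => ?_) (Eventually.of_forall fun t => ?_)
    · simp
    · rw [Complex.im_sum]
      refine Finset.sum_congr rfl fun i _ => ?_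
      rw [Complex.im_sum]
      refine Finset.sum_congr rfl fun j _ => ?_
      rw [mul_assoc, Complex.im_ofReal_mul]
      simp; try ring


lemma latSq_ne (n : Lat) (hn : n ≠ 0) : (latSq n : ℂ) ≠ 0 := by
  intro h
  apply hn
  have h1 : latSq n = 0 := by exact_mod_cast h
  unfold latSq at h1
  rw [Finset.sum_eq_zero_iff_of_nonneg fun i _ => sq_nonneg _] at h1
  ext i
  have := h1 i (Finset.mem_univ i)
  simpa using this

lemma latSq_cast (n : Lat) : (latSq n : ℂ) = (n 0 : ℂ) ^ 2 + (n 1 : ℂ) ^ 2 + (n 2 : ℂ) ^ 2 := by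
  unfold latSq
  rw [Fin.sum_univ_three]
  push_cast
  ring

def gam (u B : Vec → Vec) (n : Lat) (k : Fin 3) : ℂ :=
  2 * Real.pi * Complex.I * ((n (k + 1) : ℂ) * fcE u B (k + 2) n - (n (k + 2) : ℂ) * fcE u B (k + 1) n)

lemma ode_alg (n : Lat) (P : Fin 3 → Fin 3 → ℂ) (k : Fin 3) (p : ℂ) :
    ∑ i, ∑ j, ((latSq n : ℂ) * (if j = k then 1 else 0) - (n k : ℂ) * (n j : ℂ)) * (-(p * (n i : ℂ))) *
      (P i j - P j i) =
    (latSq n : ℂ) * (p * ((n (k + 1) : ℂ) * (P (k + 2 + 1) (k + 2 + 2) - P (k + 2 + 2) (k + 2 + 1)) -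
      (n (k + 2) : ℂ) * (P (k + 1 + 1) (k + 1 + 2) - P (k + 1 + 2) (k + 1 + 1)))) := by
  rw [latSq_cast]
  have a1 : (1 : Fin 3) + 1 = 2 := rfl
  have a2 : (1 : Fin 3) + 2 = 0 := rfl
  have a3 : (2 : Fin 3) + 1 = 0 := rfl
  have a4 : (2 : Fin 3) + 2 = 1 := rfl
  fin_cases k <;>
  · simp [Fin.sum_univ_three, a1, a2, a3, a4]
    ring

lemma b_ode (T : ℝ) (hT : 0 < T) (u B : ℝ → Vec → Vec)
    (hmu : Measurable (Function.uncurry u)) (hmB : Measurable (Function.uncurry B))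
    (hu2 : timeNorm ∞ T (fun t => eLpNorm (u t) 2 μT) < ∞)
    (hB2 : timeNorm ∞ T (fun t => eLpNorm (B t) 2 μT) < ∞) (hsol : MHDWeakDF T u B)
    (n : Lat) (hn : n ≠ 0) (k : Fin 3) :
    CWD T (fun t => fcV (B t) k n) (fun t => gam (u t) (B t) n k) := by
  have hL := latSq_ne n hn
  let w : Vec := WithLp.toLp 2 fun j => latSq n * (if j = k then 1 else 0) - (n k : ℝ) * (n j : ℝ)
  have hw : ∑ i, w i * (n i : ℝ) = 0 := by
    simp only [w, sub_mul, Finset.sum_sub_distrib]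
    simp only [mul_ite, mul_one, mul_zero, ite_mul, zero_mul, Finset.sum_ite_eq', Finset.mem_univ,
      if_true]
    rw [latSq, Finset.sum_mul, ← Finset.sum_sub_distrib]
    refine Finset.sum_eq_zero fun i _ => ?_
    ring
  have h := induction_fourier T hT u B hmu hmB hu2 hB2 hsol n w hw
  have hc := (CWD.const T ((latSq n : ℂ)⁻¹)).mul hT h
  have hwc : ∀ j, (w j : ℂ) = (latSq n : ℂ) * (if j = k then 1 else 0) - (n k : ℂ) * (n j : ℂ) := by
    intro j
    simp only [w]
    split_ifs <;> push_cast <;> rfl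
  refine hc.congr ?_ ?_
  · filter_upwards [divfree_fourier T hT B hmB hB2 hsol.2.2.2] with t ht
    have hd := ht n
    have : ∑ j, (w j : ℂ) * fcV (B t) j n = (latSq n : ℂ) * fcV (B t) k n -
        (n k : ℂ) * ∑ j, (n j : ℂ) * fcV (B t) j n := by
      simp only [hwc, sub_mul, Finset.sum_sub_distrib, Finset.mul_sum, mul_assoc]
      simp
    rw [this, hd, mul_zero, sub_zero, inv_mul_cancel_left₀ hL]
  · refine Eventually.of_forall fun t => ?_
    simp only [hwc, zero_mul, zero_add]
    rw [ode_alg n (fun i j => fcP (u t) (B t) i j n) k, inv_mul_cancel_left₀ hL]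
    rfl

/-- helicity density in Fourier space -/
def hd (B : Vec → Vec) (n : Lat) : ℂ := ∑ j, vecPotC (fcV B) n j * (starRingEnd ℂ) (fcV B j n)

def ED (u B : Vec → Vec) (n : Lat) : ℂ := ∑ j, fcE u B j n * (starRingEnd ℂ) (fcV B j n)

lemma hd_alg (n : Lat) (b bc E Ec : Fin 3 → ℂ) (hL : (latSq n : ℂ) ≠ 0)
    (h1 : ∑ j, (n j : ℂ) * b j = 0) (h2 : ∑ j, (n j : ℂ) * bc j = 0) :
    ∑ j, ((Complex.I / (2 * Real.pi * (latSq n : ℂ)) *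
        ((n (j + 1) : ℂ) * (2 * Real.pi * Complex.I * ((n (j + 2 + 1) : ℂ) * E (j + 2 + 2) - (n (j + 2 + 2) : ℂ) * E (j + 2 + 1)))
         - (n (j + 2) : ℂ) * (2 * Real.pi * Complex.I * ((n (j + 1 + 1) : ℂ) * E (j + 1 + 2) - (n (j + 1 + 2) : ℂ) * E (j + 1 + 1))))) * bc j
      + (Complex.I / (2 * Real.pi * (latSq n : ℂ)) * ((n (j + 1) : ℂ) * b (j + 2) - (n (j + 2) : ℂ) * b (j + 1))) *
        (-(2 * Real.pi * Complex.I) * ((n (j + 1) : ℂ) * Ec (j + 2) - (n (j + 2) : ℂ) * Ec (j + 1)))) =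
    ∑ j, E j * bc j + ∑ j, Ec j * b j := by
  have hpi : (Real.pi : ℂ) ≠ 0 := by exact_mod_cast Real.pi_ne_zero
  have a1 : (1 : Fin 3) + 1 = 2 := rfl
  have a2 : (1 : Fin 3) + 2 = 0 := rfl
  have a3 : (2 : Fin 3) + 1 = 0 := rfl
  have a4 : (2 : Fin 3) + 2 = 1 := rfl
  rw [Fin.sum_univ_three] at h1 h2
  simp only [Fin.sum_univ_three, zero_add, a1, a2, a3, a4]
  have hLc := latSq_cast n
  set L : ℂ := (latSq n : ℂ)
  have hI : Complex.I ^ 2 = -1 := Complex.I_sq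
  field_simp
  rw [hI, hLc]
  linear_combination (-((n 0 : ℂ) * E 0 + (n 1 : ℂ) * E 1 + (n 2 : ℂ) * E 2)) * h2 +
    (-((n 0 : ℂ) * Ec 0 + (n 1 : ℂ) * Ec 1 + (n 2 : ℂ) * Ec 2)) * h1

lemma hd_ode (T : ℝ) (hT : 0 < T) (u B : ℝ → Vec → Vec)
    (hmu : Measurable (Function.uncurry u)) (hmB : Measurable (Function.uncurry B))
    (hu2 : timeNorm ∞ T (fun t => eLpNorm (u t) 2 μT) < ∞)
    (hB2 : timeNorm ∞ T (fun t => eLpNorm (B t) 2 μT) < ∞) (hsol : MHDWeakDF T u B)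
    (hmean : ∀ᵐ t ∂tIoo T, ∀ j : Fin 3, fcV (B t) j 0 = 0) (n : Lat) :
    CWD T (fun t => hd (B t) n)
      (fun t => ED (u t) (B t) n + (starRingEnd ℂ) (ED (u t) (B t) n)) := by
  by_cases hn : n = 0
  · subst hn
    refine (CWD.const T 0).congr ?_ ?_
    · refine Eventually.of_forall fun t => ?_
      simp [hd, vecPotC]
    · filter_upwards [hmean] with t ht
      simp [ED, ht]
  have hL := latSq_ne n hn
  have hb := b_ode T hT u B hmu hmB hu2 hB2 hsol n hn
  have hm1 := CWD.const T (-1)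
  have h := CWD.sum hT (Finset.univ : Finset (Fin 3)) fun j _ =>
    ((CWD.const T (Complex.I / (2 * Real.pi * (latSq n : ℂ)))).mul hT
      (((CWD.const T (n (j + 1) : ℂ)).mul hT (hb (j + 2))).add hT
        (hm1.mul hT ((CWD.const T (n (j + 2) : ℂ)).mul hT (hb (j + 1)))))).mul hT ((hb j).conj hT)
  refine h.congr ?_ ?_
  · refine Eventually.of_forall fun t => ?_
    unfold hd vecPotC
    simp only [if_neg hn]
    refine Finset.sum_congr rfl fun j _ => ?_
    ring
  · filter_upwards [divfree_fourier T hT B hmB hB2 hsol.2.2.2] with t ht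
    have h1 := ht n
    have h2 : ∑ j, (n j : ℂ) * (starRingEnd ℂ) (fcV (B t) j n) = 0 := by
      have := congrArg (starRingEnd ℂ) h1
      simpa [map_sum] using this
    have := hd_alg n (fun j => fcV (B t) j n) (fun j => (starRingEnd ℂ) (fcV (B t) j n))
      (fun j => fcE (u t) (B t) j n) (fun j => (starRingEnd ℂ) (fcE (u t) (B t) j n)) hL h1 h2
    unfold ED
    simp only [map_sum, map_mul, Complex.conj_conj]
    rw [← this]
    refine Finset.sum_congr rfl fun j _ => ?_
    simp only [gam, map_mul, map_sub, Complex.conj_I, Complex.conj_ofReal, map_intCast, map_ofNat]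
    ring


/-! ### Final assembly -/

lemma norm_vecPot_le (c : Fin 3 → Lat → ℂ) (n : Lat) (j : Fin 3) :
    ‖vecPotC c n j‖ ≤ ‖c (j + 2) n‖ + ‖c (j + 1) n‖ := by
  unfold vecPotC
  split_ifs with hn
  · simp only [norm_zero]
    positivity
  have hL0 : 0 ≤ latSq n := Finset.sum_nonneg fun i _ => sq_nonneg _
  have hL1 : latSq n ≠ 0 := fun h => latSq_ne n hn (by rw [h]; simp)
  have hL : 0 < latSq n := lt_of_le_of_ne hL0 (Ne.symm hL1)
  have habs : ∀ i, ‖(n i : ℂ)‖ ≤ latSq n := by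
    intro i
    rw [Complex.norm_intCast]
    have h1 : ((n i : ℝ)) ^ 2 ≤ latSq n :=
      Finset.single_le_sum (f := fun i => ((n i : ℝ)) ^ 2) (fun i _ => sq_nonneg _) (Finset.mem_univ i)
    refine le_trans ?_ h1
    rw [← sq_abs]
    by_cases h0 : n i = 0
    · simp [h0]
    · have h3 : (1 : ℝ) ≤ |(n i : ℝ)| := by exact_mod_cast Int.one_le_abs h0
      nlinarith
  have hpi : (1 : ℝ) ≤ 2 * Real.pi := by
    have := Real.pi_gt_three
    linarith
  rw [norm_div, norm_mul, Complex.norm_I, one_mul]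
  have hden : ‖(2 * Real.pi * (latSq n : ℂ) : ℂ)‖ = 2 * Real.pi * latSq n := by
    have : (2 * Real.pi * (latSq n : ℂ) : ℂ) = ((2 * Real.pi * latSq n : ℝ) : ℂ) := by push_cast; rfl
    rw [this, Complex.norm_real, Real.norm_of_nonneg (by positivity)]
  rw [hden, div_le_iff₀ (by positivity)]
  refine (norm_sub_le _ _).trans ?_
  rw [norm_mul, norm_mul]
  have e1 := mul_le_mul_of_nonneg_right (habs (j + 1)) (norm_nonneg (c (j + 2) n))
  have e2 := mul_le_mul_of_nonneg_right (habs (j + 2)) (norm_nonneg (c (j + 1) n))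
  have e3 : latSq n ≤ 2 * Real.pi * latSq n := by nlinarith
  have e4 : 0 ≤ ‖c (j + 2) n‖ + ‖c (j + 1) n‖ := by positivity
  have e5 := mul_le_mul_of_nonneg_left e3 e4
  nlinarith

lemma summable_fcV_sq (B : Vec → Vec) (hB : MemLp B 2 μT) (j : Fin 3) :
    Summable fun n => ‖fcV B j n‖ ^ 2 := by
  have h := (parseval_conj _ _ (memLp_comp B hB j) (memLp_comp B hB j)).summable.norm
  refine h.congr fun n => ?_
  rw [norm_mul, RCLike.norm_conj, sq]
  rfl

lemma norm_hd_le (B : Vec → Vec) (n : Lat) : ‖hd B n‖ ≤ 2 * ∑ j, ‖fcV B j n‖ ^ 2 := by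
  unfold hd
  have h : ∀ j : Fin 3, ‖vecPotC (fcV B) n j * (starRingEnd ℂ) (fcV B j n)‖ ≤
      (‖fcV B (j + 2) n‖ + ‖fcV B (j + 1) n‖) * ‖fcV B j n‖ := by
    intro j
    rw [norm_mul, RCLike.norm_conj]
    exact mul_le_mul_of_nonneg_right (norm_vecPot_le _ _ _) (norm_nonneg _)
  refine (norm_sum_le _ _).trans ((Finset.sum_le_sum fun j _ => h j).trans ?_)
  have a1 : (1 : Fin 3) + 1 = 2 := rfl
  have a2 : (1 : Fin 3) + 2 = 0 := rfl
  have a3 : (2 : Fin 3) + 1 = 0 := rfl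
  have a4 : (2 : Fin 3) + 2 = 1 := rfl
  simp only [Fin.sum_univ_three, zero_add, a1, a2, a3, a4]
  nlinarith [sq_nonneg (‖fcV B 0 n‖ - ‖fcV B 1 n‖), sq_nonneg (‖fcV B 0 n‖ - ‖fcV B 2 n‖),
    sq_nonneg (‖fcV B 2 n‖ - ‖fcV B 1 n‖)]

lemma summable_hd (B : Vec → Vec) (hB : MemLp B 2 μT) : Summable fun n => ‖hd B n‖ := by
  refine Summable.of_nonneg_of_le (fun n => norm_nonneg _) (norm_hd_le B) ?_
  exact (summable_sum fun j _ => summable_fcV_sq B hB j).mul_left 2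

/-- mollified helicity -/
def HJ {R : ℕ} (Kr : Ker R) (b : Finset Lat) (B : Vec → Vec) : ℂ :=
  ∑ n ∈ b, ((Kr.m n * Kr.m n : ℝ) : ℂ) * hd B n

lemma HJ_tendsto (Kr : ∀ J : ℕ, Ker (2 ^ (J + 1))) (B : Vec → Vec) (hB : MemLp B 2 μT) :
    Tendsto (fun J => HJ (Kr J) (ballF (J + 1 + 1)) B) atTop (𝓝 (magHel B)) := by
  have e : ∀ J, HJ (Kr J) (ballF (J + 1 + 1)) B =
      ∑' n, (((Kr J).m n * (Kr J).m n : ℝ) : ℂ) * hd B n := by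
    intro J
    unfold HJ
    rw [tsum_eq_sum]
    intro n hn
    rw [ker_supp (J + 1) (Kr J) n hn]
    simp
  simp_rw [e]
  have hm : magHel B = ∑' n, hd B n := rfl
  rw [hm]
  refine tendsto_tsum_of_dominated_convergence (summable_hd B hB) ?_ ?_
  · intro n
    have hlim : Tendsto (fun J : ℕ => 20 * latSq n / (((2 ^ (J + 1) : ℕ) : ℝ)) ^ 2) atTop (𝓝 0) := by
      refine Tendsto.div_atTop tendsto_const_nhds ?_
      refine (tendsto_pow_atTop (by norm_num)).comp ?_
      push_cast
      exact (tendsto_pow_atTop_atTop_of_one_lt (by norm_num : (1:ℝ) < 2)).comp (tendsto_add_atTop_nat 1)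
    have h1 : Tendsto (fun J => 1 - (Kr J).m n) atTop (𝓝 0) :=
      squeeze_zero_norm (fun J => (Kr J).near n) hlim
    have h2 : Tendsto (fun J => (Kr J).m n) atTop (𝓝 1) := by
      have := (tendsto_const_nhds (x := (1:ℝ))).sub h1
      simpa using this
    have h3 := h2.mul h2
    have h4 := (Complex.continuous_ofReal.tendsto _).comp h3
    have h5 := h4.mul_const (hd B n)
    simpa using h5
  · refine Eventually.of_forall fun J n => ?_
    rw [norm_mul, Complex.norm_real, norm_mul]
    have h1 := (Kr J).le1 n
    rw [← Real.norm_eq_abs] at h1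
    have h2 : ‖(Kr J).m n‖ * ‖(Kr J).m n‖ ≤ 1 := mul_le_one₀ h1 (norm_nonneg _) h1
    exact mul_le_of_le_one_left (norm_nonneg _) h2

lemma HJ_ode {R : ℕ} (Kr : Ker R) (b : Finset Lat) (T : ℝ) (hT : 0 < T) (u B : ℝ → Vec → Vec)
    (h : ∀ n, CWD T (fun t => hd (B t) n)
      (fun t => ED (u t) (B t) n + (starRingEnd ℂ) (ED (u t) (B t) n))) :
    CWD T (fun t => HJ Kr b (B t))
      (fun t => SN Kr b (u t) (B t) + (starRingEnd ℂ) (SN Kr b (u t) (B t))) := by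
  have h1 := CWD.sum hT b fun n _ => (CWD.const T ((Kr.m n * Kr.m n : ℝ) : ℂ)).mul hT (h n)
  refine h1.congr ?_ ?_
  · exact Eventually.of_forall fun t => rfl
  · refine Eventually.of_forall fun t => ?_
    have : SN Kr b (u t) (B t) = ∑ n ∈ b, ((Kr.m n * Kr.m n : ℝ) : ℂ) * ED (u t) (B t) n := rfl
    rw [this, map_sum, ← Finset.sum_add_distrib]
    refine Finset.sum_congr rfl fun n _ => ?_
    rw [map_mul, Complex.conj_ofReal]
    ring

lemma measurable_tpNorm (s : Finset Lat) (c : ℝ → Lat → ℂ) (hc : ∀ n, Measurable fun t => c t n) :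
    Measurable fun t => eLpNorm (fun x => ∑ n ∈ s, c t n * chr n x) 4 μT := by
  have h : ∀ t, eLpNorm (fun x => ∑ n ∈ s, c t n * chr n x) 4 μT =
      (∫⁻ x, ‖∑ n ∈ s, c t n * chr n x‖ₑ ^ (4 : ℝ≥0∞).toReal ∂μT) ^ (1 / (4 : ℝ≥0∞).toReal) := fun t =>
    eLpNorm_eq_lintegral_rpow_enorm_toReal (by norm_num) (by norm_num)
  simp_rw [h]
  refine Measurable.pow_const ?_ _
  refine Measurable.lintegral_prod_right' (f := fun p : ℝ × Vec =>
    ‖∑ n ∈ s, c p.1 n * chr n p.2‖ₑ ^ (4 : ℝ≥0∞).toReal) ?_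
  refine Measurable.pow_const (Measurable.enorm ?_) _
  refine Finset.measurable_fun_sum s fun n _ => ?_
  exact ((hc n).comp measurable_fst).mul ((measurable_chr n).comp measurable_snd)

lemma measurable_besovV (s : ℝ) (B : ℝ → Vec → Vec) (hB : Measurable (Function.uncurry B)) :
    Measurable fun t => besovV s 4 ∞ (B t) := by
  unfold besovV
  refine Finset.measurable_fun_sum _ fun j _ => ?_
  have hc := measurable_fcV B hB j
  change Measurable fun t => besovC s 4 ∞ (fcV (B t) j)
  unfold besovC
  simp only [if_true, lpLow_eq, lpBlock_eq]
  refine (measurable_tpNorm _ _ hc).add ?_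
  refine Measurable.iSup fun k => ?_
  exact (measurable_tpNorm _ _ hc).const_mul _

lemma timeNorm_two (T : ℝ) (F : ℝ → ℝ≥0∞) (hF : Measurable F) (h : timeNorm 2 T F < ∞) :
    (∀ᵐ t ∂tIoo T, F t ≠ ∞) ∧ Integrable (fun t => (F t).toReal ^ 2) (tIoo T) := by
  unfold timeNorm at h
  rw [if_neg (by norm_num)] at h
  have hfin : ∫⁻ t, F t ^ (2 : ℝ≥0∞).toReal ∂tIoo T ≠ ∞ := by
    intro h'
    rw [h'] at h
    simp at h
  have hm : Measurable fun t => F t ^ (2 : ℝ≥0∞).toReal := hF.pow_const _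
  constructor
  · filter_upwards [ae_lt_top hm hfin] with t ht h'
    rw [h'] at ht
    simp at ht
  · have := integrable_toReal_of_lintegral_ne_top hm.aemeasurable hfin
    refine this.congr (Eventually.of_forall fun t => ?_)
    simp [ENNReal.toReal_pow]

lemma main_aux
    (T α₁ α₂ : ℝ) (hT : 0 < T) (h1 : 0 < α₁) (h12 : α₁ < α₂) (h2 : α₂ < 1)
    (u B : ℝ → Vec → Vec)
    (hmu : Measurable (Function.uncurry u)) (hmB : Measurable (Function.uncurry B))
    (hu2 : timeNorm ∞ T (fun t => eLpNorm (u t) 2 μT) < ∞)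
    (hB2 : timeNorm ∞ T (fun t => eLpNorm (B t) 2 μT) < ∞)
    (hsol : MHDWeakDF T u B)
    (hmean : ∀ᵐ t ∂tIoo T, ∀ j : Fin 3, fcV (B t) j 0 = 0)
    (hureg : timeNorm 2 T (fun t => besovV α₂ 4 ∞ (u t)) < ∞)
    (hBreg : timeNorm 2 T (fun t => besovV (-α₁) 4 ∞ (B t)) < ∞) :
    ∀ᵐ t₁ ∂tIoo T, ∀ᵐ t₂ ∂tIoo T, magHel (B t₁) = magHel (B t₂) := by
  set θ := (α₁ + α₂) / 2 with hθ
  have hθ1 : α₁ < θ := by rw [hθ]; linarith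
  have hθ2 : θ < α₂ := by rw [hθ]; linarith
  have hK : ∀ J : ℕ, Nonempty (Ker (2 ^ (J + 1))) := fun J => exists_ker _ (by
    calc 2 = 2 ^ 1 := by norm_num
      _ ≤ 2 ^ (J + 1) := Nat.pow_le_pow_right (by norm_num) (by omega))
  let Kr : ∀ J : ℕ, Ker (2 ^ (J + 1)) := fun J => (hK J).some
  obtain ⟨hXf, hXi⟩ := timeNorm_two T _ (measurable_besovV α₂ u hmu) hureg
  obtain ⟨hYf, hYi⟩ := timeNorm_two T _ (measurable_besovV (-α₁) B hmB) hBreg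
  obtain ⟨Mu, hMu0, hMu⟩ := ae_memLp T u hmu hu2
  obtain ⟨M, hM0, hM⟩ := ae_memLp T B hmB hB2
  let k0 : ℝ → ℝ := fun t => (besovV α₂ 4 ∞ (u t)).toReal ^ 2 + (besovV (-α₁) 4 ∞ (B t)).toReal ^ 2
  have hk0 : Integrable k0 (tIoo T) := hXi.add hYi
  have hode := hd_ode T hT u B hmu hmB hu2 hB2 hsol hmean
  have hJ : ∀ J : ℕ, ∀ᵐ t₁ ∂tIoo T, ∀ᵐ t₂ ∂tIoo T,
      ‖HJ (Kr J) (ballF (J + 1 + 1)) (B t₂) - HJ (Kr J) (ballF (J + 1 + 1)) (B t₁)‖ ≤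
        2 * ∫ t, (6 * epsJ α₁ α₂ θ (J + 1) * M) * k0 t ∂tIoo T := by
    intro J
    refine (HJ_ode (Kr J) (ballF (J + 1 + 1)) T hT u B hode).bound hT _ (hk0.const_mul _) ?_
    filter_upwards [hXf, hYf, hMu, hM] with t hx hy hu hb
    have hS := SN_bound (J + 1) (Kr J) (u t) (B t) hu.1 hb.1 α₁ α₂ θ h1 hθ1 hθ2 h2 hx hy
    refine (norm_add_le _ _).trans ?_
    rw [RCLike.norm_conj]
    have he := epsJ_nonneg α₁ α₂ θ hθ2 (J + 1)
    set e := epsJ α₁ α₂ θ (J + 1)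
    simp only [k0]
    set X := (besovV α₂ 4 ∞ (u t)).toReal with hX
    set Y := (besovV (-α₁) 4 ∞ (B t)).toReal with hY
    have hX0 : 0 ≤ X := ENNReal.toReal_nonneg
    have hY0 : 0 ≤ Y := ENNReal.toReal_nonneg
    have e1 : e * X * Y * (eLpNorm (B t) 2 μT).toReal ≤ e * X * Y * M :=
      mul_le_mul_of_nonneg_left hb.2 (by positivity)
    have e2 : (e * M) * (2 * X * Y) ≤ (e * M) * (X ^ 2 + Y ^ 2) :=
      mul_le_mul_of_nonneg_left (two_mul_le_add_sq X Y) (by positivity)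
    nlinarith
  have hJ' := ae_all_iff.2 hJ
  filter_upwards [hJ', hM] with t₁ ht₁ hb₁
  filter_upwards [ae_all_iff.2 ht₁, hM] with t₂ ht₂ hb₂
  have l1 := HJ_tendsto Kr (B t₁) hb₁.1
  have l2 := HJ_tendsto Kr (B t₂) hb₂.1
  have l3 := l2.sub l1
  have l4 : Tendsto (fun J => 2 * ∫ t, (6 * epsJ α₁ α₂ θ (J + 1) * M) * k0 t ∂tIoo T) atTop (𝓝 0) := by
    simp_rw [integral_const_mul]
    have h := (epsJ_tendsto α₁ α₂ θ hθ1).comp (tendsto_add_atTop_nat 1)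
    have := (((h.const_mul 6).mul_const M).mul_const (∫ t, k0 t ∂tIoo T)).const_mul 2
    simpa using this
  have l5 := squeeze_zero_norm ht₂ l4
  have := tendsto_nhds_unique l3 l5
  exact (sub_eq_zero.1 this).symm

end PaperHelicity

namespace PaperHelicity

/-- conservation of magnetic helicity for weak solutions of the ideal MHD
equations with `u ∈ L²((0,T); B^{α₂}_{4,∞})`, `B ∈ L²((0,T); B^{-α₁}_{4,∞})` and
`0 < α₁ < α₂ < 1`. -/
theorem magnetic_helicity_conservation_MHD
    (T α₁ α₂ : ℝ) (hT : 0 < T) (h1 : 0 < α₁) (h12 : α₁ < α₂) (h2 : α₂ < 1)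
    (u B : ℝ → Vec → Vec)
    (hmu : Measurable (Function.uncurry u)) (hmB : Measurable (Function.uncurry B))
    (hpu : ∀ t, Per (u t)) (hpB : ∀ t, Per (B t))
    (hu2 : timeNorm ∞ T (fun t => eLpNorm (u t) 2 μT) < ∞)
    (hB2 : timeNorm ∞ T (fun t => eLpNorm (B t) 2 μT) < ∞)
    (hsol : MHDWeakDF T u B)
    (hmean : ∀ᵐ t ∂tIoo T, ∀ j : Fin 3, fcV (B t) j 0 = 0)
    (hureg : timeNorm 2 T (fun t => besovV α₂ 4 ∞ (u t)) < ∞)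
    (hBreg : timeNorm 2 T (fun t => besovV (-α₁) 4 ∞ (B t)) < ∞) :
    ∀ᵐ t₁ ∂tIoo T, ∀ᵐ t₂ ∂tIoo T, magHel (B t₁) = magHel (B t₂) := by
  exact main_aux T α₁ α₂ hT h1 h12 h2 u B hmu hmB hu2 hB2 hsol hmean hureg hBreg

end PaperHelicity
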